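/- arXiv:1401.7704 — 2 statements merged into one kernel-verified Lean document; each statement's English description precedes it below -/
import Mathlib

section
/- Let R ≥ 2 and let J ∈ M_R (a whole-line Jacobi matrix with ‖J‖ ≤ R, reflectionless on (−2,2)) with coefficients a_n, b_n, and suppose J is not the free Jacobi matrix. Then a_n > 1 for all n ∈ ℤ, and for all n ∈ ℤ one has r² < (a_{n+1}² − 1)/(a_n² − 1) < 1/r². -/
open MeasureTheory Complex Filter Set

noncomputable section

/-- A Herglotz function: a holomorphic map from the open upper half plane to itself. -/
def IsHerglotz (m : ℂ → ℂ) : Prop :=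
  DifferentiableOn ℂ m {z : ℂ | 0 < z.im} ∧ ∀ z : ℂ, 0 < z.im → 0 < (m z).im

/-- `f` is a solution of the difference equation
`a_n f(n+1) + a_{n-1} f(n-1) + b_n f(n) = z f(n)` on `ℤ`. -/
def JacobiSolution (a b : ℤ → ℝ) (z : ℂ) (f : ℤ → ℂ) : Prop :=
  ∀ n : ℤ, (a n : ℂ) * f (n + 1) + (a (n - 1) : ℂ) * f (n - 1) + (b n : ℂ) * f n = z * f n

/-- `f : ℤ → ℂ` is square summable near `+∞`. -/
def SquareSummableAtTop (f : ℤ → ℂ) : Prop := Summable fun n : ℕ => ‖f (n : ℤ)‖ ^ 2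

/-- `f : ℤ → ℂ` is square summable near `-∞`. -/
def SquareSummableAtBot (f : ℤ → ℂ) : Prop := Summable fun n : ℕ => ‖f (-(n : ℤ))‖ ^ 2

/-- `m` is the half-line `m`-function `m₊` of the whole-line Jacobi matrix with
coefficients `a, b`: `m₊(z) = -f₊(1,z)/(a₀ f₊(0,z))`, where `f₊(·,z)` is a nontrivial
solution that is square summable near `+∞`. -/
def IsJacobiMPlus (a b : ℤ → ℝ) (m : ℂ → ℂ) : Prop :=
  ∀ z : ℂ, 0 < z.im → ∃ f : ℤ → ℂ, JacobiSolution a b z f ∧ SquareSummableAtTop f ∧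
    f 0 ≠ 0 ∧ m z = -(f 1 / ((a 0 : ℂ) * f 0))

/-- `m` is the half-line `m`-function `m₋` of the whole-line Jacobi matrix with
coefficients `a, b`: `m₋(z) = f₋(1,z)/(a₀ f₋(0,z))`, where `f₋(·,z)` is a nontrivial
solution that is square summable near `-∞`. -/
def IsJacobiMMinus (a b : ℤ → ℝ) (m : ℂ → ℂ) : Prop :=
  ∀ z : ℂ, 0 < z.im → ∃ f : ℤ → ℂ, JacobiSolution a b z f ∧ SquareSummableAtBot f ∧
    f 0 ≠ 0 ∧ m z = f 1 / ((a 0 : ℂ) * f 0)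

/-- The pair `(m₊, m₋)` is reflectionless on `(-2,2)`:
`m₊(x) = -conj(m₋(x))` for Lebesgue-a.e. `x ∈ (-2,2)` (boundary values). -/
def ReflectionlessOn22 (mp mm : ℂ → ℂ) : Prop :=
  ∀ᵐ x : ℝ, x ∈ Set.Ioo (-2:ℝ) 2 →
    Tendsto (fun y : ℝ => mp (↑x + ↑y * I) + starRingEnd ℂ (mm (↑x + ↑y * I)))
      (nhdsWithin 0 (Set.Ioi 0)) (nhds 0)

/-- The whole-line Jacobi matrix with coefficients `a, b` is reflectionless on `(-2,2)`. -/
def JacobiReflectionless (a b : ℤ → ℝ) : Prop :=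
  ∃ mp mm : ℂ → ℂ, IsJacobiMPlus a b mp ∧ IsJacobiMMinus a b mm ∧ ReflectionlessOn22 mp mm

/-- `T` is the bounded operator on `ℓ²(ℤ)` given by the Jacobi matrix with
coefficients `a, b`: `(Tu)_n = a_n u_{n+1} + a_{n-1} u_{n-1} + b_n u_n`. -/
def IsJacobiOperator (a b : ℤ → ℝ)
    (T : lp (fun _ : ℤ => ℂ) 2 →L[ℂ] lp (fun _ : ℤ => ℂ) 2) : Prop :=
  ∀ u : lp (fun _ : ℤ => ℂ) 2, ∀ n : ℤ,
    T u n = (a n : ℂ) * u (n + 1) + (a (n - 1) : ℂ) * u (n - 1) + (b n : ℂ) * u n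

/-- `J ∈ M_R`: the whole-line Jacobi matrix with coefficients `a, b` (with `a_n > 0`)
defines a bounded operator of norm `≤ R` and is reflectionless on `(-2,2)`. -/
def MemMR (R : ℝ) (a b : ℤ → ℝ) : Prop :=
  (∀ n : ℤ, 0 < a n) ∧
  (∃ T : lp (fun _ : ℤ => ℂ) 2 →L[ℂ] lp (fun _ : ℤ => ℂ) 2,
    IsJacobiOperator a b T ∧ ‖T‖ ≤ R) ∧
  JacobiReflectionless a b

/-- The domain `Ω = ℂ⁺ ∪ (-2,2) ∪ ℂ⁻`. -/
def Omega22 : Set ℂ := {z : ℂ | z.im ≠ 0 ∨ (-2 < z.re ∧ z.re < 2)}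

/-- `F` is the `F` function of the Jacobi matrix with coefficients `a, b`, reflectionless on
`(-2,2)`: `F(λ) = M(-λ - 1/λ)` on `ℂ⁺`, where `M : Ω → ℂ⁺` is the holomorphic continuation
of `m₊` to `Ω = ℂ⁺ ∪ (-2,2) ∪ ℂ⁻`. -/
def IsFFunction (a b : ℤ → ℝ) (F : ℂ → ℂ) : Prop :=
  ∃ mp M : ℂ → ℂ, IsJacobiMPlus a b mp ∧
    DifferentiableOn ℂ M Omega22 ∧
    (∀ z ∈ Omega22, 0 < (M z).im) ∧
    (∀ z : ℂ, 0 < z.im → M z = mp z) ∧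
    (∀ l : ℂ, 0 < l.im → F l = M (-l - 1/l))


lemma rl_morera {U : Set ℂ} (hU : IsOpen U) {P : ℂ → ℂ} (hc : ContinuousOn P U)
    (hd : ∀ z ∈ U, z.im ≠ 0 → DifferentiableAt ℂ P z) : DifferentiableOn ℂ P U := by
  apply (isConservativeOn_and_continuousOn_iff_isDifferentiableOn hU).1 ⟨?_, hc⟩
  intro z w hzw
  rw [← add_eq_zero_iff_eq_neg, wedgeIntegral_add_wedgeIntegral_eq]
  have key : ∀ y1 y2 : ℝ, uIcc y1 y2 ⊆ uIcc z.im w.im →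
      (0:ℝ) ∉ Ioo (min y1 y2) (max y1 y2) →
      (∫ x : ℝ in z.re..w.re, P (x + y1 * I)) - (∫ x : ℝ in z.re..w.re, P (x + y2 * I)) +
      I • (∫ y : ℝ in y1..y2, P (w.re + y * I)) -
      I • (∫ y : ℝ in y1..y2, P (z.re + y * I)) = 0 := by
    intro y1 y2 hy h0
    have h := integral_boundary_rect_eq_zero_of_continuousOn_of_differentiableOn P
      (z.re + y1 * I) (w.re + y2 * I) ?_ ?_
    · simpa using h
    · refine hc.mono (Subset.trans ?_ hzw)
      intro p hp
      simp [mem_reProdIm] at hp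
      simp only [Rectangle, mem_reProdIm]
      exact ⟨hp.1, hy hp.2⟩
    · intro p hp
      simp [mem_reProdIm] at hp
      refine (hd p (hzw ?_) ?_).differentiableWithinAt
      · simp only [Rectangle, mem_reProdIm]
        refine ⟨?_, hy ?_⟩
        · rw [mem_uIcc]; rcases hp.1 with ⟨h1, h2⟩
          rcases le_total z.re w.re with h | h <;> grind
        · rw [mem_uIcc]; rcases hp.2 with ⟨h1, h2⟩
          rcases le_total y1 y2 with h | h <;> grind
      · intro hp0
        apply h0
        rw [← hp0]
        exact ⟨by simpa using hp.2.1, by simpa using hp.2.2⟩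
  by_cases h0 : (0:ℝ) ∈ Ioo (min z.im w.im) (max z.im w.im)
  · have h0' : (0:ℝ) ∈ uIcc z.im w.im := ⟨h0.1.le, h0.2.le⟩
    have k1 := key z.im 0 (uIcc_subset_uIcc_left h0') (by
      simp only [mem_Ioo, not_and_or, not_lt]
      rcases le_total z.im 0 with h | h
      · right; simp [h]
      · left; simp [h])
    have k2 := key 0 w.im (uIcc_subset_uIcc_right h0') (by
      simp only [mem_Ioo, not_and_or, not_lt]
      rcases le_total w.im 0 with h | h
      · right; simp [h]
      · left; simp [h])
    have ii : ∀ x ∈ uIcc z.re w.re, ∀ y1 y2 : ℝ, uIcc y1 y2 ⊆ uIcc z.im w.im →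
        IntervalIntegrable (fun y : ℝ => P (x + y * I)) volume y1 y2 := by
      intro x hx y1 y2 hy
      apply ContinuousOn.intervalIntegrable
      apply hc.comp (by fun_prop)
      intro y hyy
      apply hzw
      simp only [Rectangle, mem_reProdIm]
      exact ⟨by simpa using hx, by simpa using hy hyy⟩
    rw [← intervalIntegral.integral_add_adjacent_intervals
        (ii w.re right_mem_uIcc z.im 0 (uIcc_subset_uIcc_left h0'))
        (ii w.re right_mem_uIcc 0 w.im (uIcc_subset_uIcc_right h0')),
      ← intervalIntegral.integral_add_adjacent_intervals
        (ii z.re left_mem_uIcc z.im 0 (uIcc_subset_uIcc_left h0'))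
        (ii z.re left_mem_uIcc 0 w.im (uIcc_subset_uIcc_right h0'))]
    simp only [smul_add]
    linear_combination k1 + k2
  · exact key z.im w.im Subset.rfl h0


lemma rl_meas {C : ℂ → ℂ} (hC0 : ∀ z : ℂ, z.im = 0 → C z = 0)
    (hCd : ∀ z : ℂ, z.im ≠ 0 → DifferentiableAt ℂ C z) : Measurable C := by
  classical
  have hs : MeasurableSet {z : ℂ | z.im ≠ 0} :=
    (isOpen_ne_fun Complex.continuous_im continuous_const).measurableSet
  have h : C = ({z : ℂ | z.im ≠ 0}).piecewise C (fun _ => 0) := by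
    ext z
    by_cases hz : z.im = 0
    · simp [Set.piecewise, hz, hC0 z hz]
    · simp [Set.piecewise, hz]
  rw [h]
  refine ContinuousOn.measurable_piecewise ?_ continuousOn_const hs
  intro z hz
  exact (hCd z hz).continuousAt.continuousWithinAt

lemma rl_rect {C : ℂ → ℂ} (hCd : ∀ z : ℂ, z.im ≠ 0 → DifferentiableAt ℂ C z)
    (x1 x2 y1 y2 : ℝ) (hy : 0 < y1 * y2) :
    (∫ x : ℝ in x1..x2, C (x + y1 * I)) - (∫ x : ℝ in x1..x2, C (x + y2 * I)) +
      I * (∫ y : ℝ in y1..y2, C (x2 + y * I)) -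
      I * (∫ y : ℝ in y1..y2, C (x1 + y * I)) = 0 := by
  have h := integral_boundary_rect_eq_zero_of_differentiableOn C
      (x1 + y1 * I) (x2 + y2 * I) ?_
  · simpa using h
  · intro p hp
    simp [mem_reProdIm] at hp
    refine (hCd p ?_).differentiableWithinAt
    intro h0
    have h2 := hp.2
    rw [h0, mem_uIcc] at h2
    rcases h2 with h | h
    · nlinarith
    · nlinarith

lemma rl_Q {C : ℂ → ℂ} (hC0 : ∀ z : ℂ, z.im = 0 → C z = 0)
    (hCd : ∀ z : ℂ, z.im ≠ 0 → DifferentiableAt ℂ C z) (hb : ∀ z, ‖C z‖ ≤ 1)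
    (hj : ∀ᵐ x : ℝ, x ∈ Set.Ioo (-2:ℝ) 2 →
      Tendsto (fun y : ℝ => C (x + y * I) - C (x - y * I)) (nhdsWithin 0 (Set.Ioi 0)) (nhds 0))
    (x1 x2 : ℝ) (hx1 : x1 ∈ Ioo (-2:ℝ) 2) (hx2 : x2 ∈ Ioo (-2:ℝ) 2)
    (y1 y2 : ℝ) (hy1 : y1 ≠ 0) (hy2 : y2 ≠ 0) :
    (∫ x : ℝ in x1..x2, C (x + y1 * I)) - (∫ x : ℝ in x1..x2, C (x + y2 * I)) +
      I * (∫ y : ℝ in y1..y2, C (x2 + y * I)) -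
      I * (∫ y : ℝ in y1..y2, C (x1 + y * I)) = 0 := by
  have hm := rl_meas hC0 hCd
  have iiv : ∀ (x y1 y2 : ℝ), IntervalIntegrable (fun t : ℝ => C (x + t * I)) volume y1 y2 := by
    intro x y1 y2
    refine (intervalIntegrable_const (c := (1:ℝ))).mono_fun' ?_ ?_
    · exact (hm.comp (by fun_prop)).aestronglyMeasurable
    · exact Eventually.of_forall fun t => hb _
  have iih : ∀ (y x1 x2 : ℝ), IntervalIntegrable (fun t : ℝ => C (t + y * I)) volume x1 x2 := by
    intro y x1 x2
    refine (intervalIntegrable_const (c := (1:ℝ))).mono_fun' ?_ ?_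
    · exact (hm.comp (by fun_prop)).aestronglyMeasurable
    · exact Eventually.of_forall fun t => hb _
  -- defect
  set E : ℝ → ℝ → ℂ := fun y1 y2 =>
    (∫ x : ℝ in x1..x2, C (x + y1 * I)) - (∫ x : ℝ in x1..x2, C (x + y2 * I)) +
      I * (∫ y : ℝ in y1..y2, C (x2 + y * I)) -
      I * (∫ y : ℝ in y1..y2, C (x1 + y * I)) with hE
  have hadd : ∀ u v w : ℝ, E u v + E v w = E u w := by
    intro u v w
    simp only [hE]
    rw [← intervalIntegral.integral_add_adjacent_intervals (iiv x2 u v) (iiv x2 v w),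
      ← intervalIntegral.integral_add_adjacent_intervals (iiv x1 u v) (iiv x1 v w)]
    ring
  have hsame : ∀ u v : ℝ, 0 < u * v → E u v = 0 := fun u v h => rl_rect hCd x1 x2 u v h
  -- limit
  have hlim : Tendsto (fun e : ℝ => E e (-e)) (nhdsWithin 0 (Set.Ioi 0)) (nhds 0) := by
    have t1 : Tendsto (fun e : ℝ => ∫ x : ℝ in x1..x2, (C (x + e * I) - C (x - e * I)))
        (nhdsWithin 0 (Set.Ioi 0)) (nhds (∫ x : ℝ in x1..x2, (0:ℂ))) := by
      refine intervalIntegral.tendsto_integral_filter_of_dominated_convergence (fun _ => (2:ℝ))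
        ?_ ?_ ?_ ?_
      · exact Eventually.of_forall fun e =>
          ((hm.comp (by fun_prop)).sub (hm.comp (by fun_prop))).aestronglyMeasurable
      · refine Eventually.of_forall fun e => Eventually.of_forall fun x _ => ?_
        refine (norm_sub_le _ _).trans ?_
        linarith [hb (x + e * I), hb (x - e * I)]
      · exact intervalIntegrable_const
      · filter_upwards [hj] with x hx hxm
        apply hx
        rw [uIoc, mem_Ioc] at hxm
        constructor
        · rcases le_total x1 x2 with h | h <;> simp [h] at hxm <;> linarith [hx1.1, hx2.1]
        · rcases le_total x1 x2 with h | h <;> simp [h] at hxm <;> linarith [hx1.2, hx2.2]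
    have t2 : ∀ x : ℝ, Tendsto (fun e : ℝ => ∫ y : ℝ in e..(-e), C (x + y * I))
        (nhdsWithin 0 (Set.Ioi 0)) (nhds 0) := by
      intro x
      have : Tendsto (fun e : ℝ => 1 * |(-e) - e|) (nhdsWithin 0 (Set.Ioi 0)) (nhds 0) := by
        have : Tendsto (fun e : ℝ => 1 * |(-e) - e|) (nhds 0) (nhds (1 * |(-0) - 0|)) := by
          apply Continuous.tendsto; fun_prop
        simpa using this.mono_left nhdsWithin_le_nhds
      refine squeeze_zero_norm (fun e => ?_) this
      exact intervalIntegral.norm_integral_le_of_norm_le_const fun y _ => hb _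
    have t3 := (t1.add ((t2 x2).const_mul I)).sub ((t2 x1).const_mul I)
    simp only [intervalIntegral.integral_zero, mul_zero, add_zero, sub_zero] at t3
    refine t3.congr fun e => ?_
    simp only [hE]
    rw [← intervalIntegral.integral_sub (iih _ _ _) (iih _ _ _)]
    have h5 : ∀ x : ℝ, C (x - e * I) = C (x + ((-e : ℝ) : ℂ) * I) := by
      intro x; congr 1; push_cast; ring
    simp only [h5]
  have hopp : E 1 (-1) = 0 := by
    have : ∀ e ∈ Ioi (0:ℝ), E e (-e) = E 1 (-1) := by
      intro e he
      have he' : (0:ℝ) < e := he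
      have h1 := hadd 1 e (-e)
      have h2 := hadd 1 (-e) (-1)
      rw [hsame 1 e (by linarith)] at h1
      rw [hsame (-e) (-1) (by linarith)] at h2
      rw [← h2, ← h1]; ring
    have h2 : Tendsto (fun e : ℝ => E e (-e)) (nhdsWithin 0 (Set.Ioi 0)) (nhds (E 1 (-1))) := by
      refine tendsto_const_nhds.congr' ?_
      filter_upwards [self_mem_nhdsWithin] with e he using (this e he).symm
    exact tendsto_nhds_unique h2 hlim
  have hself : ∀ u, E u u = 0 := fun u => by simp [hE]
  change E y1 y2 = 0
  have hto1 : ∀ y : ℝ, y ≠ 0 → E 1 y = 0 := by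
    intro y hy
    rcases lt_or_gt_of_ne hy with h | h
    · have := hadd 1 (-1) y
      rw [hopp, hsame (-1) y (by linarith)] at this
      rw [← this]; ring
    · exact hsame 1 y (by linarith)
  have h1 := hadd 1 y1 y2
  rw [hto1 y1 hy1, hto1 y2 hy2] at h1
  simpa using h1

lemma rl_painleve {C : ℂ → ℂ} (hC0 : ∀ z : ℂ, z.im = 0 → C z = 0)
    (hCd : ∀ z : ℂ, z.im ≠ 0 → DifferentiableAt ℂ C z) (hb : ∀ z, ‖C z‖ ≤ 1)
    (hj : ∀ᵐ x : ℝ, x ∈ Set.Ioo (-2:ℝ) 2 →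
      Tendsto (fun y : ℝ => C (x + y * I) - C (x - y * I)) (nhdsWithin 0 (Set.Ioi 0)) (nhds 0)) :
    ∃ D : ℂ → ℂ, DifferentiableOn ℂ D Omega22 ∧ ∀ z : ℂ, z.im ≠ 0 → D z = C z := by
  have hm := rl_meas hC0 hCd
  have iiv : ∀ (x y1 y2 : ℝ), IntervalIntegrable (fun t : ℝ => C (x + t * I)) volume y1 y2 := by
    intro x y1 y2
    refine (intervalIntegrable_const (c := (1:ℝ))).mono_fun' ?_ ?_
    · exact (hm.comp (by fun_prop)).aestronglyMeasurable
    · exact Eventually.of_forall fun t => hb _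
  have iih : ∀ (y x1 x2 : ℝ), IntervalIntegrable (fun t : ℝ => C (t + y * I)) volume x1 x2 := by
    intro y x1 x2
    refine (intervalIntegrable_const (c := (1:ℝ))).mono_fun' ?_ ?_
    · exact (hm.comp (by fun_prop)).aestronglyMeasurable
    · exact Eventually.of_forall fun t => hb _
  have hQ := rl_Q hC0 hCd hb hj
  set P : ℂ → ℂ := fun w => (∫ t : ℝ in (0:ℝ)..w.re, C (t + (1:ℝ) * I)) +
    I * ∫ s : ℝ in (1:ℝ)..w.im, C (w.re + s * I) with hP
  set U : Set ℂ := {z : ℂ | -2 < z.re ∧ z.re < 2} with hUdef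
  have hU : IsOpen U := (isOpen_lt continuous_const Complex.continuous_re).inter
    (isOpen_lt Complex.continuous_re continuous_const)
  have hPc : Continuous P := by
    refine Continuous.add ?_ (continuous_const.mul ?_)
    · have : Continuous (fun x : ℝ => ∫ t : ℝ in (0:ℝ)..x, C (t + (1:ℝ) * I)) :=
        intervalIntegral.continuous_primitive (fun a b => iih 1 a b) 0
      exact this.comp Complex.continuous_re
    · rw [continuous_iff_continuousAt]
      intro w
      have hfix : Tendsto (fun v : ℂ => ∫ s : ℝ in (1:ℝ)..w.im, C (v.re + s * I)) (nhds w)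
          (nhds (∫ s : ℝ in (1:ℝ)..w.im, C (w.re + s * I))) := by
        refine intervalIntegral.tendsto_integral_filter_of_dominated_convergence (fun _ => (1:ℝ))
          ?_ ?_ ?_ ?_
        · exact Eventually.of_forall fun e => (hm.comp (by fun_prop)).aestronglyMeasurable
        · exact Eventually.of_forall fun e => Eventually.of_forall fun x _ => hb _
        · exact intervalIntegrable_const
        · have : ∀ᵐ s : ℝ, s ≠ 0 := by simp [ae_iff, measure_singleton]
          filter_upwards [this] with s hs _
          have h1 : ContinuousAt C (w.re + s * I) := (hCd _ (by simpa using hs)).continuousAt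
          have h2 : Tendsto (fun v : ℂ => (v.re + s * I : ℂ)) (nhds w) (nhds (w.re + s * I)) := by
            apply Continuous.tendsto (f := fun v : ℂ => (v.re + s * I : ℂ)); fun_prop
          exact h1.tendsto.comp h2
      have hsm : Tendsto (fun v : ℂ => ∫ s : ℝ in w.im..v.im, C (v.re + s * I)) (nhds w)
          (nhds 0) := by
        have : Tendsto (fun v : ℂ => 1 * |v.im - w.im|) (nhds w) (nhds 0) := by
          have : Tendsto (fun v : ℂ => 1 * |v.im - w.im|) (nhds w) (nhds (1 * |w.im - w.im|)) := by
            apply Continuous.tendsto (f := fun v : ℂ => 1 * |v.im - w.im|); fun_prop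
          simpa using this
        refine squeeze_zero_norm (fun e => ?_) this
        exact intervalIntegral.norm_integral_le_of_norm_le_const fun y _ => hb _
      have := hfix.add hsm
      rw [add_zero] at this
      refine this.congr fun v => ?_
      exact intervalIntegral.integral_add_adjacent_intervals (iiv _ _ _) (iiv _ _ _)
  have hPd : ∀ z ∈ U, z.im ≠ 0 → HasDerivAt P (C z) z := by
    intro z hz hz0
    have hr : 0 < |z.im| := abs_pos.2 hz0
    have hball : ∀ v ∈ Metric.ball z |z.im|, v.im ≠ 0 := by
      intro v hv h0
      have h1 := Complex.abs_im_le_norm (v - z)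
      rw [Metric.mem_ball, dist_eq_norm] at hv
      simp [h0] at h1
      linarith
    have hdo : DifferentiableOn ℂ C (Metric.ball z |z.im|) := fun v hv =>
      (hCd v (hball v hv)).differentiableWithinAt
    have hw := hdo.isConservativeOn.hasDerivAt_wedgeIntegral hdo.continuousOn
      (Metric.mem_ball_self hr)
    have heq : P =ᶠ[nhds z] fun w => wedgeIntegral z w C + P z := by
      filter_upwards [hU.mem_nhds hz] with w hw
      simp only [hP, wedgeIntegral, smul_eq_mul]
      have q1 := hQ 0 w.re (by norm_num) hw 1 z.im one_ne_zero hz0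
      have q2 := hQ 0 z.re (by norm_num) hz 1 z.im one_ne_zero hz0
      rw [← intervalIntegral.integral_add_adjacent_intervals (iiv w.re 1 z.im) (iiv w.re z.im w.im)]
      rw [← intervalIntegral.integral_add_adjacent_intervals (iih z.im 0 z.re)
        (iih z.im z.re w.re)] at q1
      linear_combination q1 - q2
    exact (hw.add_const (P z)).congr_of_eventuallyEq heq
  have hPU : DifferentiableOn ℂ P U :=
    rl_morera hU hPc.continuousOn fun z hz h0 => (hPd z hz h0).differentiableAt
  refine ⟨fun z => if z.im = 0 then deriv P z else C z, ?_, fun z hz => by simp [hz]⟩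
  intro z hz
  apply DifferentiableAt.differentiableWithinAt
  by_cases h0 : z.im = 0
  · have hzU : z ∈ U := by
      rcases hz with h | h
      · exact absurd h0 h
      · exact h
    have hd : DifferentiableAt ℂ (deriv P) z := (hPU.deriv hU).differentiableAt (hU.mem_nhds hzU)
    refine hd.congr_of_eventuallyEq ?_
    filter_upwards [hU.mem_nhds hzU] with w hw
    by_cases hw0 : w.im = 0
    · simp [hw0]
    · simp [hw0, (hPd w hw hw0).deriv]
  · refine (hCd z h0).congr_of_eventuallyEq ?_
    filter_upwards [(isOpen_ne_fun Complex.continuous_im continuous_const).mem_nhds h0] with w hw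
    have : w.im ≠ 0 := hw
    simp [this]


lemma rl_schwarz {g : ℂ → ℂ} (hg : DiffContOnCl ℂ g (Metric.ball 0 1)) {w : ℂ}
    (hw : ‖w‖ < 1) :
    g w = starRingEnd ℂ (g 0) + 2 * I * Real.circleAverage (fun z => (z / (z - w)) * ((g z).im : ℂ)) 0 1 := by
  have hw' : w ∈ Metric.ball (0:ℂ) |1| := by simpa using hw
  have hcs : ContinuousOn g (Metric.sphere 0 1) :=
    hg.2.mono (Metric.sphere_subset_closedBall.trans_eq (closure_ball 0 one_ne_zero).symm)
  have hne : ∀ z ∈ Metric.sphere (0:ℂ) 1, z - w ≠ 0 := by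
    intro z hz h
    rw [sub_eq_zero] at h
    subst h
    simp at hz
    linarith
  have hcw : ContinuousOn (fun z : ℂ => z / (z - w)) (Metric.sphere 0 1) :=
    continuousOn_id.div (by fun_prop) hne
  have h1 := (show DiffContOnCl ℂ g (Metric.ball 0 |1|) by simpa using hg).circleAverage_smul_div hw'
  have h2 : Real.circleAverage (fun z => (z / (z - w)) * starRingEnd ℂ (g z)) 0 1
      = starRingEnd ℂ (g 0) := by
    have hk : DiffContOnCl ℂ (fun z : ℂ => (1 - starRingEnd ℂ w * z)⁻¹ * g z) (Metric.ball 0 |1|) := by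
      rw [abs_one]
      refine DiffContOnCl.smul (c := fun z : ℂ => (1 - starRingEnd ℂ w * z)⁻¹)
        (DifferentiableOn.diffContOnCl ?_) hg
      rw [closure_ball 0 one_ne_zero]
      intro z hz
      refine DifferentiableAt.differentiableWithinAt (DifferentiableAt.inv (by fun_prop) ?_)
      intro h
      have h3 : ‖starRingEnd ℂ w * z‖ = 1 := by
        rw [← sub_eq_zero.1 h]; simp
      rw [norm_mul, RCLike.norm_conj] at h3
      simp at hz
      nlinarith [norm_nonneg w, norm_nonneg z]
    have h3 := hk.circleAverage
    simp only [mul_zero, sub_zero, inv_one, one_mul] at h3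
    rw [← h3, ← Complex.conjCLE_apply]
    have h4 := ContinuousLinearMap.circleAverage_comp_comm (Complex.conjCLE : ℂ →L[ℝ] ℂ)
      (f := fun z : ℂ => (1 - starRingEnd ℂ w * z)⁻¹ * g z) (c := 0) (R := 1) (by
        apply ContinuousOn.circleIntegrable zero_le_one
        refine hk.2.mono ?_
        rw [abs_one, closure_ball 0 one_ne_zero]
        exact Metric.sphere_subset_closedBall)
    rw [ContinuousLinearEquiv.coe_coe] at h4
    rw [← h4]
    apply Real.circleAverage_congr_sphere
    intro z hz
    have hz1 : ‖z‖ = 1 := by simpa using hz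
    have hzz : z * starRingEnd ℂ z = 1 := by
      rw [Complex.mul_conj, Complex.normSq_eq_norm_sq, hz1]; simp
    have hz0 : z ≠ 0 := by intro h; simp [h] at hz1
    simp only [Function.comp, Complex.conjCLE_apply, map_mul, map_inv₀, map_sub, map_one,
      Complex.conj_conj]
    congr 1
    have h5 : 1 - w * starRingEnd ℂ z = (z - w) / z := by
      field_simp
      linear_combination -w * hzz
    rw [h5, inv_div]
  have h5 : Real.circleAverage (fun z => (z / (z - w)) * g z) 0 1 = g w := by
    simpa using h1
  rw [← h2]
  nth_rw 1 [← h5]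
  rw [← sub_eq_iff_eq_add']
  rw [← Real.circleAverage_fun_sub, ← smul_eq_mul, ← Real.circleAverage_fun_smul]
  · apply Real.circleAverage_congr_sphere
    intro z hz
    have h6 : g z - starRingEnd ℂ (g z) = 2 * I * ((g z).im : ℂ) := by
      rw [Complex.sub_conj]; push_cast; ring
    simp only [smul_eq_mul]
    linear_combination (z / (z - w)) * h6
  · exact (hcw.mul hcs).circleIntegrable zero_le_one
  · exact (hcw.mul (Complex.continuous_conj.comp_continuousOn hcs)).circleIntegrable zero_le_one

lemma rl_kernel {w : ℂ} (hw : ‖w‖ < 1) (θ : ℝ) : ‖cexp (θ * I) / (cexp (θ * I) - w)‖ ≤ 1 / (1 - ‖w‖) := by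
  rw [norm_div, Complex.norm_exp_ofReal_mul_I]
  apply one_div_le_one_div_of_le (by linarith)
  have := norm_sub_norm_le (cexp (θ * I)) w
  rwa [Complex.norm_exp_ofReal_mul_I] at this

lemma rl_kernel_ne {w : ℂ} (hw : ‖w‖ < 1) (θ : ℝ) : cexp (θ * I) - w ≠ 0 := by
  intro h
  rw [← sub_eq_zero.1 h, Complex.norm_exp_ofReal_mul_I] at hw
  linarith

lemma rl_kernel_cont {w : ℂ} (hw : ‖w‖ < 1) : Continuous fun θ : ℝ => cexp (θ * I) / (cexp (θ * I) - w) :=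
  Continuous.div (by fun_prop) (by fun_prop) (rl_kernel_ne hw)

lemma rl_herglotz_disc {f : ℂ → ℂ} (hf : DifferentiableOn ℂ f (Metric.ball 0 1))
    (him : ∀ z ∈ Metric.ball (0:ℂ) 1, 0 ≤ (f z).im) :
    ∃ ν : FiniteMeasure ℝ, ∀ w : ℂ, ‖w‖ < 1 → f w = starRingEnd ℂ (f 0) +
      2 * I * ∫ θ : ℝ, cexp (θ * I) / (cexp (θ * I) - w) ∂(ν : Measure ℝ) := by
  set ρ : ℕ → ℝ := fun n => 1 - 1 / ((n:ℝ) + 1) with hρ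
  have hρ0 : ∀ n, 0 ≤ ρ n := by
    intro n; simp only [hρ, sub_nonneg]
    rw [div_le_one (by positivity)]; linarith [n.cast_nonneg (α := ℝ)]
  have hρ1 : ∀ n, ρ n < 1 := by
    intro n; simp only [hρ, sub_lt_self_iff]; positivity
  have hρl : Tendsto ρ atTop (nhds 1) := by
    have := (tendsto_one_div_add_atTop_nhds_zero_nat (𝕜 := ℝ)).const_sub 1
    simpa [hρ] using this
  have hmem : ∀ n, ∀ z : ℂ, ‖z‖ ≤ 1 → (ρ n : ℂ) * z ∈ Metric.ball (0:ℂ) 1 := by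
    intro n z hz
    rw [mem_ball_zero_iff, norm_mul, Complex.norm_real, Real.norm_of_nonneg (hρ0 n)]
    nlinarith [hρ0 n, hρ1 n, norm_nonneg z]
  have hgd : ∀ n, DiffContOnCl ℂ (fun z => f (ρ n * z)) (Metric.ball 0 1) := by
    intro n
    refine DifferentiableOn.diffContOnCl ?_
    rw [closure_ball 0 one_ne_zero]
    refine hf.comp (by fun_prop) fun z hz => hmem n z (by simpa using hz)
  set d : ℕ → ℝ → ℝ := fun n θ => (2 * Real.pi)⁻¹ * (f (ρ n * cexp (θ * I))).im with hd
  have hdc : ∀ n, Continuous (d n) := by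
    intro n
    refine continuous_const.mul (Complex.continuous_im.comp ?_)
    refine hf.continuousOn.comp_continuous (by fun_prop) fun θ => hmem n _ ?_
    rw [Complex.norm_exp_ofReal_mul_I]
  have hd0 : ∀ n θ, 0 ≤ d n θ := by
    intro n θ
    refine mul_nonneg (by positivity) (him _ (hmem n _ ?_))
    rw [Complex.norm_exp_ofReal_mul_I]
  set N : ℕ → Measure ℝ := fun n =>
    (volume.restrict (Ioc 0 (2 * Real.pi))).withDensity (fun θ => ENNReal.ofReal (d n θ)) with hN
  have hNint : ∀ n (g : ℝ → ℂ), ∫ θ, g θ ∂(N n) =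
      ∫ θ in (0:ℝ)..(2 * Real.pi), (d n θ : ℂ) * g θ := by
    intro n g
    rw [hN, integral_withDensity_eq_integral_toReal_smul
      (hdc n).measurable.ennreal_ofReal (Eventually.of_forall fun _ => ENNReal.ofReal_lt_top),
      intervalIntegral.integral_of_le Real.two_pi_pos.le]
    refine integral_congr_ae (Eventually.of_forall fun θ => ?_)
    simp [ENNReal.toReal_ofReal (hd0 n θ)]
  have hNfin : ∀ n, IsFiniteMeasure (N n) := by
    intro n
    refine isFiniteMeasure_withDensity_ofReal ?_
    exact ((hdc n).integrableOn_Icc.mono_set Ioc_subset_Icc_self).2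
  have hrep : ∀ n (w : ℂ), ‖w‖ < 1 → f (ρ n * w) = starRingEnd ℂ (f 0) + 2 * I *
      ∫ θ : ℝ, cexp (θ * I) / (cexp (θ * I) - w) ∂(N n) := by
    intro n w hw
    have h := rl_schwarz (hgd n) hw
    simp only [mul_zero] at h
    rw [h, hNint, Real.circleAverage_def, ← intervalIntegral.integral_smul]
    congr 2
    refine intervalIntegral.integral_congr fun θ _ => ?_
    simp [circleMap, hd]
    ring
  have hmass : ∀ n, (N n).real univ = (f 0).im := by
    intro n
    have h := hrep n 0 (by simp)
    simp at h
    have h2 := congrArg Complex.im h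
    simp at h2
    linarith
  let V : ℕ → FiniteMeasure ℝ := fun n => ⟨N n, hNfin n⟩
  have hK := isCompact_setOfPred_finiteMeasure_le_of_isCompact (E := ℝ) (f 0).im.toNNReal
    (isCompact_Icc (a := (0:ℝ)) (b := 2 * Real.pi))
  have hV : ∀ n, V n ∈ {μ : FiniteMeasure ℝ | μ.mass ≤ (f 0).im.toNNReal ∧ μ (Icc (0:ℝ) (2 * Real.pi))ᶜ = 0} := by
    intro n
    refine ⟨?_, ?_⟩
    · apply le_of_eq
      rw [← NNReal.coe_inj, Real.coe_toNNReal _ (him 0 (by simp))]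
      exact hmass n
    · have : (N n) (Icc (0:ℝ) (2 * Real.pi))ᶜ = 0 := by
        refine (withDensity_absolutelyContinuous _ _) ?_
        rw [Measure.restrict_apply measurableSet_Icc.compl]
        convert measure_empty (μ := (volume : Measure ℝ))
        rw [← disjoint_iff_inter_eq_empty]
        exact (disjoint_compl_left_iff_subset.2 Ioc_subset_Icc_self)
      exact (FiniteMeasure.null_iff_toMeasure_null _ _).2 this
  obtain ⟨ν, -, hν⟩ := hK.ultrafilter_le_nhds ((hyperfilter ℕ).map V) (by
    rw [Ultrafilter.coe_map, le_principal_iff]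
    exact Filter.mem_map.2 (Filter.univ_mem' hV))
  have hνt : Tendsto V (hyperfilter ℕ : Filter ℕ) (nhds ν) := hν
  rw [FiniteMeasure.tendsto_iff_forall_integral_rclike_tendsto ℂ] at hνt
  refine ⟨ν, fun w hw => ?_⟩
  have h1 := hνt (BoundedContinuousFunction.ofNormedAddCommGroup _ (rl_kernel_cont hw) _ (rl_kernel hw))
  simp only [BoundedContinuousFunction.coe_ofNormedAddCommGroup] at h1
  have h2 := (h1.const_mul (2 * I)).const_add (starRingEnd ℂ (f 0))
  have h3 : Tendsto (fun n => f (ρ n * w)) (hyperfilter ℕ : Filter ℕ) (nhds (f w)) := by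
    have hc : ContinuousAt f w := (hf.differentiableAt (Metric.isOpen_ball.mem_nhds (by simpa using hw))).continuousAt
    have : Tendsto (fun n => (ρ n : ℂ) * w) atTop (nhds w) := by
      have := ((Complex.continuous_ofReal.tendsto 1).comp hρl).mul_const w
      simpa using this
    exact (hc.tendsto.comp this).mono_left Nat.hyperfilter_le_atTop
  refine tendsto_nhds_unique h3 (h2.congr fun n => ?_)
  exact (hrep n w hw).symm


lemma rl_ne_real {l : ℂ} (hl : 0 < l.im) (t : ℝ) : (t : ℂ) - l ≠ 0 := by
  intro h
  have := congrArg Complex.im h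
  simp at this
  linarith

lemma rl_plus_I {l : ℂ} (hl : 0 < l.im) : l + I ≠ 0 := by
  intro h
  have := congrArg Complex.im h
  simp at this
  linarith

lemma rl_cayley_lt {l : ℂ} (hl : 0 < l.im) : ‖(l - I) / (l + I)‖ < 1 := by
  rw [norm_div, div_lt_one (norm_pos_iff.2 (rl_plus_I hl))]
  apply lt_of_pow_lt_pow_left₀ 2 (norm_nonneg _)
  rw [← Complex.normSq_eq_norm_sq, ← Complex.normSq_eq_norm_sq, Complex.normSq_apply, Complex.normSq_apply]
  simp
  nlinarith

lemma rl_cayley_inv_im {w : ℂ} (hw : ‖w‖ < 1) : 0 < (I * (1 + w) / (1 - w)).im := by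
  have h1 : 1 - w ≠ 0 := by
    intro h
    rw [← sub_eq_zero.1 h] at hw
    simp at hw
  have hn : w.re * w.re + w.im * w.im < 1 := by
    rw [← Complex.normSq_apply, Complex.normSq_eq_norm_sq]
    nlinarith [norm_nonneg w]
  have h2 : 0 < Complex.normSq (1 - w) := Complex.normSq_pos.2 h1
  rw [Complex.div_im]
  rw [← sub_div]
  apply div_pos _ h2
  simp
  nlinarith

lemma rl_herglotz_hp {F : ℂ → ℂ} (hF : DifferentiableOn ℂ F {z : ℂ | 0 < z.im})
    (him : ∀ z : ℂ, 0 < z.im → 0 < (F z).im) :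
    ∃ (μ : Measure ℝ) (A c : ℝ), IsFiniteMeasure μ ∧ 0 ≤ A ∧ ∀ l : ℂ, 0 < l.im →
      F l = c + A * l + ∫ t : ℝ, (1 + t * l) / (t - l) ∂μ := by
  have hne1 : ∀ w : ℂ, ‖w‖ < 1 → 1 - w ≠ 0 := by
    intro w hw h
    rw [← sub_eq_zero.1 h] at hw
    simp at hw
  obtain ⟨ν, hν⟩ := rl_herglotz_disc (f := fun w => F (I * (1 + w) / (1 - w)))
    (by
      refine hF.comp ?_ ?_
      · intro w hw
        refine DifferentiableAt.differentiableWithinAt (DifferentiableAt.div (by fun_prop) (by fun_prop) ?_)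
        exact hne1 w (by simpa using hw)
      · intro w hw
        exact rl_cayley_inv_im (by simpa using hw))
    (fun w hw => (him _ (rl_cayley_inv_im (by simpa using hw))).le)
  set S : Set ℝ := {θ : ℝ | cexp (θ * I) = 1} with hS
  have hSm : MeasurableSet S := (isClosed_eq (by fun_prop) continuous_const).measurableSet
  set T : ℝ → ℝ := fun θ => (I * (1 + cexp (θ * I)) / (1 - cexp (θ * I))).re with hT
  have hTm : Measurable T := by fun_prop
  set μ : Measure ℝ := ((ν : Measure ℝ).restrict Sᶜ).map T with hμ
  have hTeq : ∀ θ ∈ Sᶜ, ((T θ : ℝ) : ℂ) = I * (1 + cexp (θ * I)) / (1 - cexp (θ * I)) := by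
    intro θ hθ
    have h0 : 1 - cexp (θ * I) ≠ 0 := by
      intro h; exact hθ (sub_eq_zero.1 h).symm
    rw [hT]
    apply Complex.ext
    · simp
    · rw [Complex.ofReal_im]
      set s := cexp (θ * I) with hs
      have hn : s.re * s.re + s.im * s.im = 1 := by
        rw [← Complex.normSq_apply, Complex.normSq_eq_norm_sq, Complex.norm_exp_ofReal_mul_I]; simp
      rw [Complex.div_im, ← sub_div]
      symm
      apply div_eq_zero_iff.2
      left
      simp
      linarith
  have hfin : IsFiniteMeasure μ := by rw [hμ]; infer_instance
  set A : ℝ := (ν : Measure ℝ).real S with hA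
  set m : ℝ := (ν : Measure ℝ).real Sᶜ with hm
  have hmass : μ.real univ = m := by
    rw [hμ, measureReal_def, Measure.map_apply hTm MeasurableSet.univ]
    simp [hm, measureReal_def]
  have hkey : ∀ l : ℂ, 0 < l.im → F l = (starRingEnd ℂ (F I) + I * A + I * m) + A * l +
      ∫ t : ℝ, (1 + t * l) / (t - l) ∂μ := by
    intro l hl
    have hw := rl_cayley_lt hl
    have h1 := hν _ hw
    have hl' := rl_plus_I hl
    have e1 : I * (1 + (l - I) / (l + I)) / (1 - (l - I) / (l + I)) = l := by
      have : 1 - (l - I) / (l + I) = 2 * I / (l + I) := by field_simp; ring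
      rw [this]
      have : I ≠ 0 := I_ne_zero
      field_simp
      ring
    rw [e1] at h1
    simp only [add_zero, sub_zero, mul_one, div_one] at h1
    set w := (l - I) / (l + I) with hwdef
    set k : ℝ → ℂ := fun θ => cexp (θ * I) / (cexp (θ * I) - w) with hk
    have hki : Integrable k (ν : Measure ℝ) := by
      refine (integrable_const (1 / (1 - ‖w‖))).mono' (rl_kernel_cont hw).aestronglyMeasurable ?_
      exact Eventually.of_forall (rl_kernel hw)
    rw [← integral_add_compl hSm hki] at h1
    have h2 : ∫ θ in S, k θ ∂(ν : Measure ℝ) = A * ((l + I) / (2 * I)) := by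
      have : ∀ θ ∈ S, k θ = (l + I) / (2 * I) := by
        intro θ hθ
        have : cexp (θ * I) = 1 := hθ
        simp only [hk, this, hwdef]
        have h3 : 1 - (l - I) / (l + I) = 2 * I / (l + I) := by field_simp; ring
        rw [h3, one_div, inv_div]
      rw [setIntegral_congr_fun hSm this]
      simp [hA]
    have h3 : ∫ t : ℝ, (1 + t * l) / (t - l) ∂μ = ∫ θ in Sᶜ, (2 * I * k θ - I) ∂(ν : Measure ℝ) := by
      rw [hμ, integral_map hTm.aemeasurable]
      · refine setIntegral_congr_fun hSm.compl fun θ hθ => ?_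
        simp only [hTeq θ hθ, hk, hwdef]
        have hθ' : 1 - cexp (θ * I) ≠ 0 := by
          intro h; exact hθ (sub_eq_zero.1 h).symm
        have hd1 : cexp (θ * I) - (l - I) / (l + I) ≠ 0 := rl_kernel_ne hw θ
        have hd2 : I * (1 + cexp (θ * I)) / (1 - cexp (θ * I)) - l ≠ 0 := by
          rw [← hTeq θ hθ]; exact rl_ne_real hl _
        set s := cexp (θ * I)
        have hd1' : s * (l + I) - (l - I) ≠ 0 := by
          intro h; apply hd1; field_simp; linear_combination h
        have hd2' : I * (1 + s) - l * (1 - s) ≠ 0 := by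
          intro h; apply hd2; field_simp; linear_combination h
        have E1 : (1 + I * (1 + s) / (1 - s) * l) / (I * (1 + s) / (1 - s) - l) =
            ((1 - s) + I * (1 + s) * l) / (I * (1 + s) - l * (1 - s)) := by
          field_simp
        have E2 : s / (s - (l - I) / (l + I)) = s * (l + I) / (s * (l + I) - (l - I)) := by
          field_simp
        rw [E1, E2]
        rw [eq_sub_iff_add_eq, div_add' _ _ _ hd2', ← mul_div_assoc, div_eq_div_iff hd2' hd1']
        have := Complex.I_sq
        linear_combination (2 * s * l - s ^ 2 * I - s ^ 2 * l + I - l) * this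
      · refine Continuous.aestronglyMeasurable ?_
        exact Continuous.div (by fun_prop) (by fun_prop) (rl_ne_real hl)
    rw [integral_sub (hki.integrableOn.const_mul _) (integrable_const _), integral_const_mul] at h3
    have h4 : ∫ θ in Sᶜ, I ∂(ν : Measure ℝ) = m * I := by simp [hm]
    rw [h4] at h3
    rw [h3, h1, h2]
    have : I ≠ 0 := I_ne_zero
    field_simp
    ring
  refine ⟨μ, A, (F I).re, hfin, measureReal_nonneg, fun l hl => ?_⟩
  have hI := hkey I (by simp)
  have hconst : ∫ t : ℝ, (1 + t * I) / (t - I) ∂μ = m * I := by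
    have : ∀ t : ℝ, (1 + t * I) / (t - I) = I := by
      intro t
      rw [div_eq_iff (rl_ne_real (by simp) t)]
      linear_combination Complex.I_sq
    simp only [this]
    simp [hmass]
  rw [hconst] at hI
  rw [hkey l hl]
  congr 2
  have him' := congrArg Complex.im hI
  simp at him'
  apply Complex.ext
  · simp
  · simp; linarith


lemma rl_hker {l : ℂ} (hl : 0 < l.im) (t : ℝ) :
    (1 + t * l) / (t - l) = l + (1 + l ^ 2) * (1 / (t - l)) := by
  have := rl_ne_real hl t
  field_simp
  ring

lemma rl_cker_bound {l : ℂ} (hl : 0 < l.im) (t : ℝ) : ‖1 / ((t : ℂ) - l)‖ ≤ 1 / l.im := by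
  rw [norm_div, norm_one]
  apply one_div_le_one_div_of_le hl
  have := Complex.abs_im_le_norm ((t : ℂ) - l)
  simp [abs_of_pos hl] at this
  exact this

lemma rl_cker_int {l : ℂ} (hl : 0 < l.im) (μ : Measure ℝ) [IsFiniteMeasure μ] :
    Integrable (fun t : ℝ => 1 / ((t : ℂ) - l)) μ := by
  refine (integrable_const (1 / l.im)).mono' ?_ (Eventually.of_forall (rl_cker_bound hl))
  exact (Continuous.div (by fun_prop) (by fun_prop) (rl_ne_real hl)).aestronglyMeasurable

lemma rl_hker_int {l : ℂ} (hl : 0 < l.im) (μ : Measure ℝ) [IsFiniteMeasure μ] :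
    Integrable (fun t : ℝ => (1 + t * l) / ((t : ℂ) - l)) μ := by
  simp only [rl_hker hl]
  exact (integrable_const l).add ((rl_cker_int hl μ).const_mul _)

lemma rl_hker_im {x y : ℝ} (hy : 0 < y) (t : ℝ) :
    ((1 + t * (x + y * I)) / ((t : ℂ) - (x + y * I))).im = y * (1 + t ^ 2) / ((t - x) ^ 2 + y ^ 2) := by
  have hne : (t - x) ^ 2 + y ^ 2 ≠ 0 := by positivity
  rw [Complex.div_im, Complex.normSq_apply]
  have : ((t:ℂ) - (x + y * I)).re * ((t:ℂ) - (x + y * I)).re + ((t:ℂ) - (x + y * I)).im * ((t:ℂ) - (x + y * I)).im = (t - x) ^ 2 + y ^ 2 := by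
    simp; ring
  rw [this, ← sub_div]
  congr 1
  simp
  ring

lemma rl_mass_bound {F : ℂ → ℂ} {μ : Measure ℝ} [IsFiniteMeasure μ] {A c : ℝ} (hA : 0 ≤ A)
    (hF : ∀ l : ℂ, 0 < l.im → F l = c + A * l + ∫ t : ℝ, (1 + t * l) / (t - l) ∂μ)
    {x y : ℝ} (hy : 0 < y) : μ.real (Icc (x - y) (x + y)) ≤ 2 * y * (F (x + y * I)).im := by
  have hl : 0 < ((x : ℂ) + y * I).im := by simpa using hy
  have h1 := congrArg Complex.im (hF _ hl)
  rw [Complex.add_im, ← RCLike.im_eq_complex_im, ← integral_im (rl_hker_int hl μ)] at h1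
  simp only [RCLike.im_eq_complex_im] at h1
  have h2 : ((c : ℂ) + A * (x + y * I)).im = A * y := by simp
  rw [h2] at h1
  have h3 : μ.real (Icc (x - y) (x + y)) * (1 / (2 * y)) ≤
      ∫ t : ℝ, ((1 + t * (x + y * I)) / ((t : ℂ) - (x + y * I))).im ∂μ := by
    have : μ.real (Icc (x - y) (x + y)) * (1 / (2 * y)) =
        ∫ t : ℝ, (Icc (x - y) (x + y)).indicator (fun _ => 1 / (2 * y)) t ∂μ := by
      rw [integral_indicator measurableSet_Icc]; simp
    rw [this]
    refine integral_mono ((integrable_const _).indicator measurableSet_Icc) (rl_hker_int hl μ).im ?_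
    intro t
    simp only
    rw [rl_hker_im hy]
    by_cases ht : t ∈ Icc (x - y) (x + y)
    · rw [indicator_of_mem ht, div_le_div_iff₀ (by positivity) (by positivity)]
      have : (t - x) ^ 2 ≤ y ^ 2 := by
        apply sq_le_sq'
        · linarith [ht.1]
        · linarith [ht.2]
      nlinarith [mul_nonneg (sq_nonneg y) (sq_nonneg t)]
    · rw [indicator_of_notMem ht]
      positivity
  have h4 : 0 ≤ A * y := by positivity
  have h5 : μ.real (Icc (x - y) (x + y)) * (1 / (2 * y)) ≤ (F (x + y * I)).im := by
    rw [h1]; linarith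
  rw [mul_one_div, div_le_iff₀ (by positivity)] at h5
  linarith

lemma rl_support {F : ℂ → ℂ} {μ : Measure ℝ} [IsFiniteMeasure μ] {A c : ℝ} (hA : 0 ≤ A)
    (hF : ∀ l : ℂ, 0 < l.im → F l = c + A * l + ∫ t : ℝ, (1 + t * l) / (t - l) ∂μ)
    {x0 δ C : ℝ} (hδ : 0 < δ)
    (hloc : ∀ x : ℝ, |x - x0| < δ → ∀ y : ℝ, 0 < y → y < δ → (F (x + y * I)).im ≤ C * y) :
    ∃ U ∈ nhds x0, μ U = 0 := by
  refine ⟨Icc (x0 - δ / 2) (x0 + δ / 2), Icc_mem_nhds (by linarith) (by linarith), ?_⟩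
  rw [← measureReal_eq_zero_iff]
  have key : ∀ N : ℕ, μ.real (Icc (x0 - δ / 2) (x0 + δ / 2)) ≤ (C * δ ^ 2 / 2) * (1 / ((N : ℝ) + 1)) := by
    intro N
    set y : ℝ := δ / 2 / (N + 1) with hy
    have hN : (0:ℝ) < N + 1 := by positivity
    have hy0 : 0 < y := by positivity
    have hyN : (N + 1) * y = δ / 2 := by rw [hy]; field_simp
    have hyd : y < δ := by nlinarith [N.cast_nonneg (α := ℝ)]
    have ind : ∀ k : ℕ, k ≤ N + 1 → μ.real (Icc (x0 - δ / 2) (x0 - δ / 2 + 2 * k * y)) ≤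
        (k + 1) * 0 + k * (2 * C * y ^ 2) + μ.real {x0 - δ / 2} := by
      intro k
      induction k with
      | zero => intro _; simp
      | succ k ih =>
        intro hk
        have hk' : (k : ℝ) ≤ N := by exact_mod_cast Nat.le_of_succ_le_succ hk
        have hi := ih (by omega)
        set x := x0 - δ / 2 + (2 * k + 1) * y with hx
        have hsub : Icc (x0 - δ / 2) (x0 - δ / 2 + 2 * (k + 1 : ℕ) * y) ⊆
            Icc (x0 - δ / 2) (x0 - δ / 2 + 2 * k * y) ∪ Icc (x - y) (x + y) := by
          intro t ht
          push_cast at ht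
          rcases le_total t (x0 - δ / 2 + 2 * k * y) with h | h
          · left; exact ⟨ht.1, h⟩
          · right
            constructor
            · rw [hx]; linarith
            · rw [hx]; linarith [ht.2]
        have h1 := (measureReal_mono hsub (μ := μ)).trans (measureReal_union_le _ _)
        have h2 := rl_mass_bound hA hF hy0 (x := x)
        have h3 := hloc x (by
          have : 0 ≤ (k:ℝ) * y := by positivity
          have : (k:ℝ) * y ≤ N * y := by gcongr
          rw [abs_lt]; constructor <;> rw [hx] <;> nlinarith) y hy0 hyd
        have h4 : 2 * y * (F (x + y * I)).im ≤ 2 * y * (C * y) := by gcongr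
        push_cast at h1 ⊢
        linarith
    have hp : μ.real {x0 - δ / 2} ≤ 0 := by
      have : ∀ y : ℝ, 0 < y → y < δ → μ.real {x0 - δ / 2} ≤ 2 * C * y ^ 2 := by
        intro y h0 h1
        have h2 := rl_mass_bound hA hF h0 (x := x0 - δ / 2)
        have h3 := hloc (x0 - δ / 2) (by rw [abs_lt]; constructor <;> linarith) y h0 h1
        have h4 : μ.real {x0 - δ / 2} ≤ μ.real (Icc (x0 - δ / 2 - y) (x0 - δ / 2 + y)) :=
          measureReal_mono (by intro t ht; rw [mem_singleton_iff] at ht; rw [ht]; constructor <;> linarith)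
        nlinarith
      have ht : Tendsto (fun y : ℝ => 2 * C * y ^ 2) (nhdsWithin 0 (Ioi 0)) (nhds 0) := by
        have : Tendsto (fun y : ℝ => 2 * C * y ^ 2) (nhds 0) (nhds (2 * C * 0 ^ 2)) :=
          Continuous.tendsto (by fun_prop) _
        simpa using this.mono_left nhdsWithin_le_nhds
      refine ge_of_tendsto ht ?_
      filter_upwards [Ioo_mem_nhdsGT hδ] with y hy using this y hy.1 hy.2
    have := ind (N + 1) le_rfl
    have e1 : x0 - δ / 2 + 2 * ((N + 1 : ℕ) : ℝ) * y = x0 + δ / 2 := by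
      push_cast; linarith
    rw [e1] at this
    have e2 : ((N + 1 : ℕ) : ℝ) * (2 * C * y ^ 2) = (C * δ ^ 2 / 2) * (1 / ((N : ℝ) + 1)) := by
      rw [hy]; push_cast; field_simp
      try ring
    rw [e2] at this
    linarith
  refine le_antisymm ?_ measureReal_nonneg
  have ht := (tendsto_one_div_add_atTop_nhds_zero_nat (𝕜 := ℝ)).const_mul (C * δ ^ 2 / 2)
  rw [mul_zero] at ht
  exact ge_of_tendsto ht (Eventually.of_forall key)

lemma rl_rep {F : ℂ → ℂ} (hF : DifferentiableOn ℂ F {z : ℂ | 0 < z.im})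
    (him : ∀ z : ℂ, 0 < z.im → 0 < (F z).im) {K : Set ℝ} {L : ℝ} (hK : K ⊆ Icc (-L) L)
    (hloc : ∀ x0 : ℝ, x0 ∉ K → ∃ δ C : ℝ, 0 < δ ∧ ∀ x : ℝ, |x - x0| < δ → ∀ y : ℝ, 0 < y → y < δ →
      (F (x + y * I)).im ≤ C * y) :
    ∃ (σ : Measure ℝ) (A B : ℝ), IsFiniteMeasure σ ∧ (∀ᵐ t ∂σ, t ∈ K) ∧ ∀ l : ℂ, 0 < l.im →
      F l = B + A * l + ∫ t : ℝ, 1 / ((t : ℂ) - l) ∂σ := by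
  obtain ⟨μ, A, c, hfin, hA, hrep⟩ := rl_herglotz_hp hF him
  have hnull : μ Kᶜ = 0 := by
    refine measure_null_of_locally_null _ fun x hx => ?_
    obtain ⟨δ, C, hδ, h⟩ := hloc x hx
    obtain ⟨U, hU, hU0⟩ := rl_support hA hrep hδ h
    exact ⟨U, mem_nhdsWithin_of_mem_nhds hU, hU0⟩
  have hae : ∀ᵐ t ∂μ, t ∈ K := hnull
  have hdm : Measurable fun t : ℝ => ENNReal.ofReal (1 + t ^ 2) := by fun_prop
  have hbt : ∀ᵐ t ∂μ, ‖t‖ ≤ L := by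
    filter_upwards [hae] with t ht
    exact abs_le.2 ⟨(hK ht).1, (hK ht).2⟩
  have hit : Integrable (fun t : ℝ => t) μ :=
    (integrable_const L).mono' measurable_id.aestronglyMeasurable hbt
  refine ⟨μ.withDensity fun t => ENNReal.ofReal (1 + t ^ 2), A, c - ∫ t, t ∂μ, ?_, ?_, ?_⟩
  · refine isFiniteMeasure_withDensity_ofReal ?_
    refine Integrable.hasFiniteIntegral ?_
    refine (integrable_const (1 + L ^ 2)).mono' (by fun_prop) ?_
    filter_upwards [hbt] with t ht
    rw [Real.norm_of_nonneg (by positivity)]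
    rw [Real.norm_eq_abs] at ht
    have := sq_le_sq' (by linarith [neg_abs_le t] : -L ≤ t) (by linarith [le_abs_self t])
    linarith
  · exact (withDensity_absolutelyContinuous _ _).ae_le hae
  · intro l hl
    rw [integral_withDensity_eq_integral_toReal_smul hdm
      (Eventually.of_forall fun _ => ENNReal.ofReal_lt_top), hrep l hl]
    have h1 : ∫ t : ℝ, (1 + t * l) / (t - l) ∂μ = ∫ t : ℝ, (((ENNReal.ofReal (1 + t ^ 2)).toReal • (1 / ((t : ℂ) - l))) - (t : ℂ)) ∂μ := by
      refine integral_congr_ae (Eventually.of_forall fun t => ?_)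
      simp only
      rw [ENNReal.toReal_ofReal (by positivity), Complex.real_smul]
      have := rl_ne_real hl t
      push_cast
      field_simp
      ring
    have h2 : Integrable (fun t : ℝ => (t : ℂ)) μ := hit.ofReal
    rw [h1, integral_sub _ h2, integral_complex_ofReal]
    · push_cast; ring
    · have := (rl_hker_int hl μ).add h2
      refine this.congr (Eventually.of_forall fun t => ?_)
      simp only [Pi.add_apply]
      rw [ENNReal.toReal_ofReal (by positivity), Complex.real_smul]
      have := rl_ne_real hl t
      push_cast
      field_simp
      ring


lemma rl_loc {F φ : ℂ → ℂ} {x0 : ℝ} (ha : AnalyticAt ℂ φ x0)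
    (hr : ∀ᶠ x : ℝ in nhds x0, (φ x).im = 0)
    (he : ∀ᶠ l : ℂ in nhds (x0 : ℂ), 0 < l.im → F l = φ l) :
    ∃ δ C : ℝ, 0 < δ ∧ ∀ x : ℝ, |x - x0| < δ → ∀ y : ℝ, 0 < y → y < δ →
      (F (x + y * I)).im ≤ C * y := by
  obtain ⟨C, t, ht, hL⟩ := (ha.contDiffAt (n := 1)).exists_lipschitzOnWith
  obtain ⟨δ1, h1, hb1⟩ := Metric.eventually_nhds_iff.1 hr
  obtain ⟨δ2, h2, hb2⟩ := Metric.eventually_nhds_iff.1 he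
  obtain ⟨δ3, h3, hb3⟩ := Metric.mem_nhds_iff.1 ht
  refine ⟨min δ1 (min (δ2 / 2) (δ3 / 2)), C, by positivity, ?_⟩
  intro x hx y hy0 hy
  rw [lt_min_iff, lt_min_iff] at hx hy
  have hd : dist ((x : ℂ) + y * I) x0 ≤ |x - x0| + y := by
    rw [dist_eq_norm]
    have : (x : ℂ) + y * I - x0 = ((x - x0 : ℝ) : ℂ) + y * I := by push_cast; ring
    rw [this]
    refine (norm_add_le _ _).trans ?_
    rw [Complex.norm_real, norm_mul, Complex.norm_real, Complex.norm_I, Real.norm_eq_abs,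
      Real.norm_eq_abs, abs_of_pos hy0]
    linarith
  have e1 : F (x + y * I) = φ (x + y * I) := hb2 (by linarith) (by simpa using hy0)
  have e2 : (φ x).im = 0 := hb1 (by rw [Real.dist_eq]; exact hx.1)
  have h4 := hL.dist_le_mul (x + y * I) (hb3 (by rw [Metric.mem_ball]; linarith)) x (hb3 (by
    rw [Metric.mem_ball, dist_eq_norm, ← Complex.ofReal_sub, Complex.norm_real, Real.norm_eq_abs]
    linarith))
  rw [dist_eq_norm, dist_eq_norm] at h4
  have h5 := Complex.abs_im_le_norm (φ (x + y * I) - φ x)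
  have h6 : ‖(x : ℂ) + y * I - x‖ = y := by
    simp [abs_of_pos hy0]
  rw [h6] at h4
  rw [Complex.sub_im, e2, sub_zero] at h5
  rw [e1]
  exact (le_abs_self _).trans (h5.trans h4)

/-- limit of the Cauchy transform at real points off the support -/
lemma rl_cauchy_lim {σ : Measure ℝ} [IsFiniteMeasure σ] {x d : ℝ} (hd : 0 < d)
    (hK : ∀ᵐ t ∂σ, d ≤ |t - x|) :
    Tendsto (fun y : ℝ => ∫ t : ℝ, 1 / ((t : ℂ) - (x + y * I)) ∂σ) (nhdsWithin 0 (Ioi 0))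
      (nhds ((∫ t : ℝ, 1 / (t - x) ∂σ : ℝ) : ℂ)) := by
  rw [← integral_complex_ofReal]
  refine tendsto_integral_filter_of_dominated_convergence (fun _ => 1 / d) ?_ ?_
    (integrable_const _) ?_
  · refine Eventually.of_forall fun y => ?_
    exact (by fun_prop : Measurable fun t : ℝ => 1 / ((t : ℂ) - (x + y * I))).aestronglyMeasurable
  · refine Eventually.of_forall fun y => ?_
    filter_upwards [hK] with t ht
    rw [norm_div, norm_one]
    apply one_div_le_one_div_of_le hd
    have := Complex.abs_re_le_norm ((t : ℂ) - (x + y * I))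
    simp at this
    linarith
  · filter_upwards [hK] with t ht
    have hne : (t : ℂ) - x ≠ 0 := by
      rw [← Complex.ofReal_sub, Complex.ofReal_ne_zero]
      intro h; rw [h] at ht; simp at ht; linarith
    have hc : ContinuousAt (fun y : ℝ => 1 / ((t : ℂ) - (x + y * I))) 0 := by
      refine ContinuousAt.div (by fun_prop) (by fun_prop) ?_
      simpa using hne
    have := hc.tendsto.mono_left (nhdsWithin_le_nhds (s := Ioi 0))
    simpa using this

lemma rl_endpoint {σ : Measure ℝ} [IsFiniteMeasure σ] {r A s : ℝ} (hr0 : 0 < r) (hr1 : r ≤ 1)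
    (hs : s ^ 2 = 1)
    (hK : ∀ᵐ t ∂σ, r ≤ |t| ∧ |t| ≤ 1 / r)
    (hQ : ∀ u : ℝ, 0 < u → u < r → 0 ≤ A + ∫ t : ℝ, 1 / ((s * t - u) * (s * t - 1 / u)) ∂σ)
    {e : ℝ} (he : e = r ∨ e = 1 / r) : σ.real {s * e} = 0 := by
  have hrr : r ≤ 1 / r := by rw [le_div_iff₀ hr0]; nlinarith
  have heb : r ≤ e ∧ e ≤ 1 / r := by rcases he with h | h <;> rw [h] <;> constructor <;> linarith
  set m := σ.real {s * e} with hm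
  have key : ∀ u : ℝ, 0 < u → u < r → m ≤ (e - u) * (1 / u - e) * (A + σ.real univ) := by
    intro u hu0 hur
    have hu1 : 1 / r < 1 / u := one_div_lt_one_div_of_lt hu0 hur
    have hpos : 0 < (e - u) * (1 / u - e) := mul_pos (by linarith [heb.1]) (by linarith [heb.2])
    have hb : ∀ᵐ t ∂σ, 1 / ((s * t - u) * (s * t - 1 / u)) ≤
        1 - ({s * e} : Set ℝ).indicator (fun _ => 1 / ((e - u) * (1 / u - e))) t ∧
        ‖1 / ((s * t - u) * (s * t - 1 / u))‖ ≤ 1 / ((r - u) * (1 / u - 1 / r)) + 1 := by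
      filter_upwards [hK] with t ht
      have hst : |s * t| = |t| := by
        rw [abs_mul]
        have : |s| = 1 := by rw [← sq_abs] at hs; nlinarith [abs_nonneg s]
        rw [this, one_mul]
      rw [← hst] at ht
      have hst2 : s * (s * t) = t := by rw [← mul_assoc, ← sq, hs, one_mul]
      have hq0 : 0 < (r - u) * (1 / u - 1 / r) := mul_pos (by linarith) (by linarith)
      rcases le_or_gt (s * t) 0 with h | h
      · rw [abs_of_nonpos h] at ht
        have hne : t ∉ ({s * e} : Set ℝ) := by
          intro h'
          rw [mem_singleton_iff] at h'
          rw [h', ← mul_assoc, ← sq, hs, one_mul] at h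
          linarith [heb.1]
        rw [indicator_of_notMem hne]
        have h1 : 1 ≤ (s * t - u) * (s * t - 1 / u) := by
          have h2 : 1 ≤ r * (1 / u) := by rw [mul_one_div, le_div_iff₀ hu0]; linarith
          have h3 : r * (1 / u) ≤ (u - s * t) * (1 / u - s * t) := by
            apply mul_le_mul <;> linarith [show 0 < 1 / u by positivity]
          nlinarith
        have h4 : 1 / ((s * t - u) * (s * t - 1 / u)) ≤ 1 := by
          rw [div_le_one (by linarith)]; exact h1
        refine ⟨by linarith, ?_⟩
        rw [Real.norm_of_nonneg (by positivity)]
        have : 0 < 1 / ((r - u) * (1 / u - 1 / r)) := by positivity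
        linarith
      · rw [abs_of_pos h] at ht
        have hq : 0 < (s * t - u) * (1 / u - s * t) := mul_pos (by linarith) (by linarith)
        have hq' : (s * t - u) * (s * t - 1 / u) = - ((s * t - u) * (1 / u - s * t)) := by ring
        constructor
        · by_cases h' : t ∈ ({s * e} : Set ℝ)
          · rw [indicator_of_mem h']
            rw [mem_singleton_iff] at h'
            have : s * t = e := by rw [h', ← mul_assoc, ← sq, hs, one_mul]
            rw [hq', this, div_neg]
            linarith
          · rw [indicator_of_notMem h', hq', div_neg]
            have : 0 < 1 / ((s * t - u) * (1 / u - s * t)) := by positivity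
            linarith
        · rw [hq', div_neg, norm_neg, Real.norm_of_nonneg (by positivity)]
          have : 1 / ((s * t - u) * (1 / u - s * t)) ≤ 1 / ((r - u) * (1 / u - 1 / r)) := by
            apply one_div_le_one_div_of_le hq0
            apply mul_le_mul <;> linarith
          linarith
    have hi1 : Integrable (fun t => 1 / ((s * t - u) * (s * t - 1 / u))) σ :=
      (integrable_const _).mono' (by fun_prop : Measurable _).aestronglyMeasurable
        (hb.mono fun t ht => ht.2)
    have hi2 : Integrable (({s * e} : Set ℝ).indicator (fun _ => 1 / ((e - u) * (1 / u - e)))) σ :=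
      (integrable_const _).indicator (measurableSet_singleton _)
    have h1 := integral_mono_ae hi1 ((integrable_const 1).sub hi2) (hb.mono fun t ht => ht.1)
    have h2 : ∫ t, (((fun _ : ℝ => (1:ℝ)) - ({s * e} : Set ℝ).indicator (fun _ => 1 / ((e - u) * (1 / u - e)))) : ℝ → ℝ) t ∂σ =
        σ.real univ - m * (1 / ((e - u) * (1 / u - e))) := by
      simp only [Pi.sub_apply]
      rw [integral_sub (integrable_const 1) hi2, integral_indicator (measurableSet_singleton _)]
      simp [hm, measureReal_def]
    rw [h2] at h1
    have h3 := hQ u hu0 hur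
    have h4 : m * (1 / ((e - u) * (1 / u - e))) ≤ A + σ.real univ := by linarith
    rw [mul_one_div, div_le_iff₀ hpos] at h4
    linarith
  refine le_antisymm ?_ measureReal_nonneg
  have hlim : Tendsto (fun u : ℝ => (e - u) * (1 / u - e) * (A + σ.real univ)) (nhdsWithin r (Iio r))
      (nhds 0) := by
    have hc : ContinuousAt (fun u : ℝ => (e - u) * (1 / u - e) * (A + σ.real univ)) r := by
      refine ContinuousAt.mul (ContinuousAt.mul (by fun_prop) (ContinuousAt.sub ?_ (by fun_prop))) (by fun_prop)
      exact ContinuousAt.div (by fun_prop) (by fun_prop) hr0.ne'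
    have h0 : (e - r) * (1 / r - e) * (A + σ.real univ) = 0 := by
      rcases he with h | h <;> rw [h] <;> ring
    have := hc.tendsto
    simp only [h0] at this
    exact this.mono_left nhdsWithin_le_nhds
  refine ge_of_tendsto hlim ?_
  filter_upwards [Ioo_mem_nhdsLT hr0] with u hu using key u hu.1 hu.2


lemma rl_core {r α β γ : ℝ} (hr0 : 0 < r) (hr1 : r ≤ 1) (hα : 0 < α) (hγ : 0 < γ)
    {F φ ψ : ℂ → ℂ} (hF : DifferentiableOn ℂ F {z : ℂ | 0 < z.im})
    (him : ∀ z : ℂ, 0 < z.im → 0 < (F z).im)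
    (hφa : ∀ x : ℝ, |x| < r → AnalyticAt ℂ φ x) (hφr : ∀ x : ℝ, |x| < r → (φ x).im = 0)
    (hφ0 : φ 0 = 0) (hφ1 : HasDerivAt φ 1 0)
    (hψa : ∀ x : ℝ, |x| < r → AnalyticAt ℂ ψ x) (hψr : ∀ x : ℝ, |x| < r → (ψ x).im = 0)
    (hψ0 : ψ 0 = 0) (hψ1 : HasDerivAt ψ 1 0)
    (hFφ : ∀ l : ℂ, 0 < l.im → ‖l‖ < 1 → F l = φ l)
    (hFψ : ∀ l : ℂ, 0 < l.im → 1 < ‖l‖ → (α:ℂ) ^ 2 * F l = l + 1 / l + β - (γ:ℂ) ^ 2 * ψ (1 / l))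
    (hQ : ∀ x : ℝ, x ≠ 0 → |x| < r →
      x * (α ^ 2 * (φ x).re - x - 1 / x - β + γ ^ 2 * (ψ x).re) ≤ 0) :
    (α = 1 ∧ γ = 1 ∧ β = 0) ∨
    (1 < α ∧ 1 < γ ∧ r ^ 2 < (γ ^ 2 - 1) / (α ^ 2 - 1) ∧ (γ ^ 2 - 1) / (α ^ 2 - 1) < 1 / r ^ 2) := by
  set K : Set ℝ := {t | r ≤ |t| ∧ |t| ≤ 1 / r} with hKdef
  have hinvr : ∀ x : ℝ, 1 / r < |x| → |1 / x| < r ∧ x ≠ 0 := by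
    intro x hx
    have h0 : 0 < |x| := lt_trans (by positivity) hx
    refine ⟨?_, abs_pos.1 h0⟩
    rw [abs_div, abs_one, div_lt_iff₀ h0]
    rw [div_lt_iff₀ hr0] at hx
    linarith
  have hαne : (α : ℂ) ^ 2 ≠ 0 := by
    have : (α : ℂ) ≠ 0 := by exact_mod_cast hα.ne'
    positivity
  have hrr : 1 ≤ 1 / r := by rw [le_div_iff₀ hr0]; linarith
  obtain ⟨σ, A, B, hfin, hσK, hrep⟩ := rl_rep hF him (K := K) (L := 1 / r)
    (fun t ht => abs_le.1 ht.2) (by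
      intro x0 hx0
      have : |x0| < r ∨ 1 / r < |x0| := by
        by_contra h
        push Not at h
        exact hx0 ⟨h.1, h.2⟩
      rcases this with h | h
      · refine rl_loc (hφa x0 h) ?_ ?_
        · filter_upwards [(isOpen_lt continuous_abs continuous_const).mem_nhds h] with x hx
          exact hφr x hx
        · have h1 : ‖(x0 : ℂ)‖ < 1 := by rw [Complex.norm_real, Real.norm_eq_abs]; linarith
          filter_upwards [(isOpen_lt continuous_norm continuous_const).mem_nhds h1] with l hl h0
          exact hFφ l h0 hl
      · obtain ⟨h1, h2⟩ := hinvr x0 h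
        have h2' : (x0 : ℂ) ≠ 0 := by exact_mod_cast h2
        refine rl_loc (φ := fun l => (l + 1 / l + β - (γ:ℂ) ^ 2 * ψ (1 / l)) / (α : ℂ) ^ 2) ?_ ?_ ?_
        · have hi : AnalyticAt ℂ (fun l : ℂ => 1 / l) x0 := by
            exact analyticAt_const.div analyticAt_id h2'
          have hp : AnalyticAt ℂ (fun l : ℂ => ψ (1 / l)) x0 := by
            refine AnalyticAt.fun_comp ?_ hi
            have := hψa (1 / x0) h1
            push_cast at this
            exact this
          exact (((analyticAt_id.add hi).add analyticAt_const).sub (analyticAt_const.mul hp)).div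
            analyticAt_const hαne
        · filter_upwards [(isOpen_lt continuous_const continuous_abs).mem_nhds h] with x hx
          have hx' := hψr (1 / x) (hinvr x hx).1
          push_cast at hx'
          have e : ψ (1 / x) = ((ψ (1 / x)).re : ℂ) := by
            apply Complex.ext <;> simp
            simpa using hx'
          rw [e]
          norm_cast
        · have h3 : 1 < ‖(x0 : ℂ)‖ := by rw [Complex.norm_real, Real.norm_eq_abs]; linarith
          filter_upwards [(isOpen_lt continuous_const continuous_norm).mem_nhds h3] with l hl h0
          rw [eq_div_iff hαne, mul_comm]
          exact hFψ l h0 hl)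
  have hσK' : ∀ᵐ t ∂σ, r ≤ |t| ∧ |t| ≤ 1 / r := hσK
  -- boundary values
  have hT : ∀ (x : ℝ), Tendsto (fun y : ℝ => (x : ℂ) + y * I) (nhdsWithin 0 (Ioi 0)) (nhds (x : ℂ)) := by
    intro x
    have : Tendsto (fun y : ℝ => (x : ℂ) + y * I) (nhds 0) (nhds ((x : ℂ) + (0:ℝ) * I)) :=
      Continuous.tendsto (by fun_prop) _
    simpa using this.mono_left (nhdsWithin_le_nhds (s := Ioi 0))
  have hbv : ∀ x d : ℝ, 0 < d → (∀ᵐ t ∂σ, d ≤ |t - x|) →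
      Tendsto (fun y : ℝ => F (x + y * I)) (nhdsWithin 0 (Ioi 0))
        (nhds ((B + A * x + ∫ t : ℝ, 1 / (t - x) ∂σ : ℝ) : ℂ)) := by
    intro x d hd hK
    have h1 := rl_cauchy_lim hd hK
    have h2 := (((hT x).const_mul (A : ℂ)).const_add (B : ℂ)).add h1
    push_cast
    push_cast at h2
    refine h2.congr' ?_
    filter_upwards [self_mem_nhdsWithin] with y hy
    exact (hrep _ (by simpa using hy)).symm
  have hd1 : ∀ x : ℝ, |x| < r → ∀ᵐ t ∂σ, r - |x| ≤ |t - x| := by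
    intro x hx
    filter_upwards [hσK'] with t ht
    have := abs_sub_abs_le_abs_sub t x
    linarith [ht.1]
  have hd2 : ∀ x : ℝ, x ≠ 0 → |x| < r → 0 < 1 / |x| - 1 / r ∧ ∀ᵐ t ∂σ, 1 / |x| - 1 / r ≤ |t - 1 / x| := by
    intro x h0 hx
    refine ⟨sub_pos.2 (one_div_lt_one_div_of_lt (abs_pos.2 h0) hx), ?_⟩
    filter_upwards [hσK'] with t ht
    have := abs_sub_abs_le_abs_sub (1 / x) t
    rw [abs_sub_comm, abs_div, abs_one] at this
    linarith [ht.2]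
  have hφeq : ∀ x : ℝ, |x| < r → φ x = ((B + A * x + ∫ t : ℝ, 1 / (t - x) ∂σ : ℝ) : ℂ) := by
    intro x hx
    have h1 := hbv x (r - |x|) (by linarith) (hd1 x hx)
    have h2 := (hφa x hx).continuousAt.tendsto.comp (hT x)
    refine tendsto_nhds_unique (h2.congr' ?_) h1
    have h3 : ‖(x : ℂ)‖ < 1 := by rw [Complex.norm_real, Real.norm_eq_abs]; linarith
    filter_upwards [self_mem_nhdsWithin,
      (hT x).eventually ((isOpen_lt continuous_norm continuous_const).mem_nhds h3)] with y hy hy2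
    exact (hFφ _ (by simpa using hy) hy2).symm
  have hψeq : ∀ x : ℝ, x ≠ 0 → |x| < r →
      ((α ^ 2 * (B + A * (1 / x) + ∫ t : ℝ, 1 / (t - 1 / x) ∂σ) : ℝ) : ℂ) =
        ((1 / x + x + β : ℝ) : ℂ) - ((γ ^ 2 : ℝ) : ℂ) * ψ x := by
    intro x h0 hx
    obtain ⟨hp, hk⟩ := hd2 x h0 hx
    have h1 := (hbv (1 / x) _ hp hk).const_mul ((α : ℂ) ^ 2)
    have hx0 : (x : ℂ) ≠ 0 := by exact_mod_cast h0
    have hx1 : ((1 / x : ℝ) : ℂ) ≠ 0 := by push_cast; simpa using hx0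
    have hinv : Tendsto (fun y : ℝ => 1 / (((1 / x : ℝ) : ℂ) + y * I)) (nhdsWithin 0 (Ioi 0)) (nhds (x : ℂ)) := by
      have := (tendsto_const_nhds (x := (1:ℂ))).div (hT (1 / x)) hx1
      have e : (1 : ℂ) / ((1 / x : ℝ) : ℂ) = x := by push_cast; field_simp
      rwa [e] at this
    have h2 := (((hT (1 / x)).add hinv).add_const (β : ℂ)).sub
      (((hψa x hx).continuousAt.tendsto.comp hinv).const_mul ((γ : ℂ) ^ 2))
    have h4 := tendsto_nhds_unique (h2.congr' ?_) h1
    · push_cast at h4 ⊢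
      exact h4.symm
    · have h3 : 1 < ‖((1 / x : ℝ) : ℂ)‖ := by
        rw [Complex.norm_real, Real.norm_eq_abs, abs_div, abs_one, lt_div_iff₀ (abs_pos.2 h0)]; linarith
      filter_upwards [self_mem_nhdsWithin,
        (hT (1 / x)).eventually ((isOpen_lt continuous_const continuous_norm).mem_nhds h3)] with y hy hy2
      exact (hFψ _ (by simpa using hy) hy2).symm
  have hψre : ∀ x : ℝ, x ≠ 0 → |x| < r →
      α ^ 2 * (B + A * (1 / x) + ∫ t : ℝ, 1 / (t - 1 / x) ∂σ) = 1 / x + x + β - γ ^ 2 * (ψ x).re := by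
    intro x h0 hx
    have := congrArg Complex.re (hψeq x h0 hx)
    rw [Complex.ofReal_re, Complex.sub_re, Complex.ofReal_re, Complex.re_ofReal_mul] at this
    exact this
  have hφre : ∀ x : ℝ, |x| < r → (φ x).re = B + A * x + ∫ t : ℝ, 1 / (t - x) ∂σ := by
    intro x hx
    have := congrArg Complex.re (hφeq x hx)
    rwa [Complex.ofReal_re] at this
  -- integrability
  have hint : ∀ (g : ℝ → ℝ) (C : ℝ), Measurable g → (∀ t, r ≤ |t| → |t| ≤ 1 / r → |g t| ≤ C) → Integrable g σ := by
    intro g C hg hC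
    refine (integrable_const C).mono' hg.aestronglyMeasurable ?_
    filter_upwards [hσK'] with t ht using hC t ht.1 ht.2
  have hint1 : ∀ x : ℝ, |x| < r → Integrable (fun t : ℝ => 1 / (t - x)) σ := by
    intro x hx
    refine (integrable_const (1 / (r - |x|))).mono' (by fun_prop : Measurable _).aestronglyMeasurable ?_
    filter_upwards [hd1 x hx] with t ht
    rw [norm_div, norm_one]
    exact one_div_le_one_div_of_le (by linarith) ht
  have hint2 : ∀ x : ℝ, x ≠ 0 → |x| < r → Integrable (fun t : ℝ => 1 / (t - 1 / x)) σ := by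
    intro x h0 hx
    obtain ⟨hp, hk⟩ := hd2 x h0 hx
    refine (integrable_const (1 / (1 / |x| - 1 / r))).mono' (by fun_prop : Measurable _).aestronglyMeasurable ?_
    filter_upwards [hk] with t ht
    rw [norm_div, norm_one]
    exact one_div_le_one_div_of_le hp ht
  -- sign condition
  have hsign : ∀ x : ℝ, x ≠ 0 → |x| < r → 0 ≤ A + ∫ t : ℝ, 1 / ((t - x) * (t - 1 / x)) ∂σ := by
    intro x h0 hx
    have h1 := hQ x h0 hx
    have h2 := hφre x hx
    have h3 := hψre x h0 hx
    have h4 : (∫ t : ℝ, 1 / (t - x) ∂σ) - ∫ t : ℝ, 1 / (t - 1 / x) ∂σ =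
        (x - 1 / x) * ∫ t : ℝ, 1 / ((t - x) * (t - 1 / x)) ∂σ := by
      rw [← integral_sub (hint1 x hx) (hint2 x h0 hx), ← integral_const_mul]
      refine integral_congr_ae ?_
      filter_upwards [hd1 x hx, (hd2 x h0 hx).2] with t ht1 ht2
      have n1 : t - x ≠ 0 := by
        rw [← abs_pos]; linarith
      have n2 : t - 1 / x ≠ 0 := by
        rw [← abs_pos]; linarith [(hd2 x h0 hx).1]
      rw [div_sub_div _ _ n1 n2, mul_one_div]
      congr 1
      ring
    have h5 : x * (α ^ 2 * (φ x).re - x - 1 / x - β + γ ^ 2 * (ψ x).re) =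
        α ^ 2 * ((x ^ 2 - 1) * (A + ∫ t : ℝ, 1 / ((t - x) * (t - 1 / x)) ∂σ)) := by
      have e1 : x * (x - 1 / x) = x ^ 2 - 1 := by field_simp
      rw [h2]
      linear_combination x * h3 + α ^ 2 * x * h4 + α ^ 2 * (A + ∫ t : ℝ, 1 / ((t - x) * (t - 1 / x)) ∂σ) * e1
    rw [h5] at h1
    have hx2 : x ^ 2 - 1 < 0 := by
      rw [← sq_abs]; nlinarith [abs_nonneg x]
    have h6 : (x ^ 2 - 1) * (A + ∫ t : ℝ, 1 / ((t - x) * (t - 1 / x)) ∂σ) ≤ 0 :=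
      nonpos_of_mul_nonpos_right h1 (by positivity)
    by_contra hneg
    push Not at hneg
    nlinarith
  -- endpoints
  have hend : ∀ s : ℝ, s = 1 ∨ s = -1 → ∀ e : ℝ, e = r ∨ e = 1 / r → σ.real {s * e} = 0 := by
    intro s hs e he
    have hs2 : s ^ 2 = 1 := by rcases hs with h | h <;> rw [h] <;> norm_num
    refine rl_endpoint (A := A) hr0 hr1 hs2 hσK' ?_ he
    intro u hu0 hur
    have hsabs : |s| = 1 := by rcases hs with h | h <;> rw [h] <;> norm_num
    have hs0 : s ≠ 0 := by rcases hs with h | h <;> rw [h] <;> norm_num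
    have := hsign (s * u) (mul_ne_zero hs0 hu0.ne') (by rw [abs_mul, hsabs, abs_of_pos hu0]; linarith)
    have e2 : ∀ t : ℝ, (t - s * u) * (t - 1 / (s * u)) = (s * t - u) * (s * t - 1 / u) := by
      intro t
      rcases hs with h | h <;> rw [h]
      · simp
      · field_simp; ring
    simpa only [e2] using this
  have hstrict : ∀ᵐ t ∂σ, r < |t| ∧ |t| < 1 / r := by
    have hp : ∀ s : ℝ, s = 1 ∨ s = -1 → ∀ e : ℝ, e = r ∨ e = 1 / r → ∀ᵐ t ∂σ, t ≠ s * e := by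
      intro s hs e he
      have := hend s hs e he
      rw [measureReal_eq_zero_iff] at this
      rw [ae_iff]
      simpa using this
    filter_upwards [hσK', hp 1 (by simp) r (by simp), hp 1 (by simp) (1 / r) (by simp),
      hp (-1) (by simp) r (by simp), hp (-1) (by simp) (1 / r) (by simp)] with t ht h1 h2 h3 h4
    have q1 : r ≠ |t| := by
      intro h
      rcases abs_choice t with h' | h' <;> rw [h'] at h
      · exact h1 (by linarith)
      · exact h3 (by linarith)
    have q2 : |t| ≠ 1 / r := by
      intro h
      rcases abs_choice t with h' | h' <;> rw [h'] at h
      · exact h2 (by linarith)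
      · exact h4 (by linarith)
    exact ⟨lt_of_le_of_ne ht.1 q1, lt_of_le_of_ne ht.2 q2⟩
  -- moments
  have hder : ∀ φ : ℂ → ℂ, φ 0 = 0 → HasDerivAt φ 1 0 →
      Tendsto (fun x : ℝ => (φ x).re / x) (nhdsWithin 0 {0}ᶜ) (nhds 1) := by
    intro φ h0 h1
    have h2 : HasDerivAt (fun x : ℝ => (φ x).re) (1:ℂ).re 0 := HasDerivAt.real_of_complex (by simpa using h1)
    rw [hasDerivAt_iff_tendsto_slope] at h2
    simp only [Complex.one_re] at h2
    refine h2.congr fun x => ?_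
    rw [slope_def_field]
    simp [h0]
  have hsmall : ∀ᶠ x : ℝ in nhdsWithin 0 {0}ᶜ, |x| < r / 2 := by
    apply mem_nhdsWithin_of_mem_nhds
    have := (isOpen_lt (continuous_abs (G := ℝ)) (continuous_const (y := r / 2))).mem_nhds
      (x := (0:ℝ)) (by simpa using hr0)
    exact this
  have hne : ∀ᶠ x : ℝ in nhdsWithin 0 {0}ᶜ, x ≠ 0 := self_mem_nhdsWithin
  have hB : B + ∫ t : ℝ, 1 / t ∂σ = 0 := by
    have := hφre 0 (by simpa using hr0)
    simpa [hφ0] using this.symm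
  have hM2 : A + ∫ t : ℝ, 1 / t ^ 2 ∂σ = 1 := by
    have hlim : Tendsto (fun x : ℝ => ∫ t : ℝ, 1 / (t * (t - x)) ∂σ) (nhdsWithin 0 {0}ᶜ)
        (nhds (∫ t : ℝ, 1 / t ^ 2 ∂σ)) := by
      refine tendsto_integral_filter_of_dominated_convergence (fun _ => 1 / (r * (r / 2))) ?_ ?_
        (integrable_const _) ?_
      · exact Eventually.of_forall fun x => (by fun_prop : Measurable _).aestronglyMeasurable
      · filter_upwards [hsmall] with x hx
        filter_upwards [hσK'] with t ht
        rw [norm_div, norm_one, norm_mul]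
        apply one_div_le_one_div_of_le (by positivity)
        have := abs_sub_abs_le_abs_sub t x
        apply mul_le_mul ht.1 _ (by positivity) (by positivity)
        rw [Real.norm_eq_abs]
        linarith [ht.1]
      · filter_upwards [hσK'] with t ht
        have ht0 : t ≠ 0 := by rw [← abs_pos]; linarith [ht.1]
        have hc : ContinuousAt (fun x : ℝ => 1 / (t * (t - x))) 0 :=
          ContinuousAt.div (by fun_prop) (by fun_prop) (by simpa using ht0)
        have := hc.tendsto.mono_left (nhdsWithin_le_nhds (s := {0}ᶜ))
        simpa [sq] using this
    refine tendsto_nhds_unique ((hlim.const_add A).congr' ?_) (hder φ hφ0 hφ1)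
    filter_upwards [hsmall, hne] with x hx hx0
    have hx' : |x| < r := by linarith
    rw [hφre x hx', eq_div_iff hx0]
    have h4 : (∫ t : ℝ, 1 / (t - x) ∂σ) - ∫ t : ℝ, 1 / t ∂σ = x * ∫ t : ℝ, 1 / (t * (t - x)) ∂σ := by
      have hi0 : Integrable (fun t : ℝ => 1 / t) σ := by
        simpa using hint1 0 (by simpa using hr0)
      rw [← integral_sub (hint1 x hx') hi0, ← integral_const_mul]
      refine integral_congr_ae ?_
      filter_upwards [hd1 x hx', hσK'] with t ht1 ht2
      have n1 : t - x ≠ 0 := by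
        rw [← abs_pos]; linarith
      have n2 : t ≠ 0 := by
        rw [← abs_pos]; linarith
      field_simp
      ring
    linear_combination -hB - h4
  have hH : Tendsto (fun x : ℝ => ∫ t : ℝ, 1 / (t * x - 1) ∂σ) (nhdsWithin 0 {0}ᶜ)
      (nhds (-σ.real univ)) := by
    have e0 : -σ.real univ = ∫ t : ℝ, (-1:ℝ) ∂σ := by simp
    rw [e0]
    refine tendsto_integral_filter_of_dominated_convergence (fun _ => 1 / (1 / 2)) ?_ ?_
      (integrable_const _) ?_
    · exact Eventually.of_forall fun x => (by fun_prop : Measurable _).aestronglyMeasurable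
    · filter_upwards [hsmall] with x hx
      filter_upwards [hσK'] with t ht
      rw [norm_div, norm_one]
      apply one_div_le_one_div_of_le (by positivity)
      have h1 := abs_sub_abs_le_abs_sub 1 (t * x)
      rw [abs_sub_comm, abs_one, abs_mul] at h1
      have h2 : |t| * |x| ≤ 1 / r * (r / 2) := by gcongr; exact ht.2
      have h3 : 1 / r * (r / 2) = 1 / 2 := by field_simp
      rw [Real.norm_eq_abs]
      linarith
    · filter_upwards [] with t
      have hc : ContinuousAt (fun x : ℝ => 1 / (t * x - 1)) 0 :=
        ContinuousAt.div (by fun_prop) (by fun_prop) (by simp)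
      have := hc.tendsto.mono_left (nhdsWithin_le_nhds (s := {0}ᶜ))
      simpa using this
  have hψq := hder ψ hψ0 hψ1
  have hid : Tendsto (fun x : ℝ => x) (nhdsWithin 0 {0}ᶜ) (nhds 0) :=
    tendsto_id.mono_left nhdsWithin_le_nhds
  have hψl : Tendsto (fun x : ℝ => (ψ x).re) (nhdsWithin 0 {0}ᶜ) (nhds 0) := by
    have := hψq.mul hid
    rw [mul_zero] at this
    refine this.congr' ?_
    filter_upwards [hne] with x hx
    field_simp
  have hrel : ∀ᶠ x : ℝ in nhdsWithin 0 {0}ᶜ, x ≠ 0 ∧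
      α ^ 2 * (B + A * (1 / x) + x * ∫ t : ℝ, 1 / (t * x - 1) ∂σ) = 1 / x + x + β - γ ^ 2 * (ψ x).re := by
    filter_upwards [hsmall, hne] with x hx hx0
    refine ⟨hx0, ?_⟩
    rw [← hψre x hx0 (by linarith), ← integral_const_mul]
    congr 2
    refine integral_congr_ae (Eventually.of_forall fun t => ?_)
    simp only
    have : t - 1 / x = (t * x - 1) / x := by field_simp
    rw [this, one_div_div, mul_one_div]
  have hA1 : α ^ 2 * A = 1 := by
    have l1 : Tendsto (fun x : ℝ => α ^ 2 * (B * x + A + x * x * ∫ t : ℝ, 1 / (t * x - 1) ∂σ))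
        (nhdsWithin 0 {0}ᶜ) (nhds (α ^ 2 * (B * 0 + A + 0 * 0 * (-σ.real univ)))) :=
      ((((hid.const_mul B).add_const A)).add ((hid.mul hid).mul hH)).const_mul _
    have l2 : Tendsto (fun x : ℝ => 1 + x * x + β * x - γ ^ 2 * (x * (ψ x).re))
        (nhdsWithin 0 {0}ᶜ) (nhds (1 + 0 * 0 + β * 0 - γ ^ 2 * (0 * 0))) :=
      (((hid.mul hid).const_add 1).add (hid.const_mul β)).sub ((hid.mul hψl).const_mul _)
    have := tendsto_nhds_unique (l1.congr' ?_) l2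
    · simpa using this
    · filter_upwards [hrel] with x hx
      have e : x * (1 / x) = 1 := by field_simp [hx.1]
      linear_combination x * hx.2 + (1 - α ^ 2 * A) * e
  have hB1 : α ^ 2 * B = β := by
    have l1 : Tendsto (fun x : ℝ => α ^ 2 * (B + x * ∫ t : ℝ, 1 / (t * x - 1) ∂σ))
        (nhdsWithin 0 {0}ᶜ) (nhds (α ^ 2 * (B + 0 * (-σ.real univ)))) :=
      ((hid.mul hH).const_add B).const_mul _
    have l2 : Tendsto (fun x : ℝ => x + β - γ ^ 2 * ((ψ x).re))
        (nhdsWithin 0 {0}ᶜ) (nhds (0 + β - γ ^ 2 * (0))) :=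
      (hid.add_const β).sub (hψl.const_mul _)
    have := tendsto_nhds_unique (l1.congr' ?_) l2
    · simpa using this
    · filter_upwards [hrel] with x hx
      linear_combination hx.2 - (1 / x) * hA1
  have hM0 : α ^ 2 * σ.real univ = γ ^ 2 - 1 := by
    have l1 := hH.const_mul (α ^ 2)
    have l2 : Tendsto (fun x : ℝ => 1 - γ ^ 2 * ((ψ x).re / x))
        (nhdsWithin 0 {0}ᶜ) (nhds (1 - γ ^ 2 * 1)) :=
      (hψq.const_mul _).const_sub 1
    have := tendsto_nhds_unique (l1.congr' ?_) l2
    · linarith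
    · filter_upwards [hrel] with x hx
      have h1 : x * (α ^ 2 * ∫ t : ℝ, 1 / (t * x - 1) ∂σ) = x * (1 - γ ^ 2 * ((ψ x).re / x)) := by
        have e : x * ((ψ x).re / x) = (ψ x).re := by field_simp [hx.1]
        linear_combination hx.2 - (1 / x) * hA1 - hB1 + γ ^ 2 * e
      exact mul_left_cancel₀ hx.1 h1
  have hM2' : α ^ 2 * (∫ t : ℝ, 1 / t ^ 2 ∂σ) = α ^ 2 - 1 := by
    linear_combination α ^ 2 * hM2 - hA1
  by_cases hσ : σ = 0
  · left
    rw [hσ] at hM2' hM0 hB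
    simp at hM2' hM0 hB
    refine ⟨by nlinarith, by nlinarith, ?_⟩
    rw [← hB1, hB, mul_zero]
  · right
    have hi2 : Integrable (fun t : ℝ => 1 / t ^ 2) σ := by
      refine hint _ (1 / r ^ 2) (by fun_prop) ?_
      intro t h1 h2
      rw [abs_of_nonneg (by positivity)]
      apply one_div_le_one_div_of_le (by positivity)
      rw [← sq_abs t]
      gcongr
    have hpos : ∀ g : ℝ → ℝ, Integrable g σ → (∀ᵐ t ∂σ, 0 < g t) → 0 < ∫ t, g t ∂σ := by
      intro g hg h
      rw [integral_pos_iff_support_of_nonneg_ae (h.mono fun t ht => ht.le) hg]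
      have : σ (Function.support g) = σ univ := by
        apply measure_congr
        filter_upwards [h] with t ht
        simp only [eq_iff_iff]
        exact ⟨fun _ => trivial, fun _ => ht.ne'⟩
      rw [this]
      exact (Measure.measure_univ_pos).2 hσ
    have p1 : 0 < ∫ t : ℝ, (1 / t ^ 2 - r ^ 2) ∂σ := by
      apply hpos _ (hi2.sub (integrable_const _))
      filter_upwards [hstrict] with t ht
      have ht0 : 0 < |t| := by linarith [ht.1]
      simp only [Pi.sub_apply]
      rw [sub_pos, ← sq_abs t, lt_div_iff₀ (by positivity)]
      have h1 : |t| * r < 1 := by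
        have := ht.2
        rwa [lt_div_iff₀ hr0] at this
      have : 0 < |t| * r := by positivity
      nlinarith
    have p2 : 0 < ∫ t : ℝ, (1 - r ^ 2 * (1 / t ^ 2)) ∂σ := by
      apply hpos _ ((integrable_const _).sub (hi2.const_mul _))
      filter_upwards [hstrict] with t ht
      have ht0 : 0 < |t| := by linarith [ht.1]
      simp only [Pi.sub_apply]
      rw [sub_pos, ← sq_abs t, mul_one_div, div_lt_one (by positivity)]
      gcongr
      exact ht.1
    rw [integral_sub hi2 (integrable_const _)] at p1
    rw [integral_sub (integrable_const _) (hi2.const_mul _), integral_const_mul] at p2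
    simp only [integral_const, smul_eq_mul, mul_one] at p1 p2
    have p0 : 0 < σ.real univ := by
      have h9 := hpos (fun _ => 1) (integrable_const _) (Eventually.of_forall fun _ => one_pos)
      simpa using h9
    have hα2 : 0 < α ^ 2 := by positivity
    have g1 : 0 < γ ^ 2 - 1 := by rw [← hM0]; positivity
    have hr2 : 0 < r ^ 2 := by positivity
    have p3 : 0 < ∫ t : ℝ, 1 / t ^ 2 ∂σ := by nlinarith [mul_pos p0 hr2]
    have g2 : 0 < α ^ 2 - 1 := by rw [← hM2']; positivity
    refine ⟨by nlinarith, by nlinarith, ?_, ?_⟩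
    · rw [lt_div_iff₀ g2, ← hM2', ← hM0]
      nlinarith
    · rw [div_lt_div_iff₀ g2 hr2, ← hM2', ← hM0]
      nlinarith

section opA
variable {H : Type*} [NormedAddCommGroup H] [InnerProductSpace ℂ H] [CompleteSpace H]

/-- the function `u ⟨e, (1 + u A)⁻¹ e⟩` -/
def rlG (A : H →L[ℂ] H) (e : H) (u : ℂ) : ℂ :=
  u * inner ℂ e ((Ring.inverse (1 + u • A)) e)

lemma rlG_unit {A : H →L[ℂ] H} (hA : IsSelfAdjoint A) {R : ℝ} (hR : ‖A‖ ≤ R) {u : ℂ}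
    (hu : u.im ≠ 0 ∨ ‖u‖ * R < 1) : IsUnit (1 + u • A) := by
  rcases hu with hu | hu
  · have hu0 : u ≠ 0 := by rintro rfl; simp at hu
    have h1 : (-1/u) ∉ spectrum ℂ A := by
      intro h
      have h2 := hA.mem_spectrum_eq_re h
      have h3 : (-1/u).im = 0 := by rw [h2]; simp
      have h4 : (-1/u).im = u.im / Complex.normSq u := by
        rw [neg_div, one_div, Complex.neg_im, Complex.inv_im]; ring
      rw [h4, div_eq_zero_iff] at h3
      rcases h3 with h3 | h3
      · exact hu h3
      · exact hu0 (Complex.normSq_eq_zero.1 h3)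
    rw [spectrum.notMem_iff] at h1
    have h5 : (1 + u • A) = (-u) • (algebraMap ℂ (H →L[ℂ] H) (-1/u) - A) := by
      rw [Algebra.algebraMap_eq_smul_one, smul_sub, smul_smul]
      have : -u * (-1/u) = 1 := by field_simp
      rw [this]; simp
    rw [h5]
    have h6 : IsUnit (algebraMap ℂ (H →L[ℂ] H) (-u)) :=
      (IsUnit.mk0 _ (neg_ne_zero.2 hu0)).map _
    have h7 := h6.mul h1
    rwa [← Algebra.smul_def] at h7
  · have h1 : ‖-(u • A)‖ < 1 := by
      rw [norm_neg, norm_smul]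
      exact lt_of_le_of_lt (by gcongr) hu
    have := isUnit_one_sub_of_norm_lt_one h1
    simpa using this

lemma rlG_diff {A : H →L[ℂ] H} (e : H) {u : ℂ} (hu : IsUnit (1 + u • A)) :
    DifferentiableAt ℂ (rlG A e) u := by
  obtain ⟨x, hx⟩ := hu
  have h1 : DifferentiableAt ℂ (fun u : ℂ => Ring.inverse (1 + u • A)) u := by
    have h2 : DifferentiableAt ℂ (Ring.inverse : (H →L[ℂ] H) → _) (1 + u • A) := by
      rw [← hx]; exact (hasFDerivAt_ringInverse (𝕜 := ℂ) x).differentiableAt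
    have h3 : DifferentiableAt ℂ (fun u : ℂ => 1 + u • A) u := by fun_prop
    exact DifferentiableAt.comp u h2 h3
  have h3 : DifferentiableAt ℂ (fun u : ℂ => Ring.inverse (1 + u • A) e) u :=
    h1.clm_apply (differentiableAt_const e)
  have h4 : DifferentiableAt ℂ (fun u : ℂ => inner ℂ e (Ring.inverse (1 + u • A) e)) u :=
    ((innerSL ℂ e).differentiableAt).comp u h3
  exact differentiableAt_id.mul h4

lemma rlG_an {A : H →L[ℂ] H} (hA : IsSelfAdjoint A) {R : ℝ} (hR : ‖A‖ ≤ R) (e : H) {u : ℂ}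
    (hu : u.im ≠ 0 ∨ ‖u‖ * R < 1) : AnalyticAt ℂ (rlG A e) u := by
  have ho : IsOpen {u : ℂ | u.im ≠ 0 ∨ ‖u‖ * R < 1} := by
    apply IsOpen.union
    · exact isOpen_ne_fun Complex.continuous_im continuous_const
    · exact isOpen_lt (f := fun u : ℂ => ‖u‖ * R) (by fun_prop) continuous_const
  have hd : DifferentiableOn ℂ (rlG A e) {u : ℂ | u.im ≠ 0 ∨ ‖u‖ * R < 1} := fun w hw =>
    (rlG_diff e (rlG_unit hA hR hw)).differentiableWithinAt
  exact hd.analyticAt (ho.mem_nhds hu)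

lemma rlG_zero (A : H →L[ℂ] H) (e : H) : rlG A e 0 = 0 := by simp [rlG]

lemma rlG_deriv {A : H →L[ℂ] H} {e : H} (he : ‖e‖ = 1) : HasDerivAt (rlG A e) 1 0 := by
  have hc : DifferentiableAt ℂ (fun u : ℂ => inner ℂ e (Ring.inverse (1 + u • A) e)) 0 := by
    have h2 : DifferentiableAt ℂ (Ring.inverse : (H →L[ℂ] H) → _) (1 + (0:ℂ) • A) := by
      have : (1 + (0:ℂ) • A) = ((1 : (H →L[ℂ] H)ˣ) : H →L[ℂ] H) := by simp
      rw [this]; exact (hasFDerivAt_ringInverse (𝕜 := ℂ) _).differentiableAt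
    have h1 : DifferentiableAt ℂ (fun u : ℂ => Ring.inverse (1 + u • A)) 0 := by
      have h3 : DifferentiableAt ℂ (fun u : ℂ => 1 + u • A) 0 := by fun_prop
      exact DifferentiableAt.comp (0:ℂ) h2 h3
    exact ((innerSL ℂ e).differentiableAt).comp _ (h1.clm_apply (differentiableAt_const e))
  have := (hasDerivAt_id (0:ℂ)).mul hc.hasDerivAt
  have e1 : (1:ℂ) = 1 * inner ℂ e (Ring.inverse (1 + (0:ℂ) • A) e) + id (0:ℂ) * deriv
      (fun u : ℂ => inner ℂ e (Ring.inverse (1 + u • A) e)) 0 := by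
    simp [he, inner_self_eq_norm_sq_to_K]
  rw [e1]; exact this

lemma rlG_conj {A : H →L[ℂ] H} (hA : IsSelfAdjoint A) (e : H) (u : ℂ) :
    rlG A e (starRingEnd ℂ u) = starRingEnd ℂ (rlG A e u) := by
  unfold rlG
  have h1 : (1 + (starRingEnd ℂ u) • A) = star (1 + u • A) := by
    rw [star_add, star_one, star_smul, hA.star_eq]; rfl
  rw [map_mul, h1, Ring.inverse_star, inner_conj_symm, ContinuousLinearMap.star_eq_adjoint,
    ContinuousLinearMap.adjoint_inner_right]

lemma rlG_eq {A : H →L[ℂ] H} (hA : IsSelfAdjoint A) {R : ℝ} (hR : ‖A‖ ≤ R) (e : H) {z c : ℂ}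
    (hz : z ≠ 0) (hu : (-1/z).im ≠ 0 ∨ ‖-1/z‖ * R < 1) {v : H} (hv : A v - z • v = c • e) :
    inner ℂ e v = c * rlG A e (-1/z) := by
  have hU := rlG_unit hA hR hu
  have h1 : (1 + (-1/z) • A) v = (-1/z) • (c • e) := by
    rw [← hv]
    simp only [_root_.add_apply, one_apply_eq_self,
      _root_.smul_apply, smul_sub, smul_smul]
    have : -1/z * z = -1 := by field_simp
    rw [this]; simp [add_comm]
  have h2 : v = (Ring.inverse (1 + (-1/z) • A)) ((-1/z) • (c • e)) := by
    rw [← h1, ← mul_apply_eq_comp, Ring.inverse_mul_cancel _ hU]; simp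
  unfold rlG
  conv_lhs => rw [h2]
  rw [map_smul, map_smul, inner_smul_right, inner_smul_right]; ring

lemma rlG_ex {A : H →L[ℂ] H} (hA : IsSelfAdjoint A) {R : ℝ} (hR : ‖A‖ ≤ R) (e : H) {z : ℂ}
    (hz : z ≠ 0) (hu : (-1/z).im ≠ 0 ∨ ‖-1/z‖ * R < 1) : ∃ v : H, A v - z • v = e := by
  have hU := rlG_unit hA hR hu
  refine ⟨(-1/z) • (Ring.inverse (1 + (-1/z) • A)) e, ?_⟩
  have h1 : (1 + (-1/z) • A) ((Ring.inverse (1 + (-1/z) • A)) e) = e := by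
    rw [← mul_apply_eq_comp, Ring.mul_inverse_cancel _ hU]; simp
  conv_rhs => rw [← h1]
  simp only [_root_.add_apply, one_apply_eq_self,
      _root_.smul_apply, smul_smul, map_smul]
  have : z * (-1/z) = -1 := by field_simp
  rw [this]; simp [sub_eq_add_neg, add_comm]

lemma rlG_im {A : H →L[ℂ] H} (hA : IsSelfAdjoint A) {e v : H} (he : e ≠ 0) {z : ℂ}
    (hz : 0 < z.im) (hv : A v - z • v = e) : 0 < (inner ℂ e v).im := by
  have hv0 : v ≠ 0 := by rintro rfl; simp at hv; exact he hv.symm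
  have h1 : (inner ℂ (A v) v).im = 0 := by
    have h2 : inner ℂ (A v) v = inner ℂ v (A v) := by
      have := hA.isSymmetric v v
      simpa using this
    have h3 := inner_conj_symm v (A v) (𝕜 := ℂ)
    rw [h2] 
    rw [h2] at h3
    exact Complex.conj_eq_iff_im.1 h3
  rw [← hv, inner_sub_left, inner_smul_left, Complex.sub_im, h1, inner_self_eq_norm_sq_to_K]
  have : 0 < ‖v‖ := norm_pos_iff.2 hv0
  have e1 : ((starRingEnd ℂ) z * ((‖v‖ : ℝ) : ℂ) ^ 2).im = - z.im * ‖v‖^2 := by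
    rw [← Complex.ofReal_pow, Complex.im_mul_ofReal]; simp
  erw [e1]
  nlinarith [mul_pos hz (pow_pos this 2)]
end opA

abbrev rlH := lp (fun _ : ℤ => ℂ) 2

lemma rl_memlp {f : ℤ → ℂ} (hf : Summable fun n => ‖f n‖ ^ 2) :
    Memℓp (E := fun _ : ℤ => ℂ) f 2 := by
  apply memℓp_gen
  simpa using hf

lemma rl_lp_summable (u : rlH) : Summable fun n => ‖u n‖ ^ 2 := by
  have := (lp.memℓp u).summable (by norm_num)
  simpa using this

lemma rl_lp_norm (u : rlH) : ‖u‖ ^ 2 = ∑' n, ‖u n‖ ^ 2 := by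
  have := lp.norm_rpow_eq_tsum (p := 2) (by norm_num) u
  simpa using this

open Classical in
/-- coordinate projection -/
def rlP (S : Set ℤ) : rlH →L[ℂ] rlH :=
  LinearMap.mkContinuous
    { toFun := fun u => ⟨fun n => if n ∈ S then u n else 0, by
        apply rl_memlp
        refine Summable.of_nonneg_of_le (fun n => by positivity) (fun n => ?_) (rl_lp_summable u)
        split_ifs <;> simp [sq_nonneg]⟩
      map_add' := by
        intro u v; ext n
        simp only [lp.coeFn_add, Pi.add_apply]
        split_ifs <;> simp
      map_smul' := by
        intro c u; ext n
        simp only [lp.coeFn_smul, Pi.smul_apply, RingHom.id_apply]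
        split_ifs <;> simp } 1 (by
    intro u
    rw [one_mul]
    apply le_of_sq_le_sq _ (norm_nonneg _)
    rw [rl_lp_norm, rl_lp_norm]
    refine Summable.tsum_le_tsum (fun n => ?_) (rl_lp_summable _) (rl_lp_summable u)
    simp only [LinearMap.coe_mk, AddHom.coe_mk]
    split_ifs <;> simp [sq_nonneg])

open Classical in
lemma rlP_apply (S : Set ℤ) (u : rlH) (n : ℤ) : rlP S u n = if n ∈ S then u n else 0 := rfl

lemma rlP_norm (S : Set ℤ) : ‖rlP S‖ ≤ 1 := LinearMap.mkContinuous_norm_le _ zero_le_one _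

/-- basis vector -/
def rlE (k : ℤ) : rlH := lp.single 2 k (1:ℂ)

lemma rlE_apply (k n : ℤ) : rlE k n = if n = k then 1 else 0 := by
  unfold rlE
  rw [lp.single_apply]
  by_cases h : n = k
  · subst h; simp
  · simp [h]

lemma rlE_inner (k : ℤ) (u : rlH) : inner ℂ (rlE k) u = u k := by
  unfold rlE; rw [lp.inner_single_left]; simp

lemma rlE_norm (k : ℤ) : ‖rlE k‖ = 1 := by
  unfold rlE; rw [lp.norm_single (by norm_num)]; simp

lemma rl_sa_of {A : rlH →L[ℂ] rlH} (h : ∀ n u, inner ℂ (A (rlE n)) u = A u n) :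
    IsSelfAdjoint A := by
  rw [ContinuousLinearMap.isSelfAdjoint_iff']
  ext u n
  rw [← rlE_inner n, ContinuousLinearMap.adjoint_inner_right, h]

lemma rlP_sa (S : Set ℤ) : IsSelfAdjoint (rlP S) := by
  apply rl_sa_of
  intro n u
  by_cases h : n ∈ S
  · have : rlP S (rlE n) = rlE n := by
      ext m; rw [rlP_apply, rlE_apply]; split_ifs with h1 h2 <;> simp_all
    rw [this, rlE_inner, rlP_apply, if_pos h]
  · have : rlP S (rlE n) = 0 := by
      ext m; rw [rlP_apply, rlE_apply]; split_ifs with h1 h2 <;> simp_all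
    rw [this, rlP_apply, if_neg h, inner_zero_left]

lemma rlT_sa {a b : ℤ → ℝ} {T : rlH →L[ℂ] rlH} (hT : ∀ u : rlH, ∀ n : ℤ,
    T u n = (a n : ℂ) * u (n + 1) + (a (n - 1) : ℂ) * u (n - 1) + (b n : ℂ) * u n) :
    IsSelfAdjoint T := by
  apply rl_sa_of
  intro n u
  have : T (rlE n) = (a n : ℂ) • rlE (n+1) + (a (n-1) : ℂ) • rlE (n-1) + (b n : ℂ) • rlE n := by
    ext m
    simp only [hT, lp.coeFn_add, Pi.add_apply, lp.coeFn_smul, Pi.smul_apply, rlE_apply, smul_eq_mul]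
    by_cases h1 : m = n
    · subst h1
      have h4 : m ≠ m - 1 := by omega
      simp [h4]
    · by_cases h2 : m = n + 1
      · subst h2
        have h4 : n + 1 + 1 ≠ n := by omega
        have h5 : n + 1 ≠ n - 1 := by omega
        simp [h4, h5]
      · by_cases h3 : m = n - 1
        · subst h3
          have h4 : n - 1 - 1 ≠ n := by omega
          have h5 : n - 1 ≠ n + 1 := by omega
          simp [h4, h5]
        · have h4 : m + 1 ≠ n := by omega
          have h5 : m - 1 ≠ n := by omega
          simp [h1, h2, h3, h4, h5]
  rw [this]
  simp only [inner_add_left, inner_smul_left, rlE_inner, hT, Complex.conj_ofReal]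

/-- truncated operator -/
def rlTS (T : rlH →L[ℂ] rlH) (S : Set ℤ) : rlH →L[ℂ] rlH := rlP S * T * rlP S

lemma rlTS_sa {T : rlH →L[ℂ] rlH} (hT : IsSelfAdjoint T) (S : Set ℤ) : IsSelfAdjoint (rlTS T S) := by
  have := hT.conjugate (rlP S)
  rwa [(rlP_sa S).star_eq] at this

lemma rlTS_norm {T : rlH →L[ℂ] rlH} {R : ℝ} (hT : ‖T‖ ≤ R) (S : Set ℤ) : ‖rlTS T S‖ ≤ R := by
  unfold rlTS
  have h0 := rlP_norm S
  calc ‖rlP S * T * rlP S‖ ≤ ‖rlP S‖ * ‖T‖ * ‖rlP S‖ :=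
        (norm_mul_le _ _).trans (by gcongr; exact norm_mul_le _ _)
    _ ≤ 1 * ‖T‖ * 1 := by gcongr
    _ ≤ R := by simpa using hT

/-- vectors supported in `S` solving the truncated equation with right side `c δ_k` -/
def rlSol (T : rlH →L[ℂ] rlH) (S : Set ℤ) (k : ℤ) (z c : ℂ) (v : rlH) : Prop :=
  (∀ n ∉ S, v n = 0) ∧ ∀ n ∈ S, T v n - z * v n = if n = k then c else 0

lemma rlSol_iff {T : rlH →L[ℂ] rlH} {S : Set ℤ} {k : ℤ} (hk : k ∈ S) {z c : ℂ} (hz : z ≠ 0)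
    (v : rlH) : rlSol T S k z c v ↔ rlTS T S v - z • v = c • rlE k := by
  have hx : (∀ n ∉ S, v n = 0) → rlP S v = v := by
    intro h; ext n; rw [rlP_apply]; split_ifs with h1
    · rfl
    · rw [h n h1]
  constructor
  · rintro ⟨h1, h2⟩
    ext n
    simp only [rlTS, mul_apply_eq_comp, hx h1, lp.coeFn_sub, Pi.sub_apply, lp.coeFn_smul,
      Pi.smul_apply, smul_eq_mul, rlP_apply, rlE_apply]
    by_cases hn : n ∈ S
    · rw [if_pos hn, h2 n hn]; split_ifs <;> simp
    · have : n ≠ k := by rintro rfl; exact hn hk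
      simp [hn, h1 n hn, this]
  · intro h
    have h' : ∀ n, (rlTS T S v - z • v) n = (c • rlE k) n := fun n => by rw [h]
    simp only [rlTS, mul_apply_eq_comp, lp.coeFn_sub, Pi.sub_apply, lp.coeFn_smul,
      Pi.smul_apply, smul_eq_mul, rlP_apply, rlE_apply] at h'
    have h1 : ∀ n ∉ S, v n = 0 := by
      intro n hn
      have := h' n
      have h3 : n ≠ k := by rintro rfl; exact hn hk
      simpa [hn, h3, hz] using this
    refine ⟨h1, fun n hn => ?_⟩
    have := h' n
    rw [if_pos hn, hx h1] at this
    rw [this]; split_ifs <;> simp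

/-- resolvent entries -/
def rlg (T : rlH →L[ℂ] rlH) (S : Set ℤ) (k : ℤ) (u : ℂ) : ℂ := rlG (rlTS T S) (rlE k) u

lemma rlg_eq {T : rlH →L[ℂ] rlH} (hT : IsSelfAdjoint T) {R : ℝ} (hR : ‖T‖ ≤ R)
    {S : Set ℤ} {k : ℤ} (hk : k ∈ S) {z c : ℂ} (hz : z ≠ 0)
    (hu : (-1/z).im ≠ 0 ∨ ‖-1/z‖ * R < 1) {v : rlH} (hv : rlSol T S k z c v) :
    v k = c * rlg T S k (-1/z) := by
  rw [rlSol_iff hk hz] at hv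
  rw [← rlE_inner]
  exact rlG_eq (rlTS_sa hT S) (rlTS_norm hR S) _ hz hu hv

lemma rlg_ex {T : rlH →L[ℂ] rlH} (hT : IsSelfAdjoint T) {R : ℝ} (hR : ‖T‖ ≤ R)
    {S : Set ℤ} {k : ℤ} (hk : k ∈ S) {z : ℂ} (hz : z ≠ 0)
    (hu : (-1/z).im ≠ 0 ∨ ‖-1/z‖ * R < 1) :
    ∃ v : rlH, rlSol T S k z 1 v ∧ v k = rlg T S k (-1/z) := by
  obtain ⟨v, hv⟩ := rlG_ex (rlTS_sa hT S) (rlTS_norm hR S) (rlE k) hz hu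
  have h : rlSol T S k z 1 v := by
    rw [rlSol_iff hk hz, hv, one_smul]
  refine ⟨v, h, ?_⟩
  rw [rlg_eq hT hR hk hz hu h, one_mul]

lemma rl_neg_inv_im {z : ℂ} : (-1/z).im = z.im / Complex.normSq z := by
  rw [neg_div, one_div, Complex.neg_im, Complex.inv_im]; ring

lemma rl_neg_inv_ne {z : ℂ} (hz : z.im ≠ 0) : (-1/z).im ≠ 0 := by
  rw [rl_neg_inv_im]
  apply div_ne_zero hz
  rw [Ne, Complex.normSq_eq_zero]; rintro rfl; simp at hz

lemma rlg_pos {T : rlH →L[ℂ] rlH} (hT : IsSelfAdjoint T)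
    {S : Set ℤ} {k : ℤ} (hk : k ∈ S) {z : ℂ} (hz : 0 < z.im) :
    0 < (rlg T S k (-1/z)).im := by
  have hz0 : z ≠ 0 := by rintro rfl; simp at hz
  obtain ⟨v, hv, h⟩ := rlg_ex hT le_rfl hk hz0 (Or.inl (rl_neg_inv_ne hz.ne'))
  rw [← h, ← rlE_inner]
  rw [rlSol_iff hk hz0, one_smul] at hv
  refine rlG_im (rlTS_sa hT S) ?_ hz hv
  intro h0
  have := rlE_norm k
  rw [h0] at this; simp at this

/-- right half line resolvent entry -/
def rlp (T : rlH →L[ℂ] rlH) (n : ℤ) (u : ℂ) : ℂ := rlg T (Ici (n+1)) (n+1) u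
/-- left half line resolvent entry -/
def rlm (T : rlH →L[ℂ] rlH) (n : ℤ) (u : ℂ) : ℂ := rlg T (Iic (n-1)) (n-1) u

section conc
variable {a b : ℤ → ℝ} {T : rlH →L[ℂ] rlH} (hT : ∀ u : rlH, ∀ n : ℤ,
    T u n = (a n : ℂ) * u (n + 1) + (a (n - 1) : ℂ) * u (n - 1) + (b n : ℂ) * u n)
include hT

lemma rl_schur_p (n : ℤ) {z : ℂ} (hz : z.im ≠ 0) :
    rlp T n (-1/z) * (-(a (n+1):ℂ)^2 * rlp T (n+1) (-1/z) + b (n+1) - z) = 1 := by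
  have hz0 : z ≠ 0 := by rintro rfl; simp at hz
  have hu := Or.inl (b := ‖-1/z‖ * ‖T‖ < 1) (rl_neg_inv_ne hz)
  obtain ⟨v, ⟨hv1, hv2⟩, h⟩ := rlg_ex (rlT_sa hT) le_rfl (S := Ici (n+1)) (k := n+1) (by simp) hz0 hu
  have hw : rlSol T (Ici (n+1+1)) (n+1+1) z (-(a (n+1) : ℂ) * v (n+1)) (rlP (Ici (n+1+1)) v) := by
    constructor
    · intro m hm; rw [rlP_apply, if_neg hm]
    · intro m hm
      simp only [mem_Ici] at hm
      have h2 := hv2 m (by simp only [mem_Ici]; omega)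
      rw [if_neg (by omega), hT] at h2
      simp only [hT, rlP_apply, mem_Ici]
      rw [if_pos (by omega), if_pos hm]
      by_cases hm' : m = n + 1 + 1
      · subst hm'
        rw [if_pos rfl, if_neg (by omega)]
        have e1 : n + 1 + 1 - 1 = n + 1 := by ring
        rw [e1] at h2 ⊢
        linear_combination h2
      · rw [if_neg hm', if_pos (by omega)]
        exact h2
  have h3 := rlg_eq (rlT_sa hT) le_rfl (by simp) hz0 hu hw
  rw [rlP_apply, if_pos (by simp)] at h3
  have h4 := hv2 (n+1) (by simp)
  rw [if_pos rfl, hT] at h4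
  have h5 := hv1 (n+1-1) (by simp)
  rw [h5, h3] at h4
  unfold rlp
  rw [← h]
  linear_combination h4

lemma rl_schur_m (n : ℤ) {z : ℂ} (hz : z.im ≠ 0) :
    rlm T (n+1) (-1/z) * (-(a (n-1):ℂ)^2 * rlm T n (-1/z) + b n - z) = 1 := by
  have hz0 : z ≠ 0 := by rintro rfl; simp at hz
  have hu := Or.inl (b := ‖-1/z‖ * ‖T‖ < 1) (rl_neg_inv_ne hz)
  obtain ⟨v, ⟨hv1, hv2⟩, h⟩ := rlg_ex (rlT_sa hT) le_rfl (S := Iic n) (k := n) (by simp) hz0 hu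
  have hw : rlSol T (Iic (n-1)) (n-1) z (-(a (n-1) : ℂ) * v n) (rlP (Iic (n-1)) v) := by
    constructor
    · intro m hm; rw [rlP_apply, if_neg hm]
    · intro m hm
      simp only [mem_Iic] at hm
      have h2 := hv2 m (by simp only [mem_Iic]; omega)
      rw [if_neg (by omega), hT] at h2
      simp only [hT, rlP_apply, mem_Iic]
      rw [if_pos (c := m - 1 ≤ n - 1) (by omega), if_pos hm]
      by_cases hm' : m = n - 1
      · subst hm'
        rw [if_pos rfl, if_neg (by omega)]
        have e1 : n - 1 + 1 = n := by ring
        rw [e1] at h2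
        linear_combination h2
      · rw [if_neg hm', if_pos (by omega)]
        exact h2
  have h3 := rlg_eq (rlT_sa hT) le_rfl (by simp) hz0 hu hw
  rw [rlP_apply, if_pos (by simp)] at h3
  have h4 := hv2 n (by simp)
  rw [if_pos rfl, hT] at h4
  have h5 := hv1 (n+1) (by simp)
  rw [h5, h3] at h4
  unfold rlm
  have e1 : n + 1 - 1 = n := by ring
  rw [e1, ← h]
  linear_combination h4

open Classical in
lemma rl_mp (ha : ∀ n, 0 < a n) {z : ℂ} (hz : z.im ≠ 0) {f : ℤ → ℂ}
    (hf : ∀ n : ℤ, (a n : ℂ) * f (n + 1) + (a (n - 1) : ℂ) * f (n - 1) + (b n : ℂ) * f n = z * f n)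
    (hs : Summable fun n : ℕ => ‖f (n : ℤ)‖ ^ 2) (h0 : f 0 ≠ 0) :
    -(f 1 / ((a 0 : ℂ) * f 0)) = rlp T 0 (-1/z) := by
  have hz0 : z ≠ 0 := by rintro rfl; simp at hz
  have hu := Or.inl (b := ‖-1/z‖ * ‖T‖ < 1) (rl_neg_inv_ne hz)
  have ha0 : (a 0 : ℂ) ≠ 0 := by exact_mod_cast (ha 0).ne'
  have hmem : Memℓp (E := fun _ : ℤ => ℂ) (fun n : ℤ => if 1 ≤ n then f n else 0) 2 := by
    apply rl_memlp
    apply Summable.of_nat_of_neg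
    · refine Summable.of_nonneg_of_le (fun n => by positivity) (fun n => ?_) hs
      split_ifs <;> simp
    · apply summable_of_ne_finset_zero (s := ∅)
      intro n _
      rw [if_neg (by omega)]; simp
  have hv : rlSol T (Ici (0+1)) (0+1) z (-(a 0 : ℂ) * f 0) ⟨_, hmem⟩ := by
    constructor
    · intro n hn
      simp only [mem_Ici] at hn
      simp only
      rw [if_neg (by omega)]
    · intro n hn
      simp only [mem_Ici] at hn
      rw [hT]
      simp only
      rw [if_pos (by omega), if_pos (by omega : 1 ≤ n)]
      have h2 := hf n
      by_cases h : n = 0 + 1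
      · subst h
        rw [if_neg (by omega), if_pos rfl]
        simp only [zero_add, sub_self] at h2 ⊢
        linear_combination h2
      · rw [if_neg h, if_pos (by omega)]
        linear_combination h2
  have h3 := rlg_eq (rlT_sa hT) le_rfl (by simp) hz0 hu hv
  simp only [zero_add, le_refl, if_true] at h3
  unfold rlp
  simp only [zero_add]
  rw [h3]; field_simp

open Classical in
lemma rl_mm (ha : ∀ n, 0 < a n) {z : ℂ} (hz : z.im ≠ 0) {f : ℤ → ℂ}
    (hf : ∀ n : ℤ, (a n : ℂ) * f (n + 1) + (a (n - 1) : ℂ) * f (n - 1) + (b n : ℂ) * f n = z * f n)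
    (hs : Summable fun n : ℕ => ‖f (-(n : ℤ))‖ ^ 2) (h0 : f 0 ≠ 0) :
    f 1 / ((a 0 : ℂ) * f 0) = (z - b 0 + (a (0-1) : ℂ)^2 * rlm T 0 (-1/z)) / (a 0 : ℂ)^2 := by
  have hz0 : z ≠ 0 := by rintro rfl; simp at hz
  have hu := Or.inl (b := ‖-1/z‖ * ‖T‖ < 1) (rl_neg_inv_ne hz)
  have ha0 : (a 0 : ℂ) ≠ 0 := by exact_mod_cast (ha 0).ne'
  have hmem : Memℓp (E := fun _ : ℤ => ℂ) (fun n : ℤ => if n ≤ -1 then f n else 0) 2 := by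
    apply rl_memlp
    apply Summable.of_nat_of_neg
    · apply summable_of_ne_finset_zero (s := ∅)
      intro n _
      rw [if_neg (by omega)]; simp
    · refine Summable.of_nonneg_of_le (fun n => by positivity) (fun n => ?_) hs
      split_ifs <;> simp
  have hv : rlSol T (Iic (0-1)) (0-1) z (-(a (0-1) : ℂ) * f 0) ⟨_, hmem⟩ := by
    constructor
    · intro n hn
      simp only [mem_Iic] at hn
      simp only
      rw [if_neg (by omega)]
    · intro n hn
      simp only [mem_Iic] at hn
      rw [hT]
      simp only
      rw [if_pos (by omega : n - 1 ≤ -1), if_pos (by omega : n ≤ -1)]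
      have h2 := hf n
      by_cases h : n = 0 - 1
      · subst h
        rw [if_neg (by omega), if_pos rfl]
        have e1 : (0:ℤ) - 1 + 1 = 0 := by ring
        rw [e1] at h2
        linear_combination h2
      · rw [if_neg h, if_pos (by omega)]
        linear_combination h2
  have h3 := rlg_eq (rlT_sa hT) le_rfl (by simp) hz0 hu hv
  have h4 := hf 0
  simp only [zero_sub, le_refl, if_true, zero_add] at h3 h4
  unfold rlm
  simp only [zero_sub]
  rw [h3] at h4
  generalize rlg T (Iic (-1)) (-1) (-1 / z) = G at *
  field_simp
  linear_combination h4

lemma rl_sign {R : ℝ} (hR : ‖T‖ ≤ R) (n : ℤ) {E : ℝ} (hE0 : E ≠ 0) (hE : ‖-1/(E:ℂ)‖ * R < 1)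
    (hER : R < |E|) :
    0 ≤ E * ((a n)^2 * (rlp T n (-1/(E:ℂ))).re + E - b n +
      (a (n-1))^2 * (rlm T n (-1/(E:ℂ))).re) := by
  have hz0 : (E:ℂ) ≠ 0 := by exact_mod_cast hE0
  have hu := Or.inr (a := (-1/(E:ℂ)).im ≠ 0) hE
  obtain ⟨v, ⟨hv1, hv2⟩, hv⟩ :=
    rlg_ex (rlT_sa hT) hR (S := Ici (n+1)) (k := n+1) (by simp) hz0 hu
  obtain ⟨w, ⟨hw1, hw2⟩, hw⟩ :=
    rlg_ex (rlT_sa hT) hR (S := Iic (n-1)) (k := n-1) (by simp) hz0 hu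
  set f : rlH := rlE n - (a n : ℂ) • v - (a (n-1) : ℂ) • w with hf
  set c : ℂ := -((a n:ℂ)^2 * rlp T n (-1/(E:ℂ)) + E - b n + (a (n-1):ℂ)^2 * rlm T n (-1/(E:ℂ)))
    with hc
  have hfm : ∀ m, f m = (if m = n then 1 else 0) - a n * v m - a (n-1) * w m := by
    intro m
    simp only [hf, lp.coeFn_sub, Pi.sub_apply, lp.coeFn_smul, Pi.smul_apply, smul_eq_mul, rlE_apply]
  have hTf : T f - (E:ℂ) • f = c • rlE n := by
    ext m
    simp only [lp.coeFn_sub, Pi.sub_apply, lp.coeFn_smul, Pi.smul_apply, smul_eq_mul, rlE_apply, hT,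
      hfm]
    rcases lt_trichotomy m n with h | h | h
    · have e1 := hw2 m (by simp only [mem_Iic]; omega)
      rw [hT] at e1
      rw [hv1 m (by simp only [mem_Ici]; omega), hv1 (m-1) (by simp only [mem_Ici]; omega),
        hv1 (m+1) (by simp only [mem_Ici]; omega), if_neg (c := m = n) (by omega),
        if_neg (c := m - 1 = n) (by omega)]
      by_cases h' : m = n - 1
      · subst h'
        rw [if_pos rfl] at e1
        rw [if_pos (by omega)]
        linear_combination -(a (n-1) : ℂ) * e1
      · rw [if_neg h'] at e1
        rw [if_neg (by omega)]
        linear_combination -(a (n-1) : ℂ) * e1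
    · subst h
      rw [hv1 m (by simp only [mem_Ici]; omega), hv1 (m-1) (by simp only [mem_Ici]; omega),
        hw1 m (by simp only [mem_Iic]; omega), hw1 (m+1) (by simp only [mem_Iic]; omega),
        hv, hw, hc, if_neg (by omega), if_pos rfl, if_neg (by omega)]
      unfold rlp rlm
      ring
    · have e1 := hv2 m (by simp only [mem_Ici]; omega)
      rw [hT] at e1
      rw [hw1 m (by simp only [mem_Iic]; omega), hw1 (m-1) (by simp only [mem_Iic]; omega),
        hw1 (m+1) (by simp only [mem_Iic]; omega), if_neg (c := m = n) (by omega),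
        if_neg (c := m + 1 = n) (by omega)]
      by_cases h' : m = n + 1
      · subst h'
        have e2 : n + 1 - 1 = n := by ring
        rw [if_pos rfl] at e1
        rw [if_pos (by omega)]
        rw [e2] at e1 ⊢
        linear_combination -(a n : ℂ) * e1
      · rw [if_neg h'] at e1
        rw [if_neg (by omega)]
        linear_combination -(a n : ℂ) * e1
  have hfn : f n = 1 := by
    rw [hfm, hv1 n (by simp), hw1 n (by simp)]; simp
  have h1 : inner ℂ f (T f) - E * ((‖f‖^2 : ℝ) : ℂ) = c := by
    have h2 : inner ℂ f (T f - (E:ℂ) • f) = inner ℂ f (c • rlE n) := by rw [hTf]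
    rw [inner_sub_right, inner_smul_right, inner_smul_right, inner_self_eq_norm_sq_to_K,
      ← inner_conj_symm f (rlE n), rlE_inner, hfn] at h2
    simpa using h2
  have h2 := congrArg Complex.re h1
  rw [Complex.sub_re, ← Complex.ofReal_mul, Complex.ofReal_re] at h2
  have h3 : |(inner ℂ f (T f)).re| ≤ R * ‖f‖^2 := by
    calc |(inner ℂ f (T f)).re| ≤ ‖inner ℂ f (T f)‖ := Complex.abs_re_le_norm _
      _ ≤ ‖f‖ * ‖T f‖ := norm_inner_le_norm _ _
      _ ≤ ‖f‖ * (R * ‖f‖) := by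
        gcongr
        exact (T.le_opNorm f).trans (by gcongr)
      _ = _ := by ring
  have h4 : c.re = -((a n)^2 * (rlp T n (-1/(E:ℂ))).re + E - b n +
      (a (n-1))^2 * (rlm T n (-1/(E:ℂ))).re) := by
    rw [hc]
    simp only [Complex.neg_re, Complex.add_re, Complex.sub_re, Complex.ofReal_re,
      ← Complex.ofReal_pow, Complex.re_ofReal_mul]
  have h5 := abs_le.1 h3
  have h6 : 0 ≤ ‖f‖^2 := by positivity
  rcases lt_or_gt_of_ne hE0 with h | h
  · rw [abs_of_neg h] at hER
    apply mul_nonneg_of_nonpos_of_nonpos h.le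
    nlinarith [mul_nonneg (sub_nonneg.2 hER.le) h6]
  · rw [abs_of_pos h] at hER
    apply mul_nonneg h.le
    nlinarith [mul_nonneg (sub_nonneg.2 hER.le) h6]
end conc

lemma rl_Omega_open : IsOpen Omega22 := by
  have : Omega22 = {z : ℂ | z.im ≠ 0} ∪ ({z : ℂ | -2 < z.re} ∩ {z : ℂ | z.re < 2}) := by
    ext z; simp [Omega22]
  rw [this]
  exact (isOpen_ne_fun Complex.continuous_im continuous_const).union
    ((isOpen_lt continuous_const Complex.continuous_re).inter
    (isOpen_lt Complex.continuous_re continuous_const))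

lemma rl_vert (z : ℂ) : Tendsto (fun y : ℝ => z + y * I) (nhdsWithin 0 (Ioi 0)) (nhds z) := by
  have h : Continuous (fun y : ℝ => z + y * I) := by fun_prop
  have := h.tendsto 0
  simp only [ofReal_zero, zero_mul, add_zero] at this
  exact this.mono_left nhdsWithin_le_nhds

lemma rl_contin {mp mm : ℂ → ℂ} (hp : ∀ z, 0 < z.im → DifferentiableAt ℂ mp z)
    (hm : ∀ z, 0 < z.im → DifferentiableAt ℂ mm z)
    (hpi : ∀ z, 0 < z.im → 0 < (mp z).im) (hmi : ∀ z, 0 < z.im → 0 < (mm z).im)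
    (hrefl : ∀ᵐ x : ℝ, x ∈ Set.Ioo (-2:ℝ) 2 →
    Tendsto (fun y : ℝ => mp (↑x + ↑y * I) + starRingEnd ℂ (mm (↑x + ↑y * I)))
      (nhdsWithin 0 (Set.Ioi 0)) (nhds 0)) :
    ∃ M : ℂ → ℂ, DifferentiableOn ℂ M Omega22 ∧ (∀ z ∈ Omega22, 0 < (M z).im) ∧
      (∀ z, 0 < z.im → M z = mp z) ∧
      (∀ z, z.im < 0 → M z = - starRingEnd ℂ (mm (starRingEnd ℂ z))) := by
  classical
  set K : ℂ → ℂ := fun z => if 0 < z.im then mp z else - starRingEnd ℂ (mm (starRingEnd ℂ z))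
    with hK
  have hKp : ∀ z, 0 < z.im → K z = mp z := fun z hz => by simp only [hK]; rw [if_pos hz]
  have hKm : ∀ z, z.im < 0 → K z = - starRingEnd ℂ (mm (starRingEnd ℂ z)) := fun z hz => by
    simp only [hK]; rw [if_neg (by linarith)]
  have hKi : ∀ z, z.im ≠ 0 → 0 < (K z).im := by
    intro z hz
    rcases lt_or_gt_of_ne hz with h | h
    · rw [hKm z h]; simpa using hmi (starRingEnd ℂ z) (by simpa using h)
    · rw [hKp z h]; exact hpi z h
  have hKd : ∀ z, z.im ≠ 0 → DifferentiableAt ℂ K z := by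
    intro z hz
    rcases lt_or_gt_of_ne hz with h | h
    · have h1 : DifferentiableAt ℂ (fun z => - starRingEnd ℂ (mm (starRingEnd ℂ z))) z := by
        have h2 := (hm (starRingEnd ℂ z) (by simpa using h)).star_star
        rw [starRingEnd_apply, star_star] at h2
        exact h2.neg
      refine h1.congr_of_eventuallyEq ?_
      filter_upwards [(isOpen_lt Complex.continuous_im continuous_const).mem_nhds h] with w hw
      exact hKm w hw
    · refine (hp z h).congr_of_eventuallyEq ?_
      filter_upwards [(isOpen_lt continuous_const Complex.continuous_im).mem_nhds h] with w hw
      exact hKp w hw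
  set C : ℂ → ℂ := fun z => if z.im = 0 then 0 else (K z - I) / (K z + I) with hC
  have hC1 : ∀ z, z.im ≠ 0 → C z = (K z - I) / (K z + I) := fun z hz => by
    simp only [hC]; rw [if_neg hz]
  have hClt : ∀ z, ‖C z‖ < 1 := by
    intro z
    by_cases hz : z.im = 0
    · simp only [hC]; rw [if_pos hz]; simp
    · rw [hC1 z hz]; exact rl_cayley_lt (hKi z hz)
  obtain ⟨D, hD, hDC⟩ := rl_painleve (C := C) (fun z hz => by simp only [hC]; rw [if_pos hz])
    (by
      intro z hz
      have h1 : DifferentiableAt ℂ (fun z => (K z - I) / (K z + I)) z :=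
        ((hKd z hz).sub_const I).div ((hKd z hz).add_const I) (rl_plus_I (hKi z hz))
      refine h1.congr_of_eventuallyEq ?_
      filter_upwards [(isOpen_ne_fun Complex.continuous_im continuous_const).mem_nhds hz] with w hw
      exact hC1 w hw) (fun z => (hClt z).le)
    (by
      filter_upwards [hrefl] with x hx hx2
      have h1 := (hx hx2).norm.const_mul 2
      simp only [norm_zero, mul_zero] at h1
      refine squeeze_zero_norm' ?_ h1
      filter_upwards [self_mem_nhdsWithin] with y hy
      simp only [mem_Ioi] at hy
      have e1 : ((x:ℂ) + y * I).im = y := by simp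
      have e2 : ((x:ℂ) - y * I).im = -y := by simp
      have e3 : starRingEnd ℂ ((x:ℂ) - y * I) = x + y * I := by simp
      have i1 := hKi (x + y * I) (by rw [e1]; exact hy.ne')
      have i2 := hKi (x - y * I) (by rw [e2]; simpa using hy.ne')
      rw [hC1 _ (by rw [e1]; exact hy.ne'), hC1 _ (by rw [e2]; simpa using hy.ne')]
      have e4 := hKp (x + y * I) (by rw [e1]; exact hy)
      have e5 := hKm (x - y * I) (by rw [e2]; linarith)
      rw [e3] at e5
      have e6 : mp (x + y * I) + starRingEnd ℂ (mm (x + y * I)) =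
        K (x + y * I) - K (x - y * I) := by rw [e4, e5]; ring
      rw [e6]
      have n1 := rl_plus_I i1
      have n2 := rl_plus_I i2
      have b1 : 1 ≤ ‖K (x + y * I) + I‖ := by
        refine le_trans ?_ (Complex.abs_im_le_norm _)
        rw [Complex.add_im, Complex.I_im, abs_of_pos (by linarith)]; linarith
      have b2 : 1 ≤ ‖K (x - y * I) + I‖ := by
        refine le_trans ?_ (Complex.abs_im_le_norm _)
        rw [Complex.add_im, Complex.I_im, abs_of_pos (by linarith)]; linarith
      have e7 : (K (x + y * I) - I) / (K (x + y * I) + I) -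
          (K (x - y * I) - I) / (K (x - y * I) + I) =
          2 * I * (K (x + y * I) - K (x - y * I)) /
            ((K (x + y * I) + I) * (K (x - y * I) + I)) := by
        field_simp; ring
      rw [e7, norm_div, norm_mul, norm_mul, norm_mul]
      simp only [Complex.norm_ofNat, Complex.norm_I, mul_one]
      apply div_le_self (by positivity)
      nlinarith)
  have hDle : ∀ z ∈ Omega22, ‖D z‖ ≤ 1 := by
    intro z hz
    by_cases h : z.im = 0
    · have h1 : Tendsto (fun y : ℝ => ‖D (z + y * I)‖) (nhdsWithin 0 (Ioi 0)) (nhds ‖D z‖) :=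
        (((hD.differentiableAt (rl_Omega_open.mem_nhds hz)).continuousAt.tendsto).comp
          (rl_vert z)).norm
      refine le_of_tendsto h1 ?_
      filter_upwards [self_mem_nhdsWithin] with y hy
      simp only [mem_Ioi] at hy
      rw [hDC _ (by simp [h, hy.ne'])]
      exact (hClt _).le
    · rw [hDC z h]; exact (hClt z).le
  have hDlt : ∀ z ∈ Omega22, ‖D z‖ < 1 := by
    intro z hz
    by_contra hc
    have hz1 : ‖D z‖ = 1 := le_antisymm (hDle z hz) (not_lt.1 hc)
    have hO := rl_Omega_open.mem_nhds hz
    have hmax : IsLocalMax (norm ∘ D) z := by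
      filter_upwards [hO] with w hw
      change ‖D w‖ ≤ ‖D z‖
      rw [hz1]; exact hDle w hw
    have h2 := Complex.norm_eventually_eq_of_isLocalMax (f := D) (c := z)
      (by filter_upwards [hO] with w hw; exact hD.differentiableAt (rl_Omega_open.mem_nhds hw)) hmax
    by_cases h : z.im = 0
    · obtain ⟨y, hy1, hy2⟩ := (((rl_vert z).eventually h2).and self_mem_nhdsWithin).exists
      have hy2 : 0 < y := hy2
      rw [hDC _ (by simp [h, hy2.ne']), hz1] at hy1
      exact absurd hy1 (hClt _).ne
    · rw [hDC z h] at hz1; exact absurd hz1 (hClt z).ne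
  have hMK : ∀ z, z.im ≠ 0 → I * (1 + D z) / (1 - D z) = K z := by
    intro z hz
    rw [hDC z hz, hC1 z hz]
    have := rl_plus_I (hKi z hz)
    have e1 : 1 - (K z - I) / (K z + I) = 2 * I / (K z + I) := by field_simp; ring
    have e2 : 1 + (K z - I) / (K z + I) = 2 * K z / (K z + I) := by field_simp; ring
    rw [e1, e2]
    have := Complex.I_ne_zero
    field_simp
  refine ⟨fun z => I * (1 + D z) / (1 - D z), ?_, fun z hz => rl_cayley_inv_im (hDlt z hz),
    fun z hz => ?_, fun z hz => ?_⟩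
  · apply DifferentiableOn.div
    · exact (hD.const_add 1).const_mul I
    · exact hD.const_sub 1
    · intro z hz h
      have := hDlt z hz
      rw [← sub_eq_zero.1 h] at this
      simp at this
  · exact (hMK z hz.ne').trans (hKp z hz)
  · exact (hMK z hz.ne).trans (hKm z hz)

lemma rlg_conj {T : rlH →L[ℂ] rlH} (hT : IsSelfAdjoint T) (S : Set ℤ) (k : ℤ) (u : ℂ) :
    rlg T S k (starRingEnd ℂ u) = starRingEnd ℂ (rlg T S k u) := rlG_conj (rlTS_sa hT S) _ _

lemma rlg_neg {T : rlH →L[ℂ] rlH} (hT : IsSelfAdjoint T)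
    {S : Set ℤ} {k : ℤ} (hk : k ∈ S) {z : ℂ} (hz : z.im < 0) :
    (rlg T S k (-1/z)).im < 0 := by
  have h := rlg_pos hT hk (z := starRingEnd ℂ z) (by simpa using hz)
  have e : -1 / (starRingEnd ℂ z) = starRingEnd ℂ (-1/z) := by simp
  rw [e, rlg_conj hT] at h
  simpa using h

lemma rlg_dz {T : rlH →L[ℂ] rlH} (hT : IsSelfAdjoint T) (S : Set ℤ) (k : ℤ) {z : ℂ}
    (hz : z.im ≠ 0) : DifferentiableAt ℂ (fun z => rlg T S k (-1/z)) z := by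
  have hz0 : z ≠ 0 := by rintro rfl; simp at hz
  have h1 : DifferentiableAt ℂ (rlg T S k) (-1/z) :=
    (rlG_an (rlTS_sa hT S) le_rfl (rlE k) (Or.inl (rl_neg_inv_ne hz))).differentiableAt
  have h2 : DifferentiableAt ℂ (fun z : ℂ => -1/z) z :=
    (differentiableAt_const _).div differentiableAt_id hz0
  exact DifferentiableAt.comp z h1 h2

lemma rl_real_mul_im (x : ℝ) (w : ℂ) : ((x:ℂ)^2 * w).im = x^2 * w.im := by
  rw [← Complex.ofReal_pow, Complex.im_ofReal_mul]

/-- continuation property at site `n` -/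
def rlGood (a b : ℤ → ℝ) (T : rlH →L[ℂ] rlH) (n : ℤ) : Prop :=
  ∃ M : ℂ → ℂ, DifferentiableOn ℂ M Omega22 ∧ (∀ z ∈ Omega22, 0 < (M z).im) ∧
    (∀ z, 0 < z.im → M z = rlp T n (-1/z)) ∧
    (∀ z, z.im < 0 → (a n : ℂ)^2 * M z = -(z - b n + (a (n-1) : ℂ)^2 * rlm T n (-1/z)))

section good
variable {a b : ℤ → ℝ} {T : rlH →L[ℂ] rlH}

lemma rlGood_zero (hT : ∀ u : rlH, ∀ n : ℤ,
    T u n = (a n : ℂ) * u (n + 1) + (a (n - 1) : ℂ) * u (n - 1) + (b n : ℂ) * u n)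
    (ha : ∀ n, 0 < a n) {mp mm : ℂ → ℂ}
    (hp : ∀ z, 0 < z.im → mp z = rlp T 0 (-1/z))
    (hm : ∀ z : ℂ, 0 < z.im →
      mm z = (z - b 0 + (a (0-1) : ℂ)^2 * rlm T 0 (-1/z)) / (a 0 : ℂ)^2)
    (hrefl : ∀ᵐ x : ℝ, x ∈ Set.Ioo (-2:ℝ) 2 →
    Tendsto (fun y : ℝ => mp (↑x + ↑y * I) + starRingEnd ℂ (mm (↑x + ↑y * I)))
      (nhdsWithin 0 (Set.Ioi 0)) (nhds 0)) : rlGood a b T 0 := by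
  have hs := rlT_sa hT
  have ha0 : (a 0 : ℂ) ≠ 0 := by exact_mod_cast (ha 0).ne'
  have hnh : ∀ z : ℂ, 0 < z.im → ∀ᶠ w in nhds z, 0 < w.im := fun z hz =>
    (isOpen_lt continuous_const Complex.continuous_im).mem_nhds hz
  obtain ⟨M, h1, h2, h3, h4⟩ := rl_contin (mp := mp) (mm := mm)
    (fun z hz => by
      refine (rlg_dz hs (Ici (0+1)) (0+1) hz.ne').congr_of_eventuallyEq ?_
      filter_upwards [hnh z hz] with w hw
      exact hp w hw)
    (fun z hz => by
      have h : DifferentiableAt ℂ (fun z : ℂ => (z - b 0 + (a (0-1) : ℂ)^2 *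
          rlg T (Iic (0-1)) (0-1) (-1/z)) / (a 0 : ℂ)^2) z :=
        ((differentiableAt_id.sub_const _).add
          ((rlg_dz hs (Iic (0-1)) (0-1) hz.ne').const_mul _)).div_const _
      refine h.congr_of_eventuallyEq ?_
      filter_upwards [hnh z hz] with w hw
      exact hm w hw)
    (fun z hz => by rw [hp z hz]; exact rlg_pos hs (by simp) hz)
    (fun z hz => by
      have h5 := rlg_pos hs (S := Iic (0-1)) (k := 0-1) (by simp) hz
      rw [hm z hz, ← Complex.ofReal_pow (a 0), Complex.div_ofReal_im]
      have := ha 0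
      apply div_pos _ (by positivity)
      rw [Complex.add_im, Complex.sub_im, Complex.ofReal_im, rl_real_mul_im]
      have : 0 ≤ (a (0-1))^2 * (rlm T 0 (-1/z)).im := mul_nonneg (sq_nonneg _) h5.le
      linarith) hrefl
  refine ⟨M, h1, h2, fun z hz => (h3 z hz).trans (hp z hz), fun z hz => ?_⟩
  rw [h4 z hz, hm _ (by simpa using hz)]
  have e : -1 / (starRingEnd ℂ z) = starRingEnd ℂ (-1/z) := by simp
  rw [e]
  unfold rlm
  rw [rlg_conj hs]
  simp only [map_div₀, map_add, map_sub, map_mul, map_pow, Complex.conj_ofReal, Complex.conj_conj]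
  field_simp

variable (hT : ∀ u : rlH, ∀ n : ℤ,
    T u n = (a n : ℂ) * u (n + 1) + (a (n - 1) : ℂ) * u (n - 1) + (b n : ℂ) * u n)
    (ha : ∀ n, 0 < a n)
include hT ha

lemma rlGood_succ {n : ℤ} (h : rlGood a b T n) : rlGood a b T (n+1) := by
  obtain ⟨M, h1, h2, h3, h4⟩ := h
  have hs := rlT_sa hT
  have haC : ∀ n, (a n : ℂ) ≠ 0 := fun n => by exact_mod_cast (ha n).ne'
  have hM0 : ∀ z ∈ Omega22, M z ≠ 0 := fun z hz h0 => by
    have := h2 z hz; rw [h0] at this; simp at this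
  have k3 : ∀ z : ℂ, 0 < z.im →
      -(z - b (n+1) + 1 / M z) / (a (n+1) : ℂ)^2 = rlp T (n+1) (-1/z) := by
    intro z hz
    have e := rl_schur_p hT n hz.ne'
    rw [← h3 z hz] at e
    have hm := hM0 z (Or.inl hz.ne')
    rw [div_eq_iff (pow_ne_zero 2 (haC _)), eq_comm, ← sub_eq_zero]
    have e' : 1 / M z = -(a (n+1):ℂ)^2 * rlp T (n+1) (-1/z) + b (n+1) - z := by
      rw [div_eq_iff hm, mul_comm, e]
    rw [e']; ring
  have k4 : ∀ z : ℂ, z.im < 0 → (a (n+1) : ℂ)^2 * (-(z - b (n+1) + 1 / M z) / (a (n+1) : ℂ)^2) =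
      -(z - b (n+1) + (a (n+1-1) : ℂ)^2 * rlm T (n+1) (-1/z)) := by
    intro z hz
    have e := rl_schur_m hT n hz.ne
    have hm := hM0 z (Or.inl hz.ne)
    have e2 : rlm T (n+1) (-1/z) * ((a n : ℂ)^2 * M z) = 1 := by
      rw [h4 z hz]; linear_combination e
    have e' : 1 / M z = (a n:ℂ)^2 * rlm T (n+1) (-1/z) := by
      rw [div_eq_iff hm]; linear_combination -e2
    have e3 : n + 1 - 1 = n := by ring
    rw [mul_div_cancel₀ _ (pow_ne_zero 2 (haC _)), e', e3]
  refine ⟨fun z => -(z - b (n+1) + 1 / M z) / (a (n+1) : ℂ)^2, ?_, ?_, k3, k4⟩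
  · apply DifferentiableOn.div_const
    apply DifferentiableOn.neg
    apply DifferentiableOn.add
    · exact differentiableOn_id.sub_const _
    · exact (differentiableOn_const _).div h1 hM0
  · intro z hz
    change 0 < (-(z - b (n+1) + 1 / M z) / (a (n+1) : ℂ)^2).im
    have han := ha (n+1)
    rcases lt_trichotomy z.im 0 with h | h | h
    · have e := congrArg Complex.im (k4 z h)
      rw [rl_real_mul_im, Complex.neg_im, Complex.add_im, Complex.sub_im, Complex.ofReal_im,
        rl_real_mul_im] at e
      have hg := rlg_neg hs (S := Iic (n+1-1)) (k := n+1-1) (by simp) h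
      have : (a (n+1-1))^2 * (rlm T (n+1) (-1/z)).im ≤ 0 :=
        mul_nonpos_of_nonneg_of_nonpos (sq_nonneg _) hg.le
      have h5 : 0 < (a (n+1))^2 := by positivity
      by_contra hc
      have := mul_nonpos_of_nonneg_of_nonpos h5.le (not_lt.1 hc)
      linarith
    · rw [← Complex.ofReal_pow, Complex.div_ofReal_im]
      apply div_pos _ (by positivity)
      have h6 := rl_neg_inv_im (z := M z)
      rw [Complex.neg_im, Complex.add_im, Complex.sub_im, Complex.ofReal_im, h]
      have h7 : (1 / M z).im = -(-1 / M z).im := by rw [neg_div, Complex.neg_im, neg_neg]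
      rw [h7, h6]
      have : 0 < (M z).im / Complex.normSq (M z) :=
        div_pos (h2 z hz) (Complex.normSq_pos.2 (hM0 z hz))
      linarith
    · rw [k3 z h]; exact rlg_pos hs (by simp) h

lemma rlGood_pred {n : ℤ} (h : rlGood a b T n) : rlGood a b T (n-1) := by
  obtain ⟨M, h1, h2, h3, h4⟩ := h
  have hs := rlT_sa hT
  have haC : ∀ n, (a n : ℂ) ≠ 0 := fun n => by exact_mod_cast (ha n).ne'
  have hW : ∀ z ∈ Omega22, 0 < ((a n : ℂ)^2 * M z + z - b n).im := by
    intro z hz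
    have han := ha n
    rcases le_or_gt 0 z.im with h | h
    · rw [Complex.sub_im, Complex.add_im, rl_real_mul_im, Complex.ofReal_im]
      have := mul_pos (pow_pos han 2) (h2 z hz)
      linarith
    · rw [h4 z h]
      have e : -(z - b n + (a (n-1) : ℂ)^2 * rlm T n (-1/z)) + z - b n =
        -((a (n-1) : ℂ)^2 * rlm T n (-1/z)) := by ring
      rw [e, Complex.neg_im, rl_real_mul_im]
      have hg := rlg_neg hs (S := Iic (n-1)) (k := n-1) (by simp) h
      have := mul_neg_of_pos_of_neg (pow_pos (ha (n-1)) 2) hg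
      unfold rlm; linarith
  have hW0 : ∀ z ∈ Omega22, (a n : ℂ)^2 * M z + z - b n ≠ 0 := fun z hz h0 => by
    have := hW z hz; rw [h0] at this; simp at this
  refine ⟨fun z => -1 / ((a n : ℂ)^2 * M z + z - b n), ?_, ?_, ?_, ?_⟩
  · apply (differentiableOn_const _).div _ hW0
    exact ((h1.const_mul _).add differentiableOn_id).sub_const _
  · intro z hz
    change 0 < (-1 / ((a n : ℂ)^2 * M z + z - b n)).im
    rw [rl_neg_inv_im]
    exact div_pos (hW z hz) (Complex.normSq_pos.2 (hW0 z hz))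
  · intro z hz
    have e := rl_schur_p hT (n-1) hz.ne'
    have e3 : n - 1 + 1 = n := by ring
    rw [e3, ← h3 z hz] at e
    change -1 / ((a n : ℂ)^2 * M z + z - b n) = _
    rw [div_eq_iff (hW0 z (Or.inl hz.ne'))]
    linear_combination e
  · intro z hz
    have e := rl_schur_m hT (n-1) hz.ne
    have e3 : n - 1 + 1 = n := by ring
    rw [e3] at e
    change (a (n-1) : ℂ)^2 * (-1 / ((a n : ℂ)^2 * M z + z - b n)) = _
    have e4 : (a n : ℂ)^2 * M z + z - b n = -((a (n-1) : ℂ)^2 * rlm T n (-1/z)) := by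
      rw [h4 z hz]; ring
    have h0 := hW0 z (Or.inl hz.ne)
    rw [← mul_div_assoc, div_eq_iff h0, e4]
    linear_combination ((a (n-1) : ℂ)^2) * e

lemma rlGood_all (h : rlGood a b T 0) (n : ℤ) : rlGood a b T n := by
  induction n using Int.induction_on with
  | zero => exact h
  | succ i hi => exact rlGood_succ hT ha hi
  | pred i hi => exact rlGood_pred hT ha hi

end good

lemma rl_z_im {l : ℂ} : (-l - 1/l).im = l.im / Complex.normSq l - l.im := by
  rw [Complex.sub_im, one_div, Complex.inv_im, Complex.neg_im]; ring

lemma rl_z_neg_inv {l : ℂ} (hl : l ≠ 0) : -1 / (-l - 1/l) = l / (1 + l^2) := by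
  have e : -l - 1/l = -((1 + l^2) / l) := by field_simp; ring
  rw [e, div_neg, neg_div, neg_neg, one_div, inv_div]

lemma rl_z_mem {l : ℂ} (hl : 0 < l.im) : -l - 1/l ∈ Omega22 := by
  by_cases h : (-l - 1/l).im = 0
  · right
    have hl0 : l ≠ 0 := by rintro rfl; simp at hl
    have hn := Complex.normSq_pos.2 hl0
    rw [rl_z_im, sub_eq_zero, div_eq_iff hn.ne'] at h
    have h1 : Complex.normSq l = 1 := by
      have : l.im * (Complex.normSq l - 1) = 0 := by linarith
      rcases mul_eq_zero.1 this with h | h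
      · exact absurd h hl.ne'
      · linarith
    have h2 : (-l - 1/l).re = -2 * l.re := by
      rw [Complex.sub_re, one_div, Complex.inv_re, Complex.neg_re, h1]; ring
    rw [h2]
    rw [Complex.normSq_apply] at h1
    constructor <;> nlinarith
  · exact Or.inl h

lemma rl_u_small {r R x : ℝ} (hr0 : 0 < r) (hr1 : r ≤ 1) (hrR : r + 1/r = R) (hx : |x| < r) :
    ‖(x:ℂ) / (1 + (x:ℂ)^2)‖ * R < 1 := by
  have e : (x:ℂ) / (1 + (x:ℂ)^2) = ((x / (1 + x^2) : ℝ) : ℂ) := by push_cast; ring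
  have hp : 0 < 1 + x^2 := by positivity
  rw [e, Complex.norm_real, Real.norm_eq_abs, abs_div, abs_of_pos hp, div_mul_eq_mul_div,
    div_lt_one hp, ← sq_abs x, ← hrR]
  have h1 : 1 ≤ 1/r := by rw [le_div_iff₀ hr0]; linarith
  have h2 : 0 < (r - |x|) * (1/r - |x|) := mul_pos (by linarith) (by linarith)
  have h3 : r * (1/r) = 1 := by field_simp
  nlinarith

section app
variable {r R : ℝ} (hr0 : 0 < r) (hr1 : r ≤ 1) (hrR : r + 1/r = R) {T : rlH →L[ℂ] rlH}
  (hs : IsSelfAdjoint T) (hR : ‖T‖ ≤ R)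
include hr0 hr1 hrR hs hR

lemma rl_app_an (S : Set ℤ) (k : ℤ) (x : ℝ) (hx : |x| < r) :
    AnalyticAt ℂ (fun l : ℂ => rlg T S k (l / (1 + l^2))) x := by
  have h1 : AnalyticAt ℂ (rlg T S k) ((x:ℂ) / (1 + (x:ℂ)^2)) :=
    rlG_an (rlTS_sa hs S) (rlTS_norm hR S) _ (Or.inr (rl_u_small hr0 hr1 hrR hx))
  have h0 : (1 + (x:ℂ)^2) ≠ 0 := by
    have : (1 + x^2 : ℝ) ≠ 0 := by positivity
    exact_mod_cast this
  have h2 : AnalyticAt ℂ (fun l : ℂ => l / (1 + l^2)) x :=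
    analyticAt_id.div (analyticAt_const.add (analyticAt_id.pow 2)) h0
  exact AnalyticAt.comp' h1 h2

omit hr0 hr1 hrR hR in
lemma rl_app_real (S : Set ℤ) (k : ℤ) (x : ℝ) :
    (rlg T S k ((x:ℂ) / (1 + (x:ℂ)^2))).im = 0 := by
  have e : starRingEnd ℂ ((x:ℂ) / (1 + (x:ℂ)^2)) = (x:ℂ) / (1 + (x:ℂ)^2) := by
    simp
  have := rlg_conj hs S k ((x:ℂ) / (1 + (x:ℂ)^2))
  rw [e] at this
  exact Complex.conj_eq_iff_im.1 this.symm

omit hr0 hr1 hrR hs hR in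
lemma rl_app_deriv (S : Set ℤ) (k : ℤ) :
    HasDerivAt (fun l : ℂ => rlg T S k (l / (1 + l^2))) 1 0 := by
  have h2 : HasDerivAt (fun l : ℂ => l / (1 + l^2)) 1 0 := by
    have h3 : HasDerivAt (fun l : ℂ => 1 + l^2) 0 0 := by
      have := (hasDerivAt_pow 2 (0:ℂ)).const_add 1
      simpa using this
    have h4 := (hasDerivAt_id (0:ℂ)).div h3 (by simp)
    have e : (1 * (1 + (0:ℂ)^2) - id (0:ℂ) * 0) / (1 + (0:ℂ)^2)^2 = 1 := by simp
    rw [e] at h4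
    exact h4
  have h1 : HasDerivAt (rlg T S k) 1 ((0:ℂ) / (1 + (0:ℂ)^2)) := by
    rw [zero_div]; exact rlG_deriv (rlE_norm k)
  have h5 := HasDerivAt.comp (0:ℂ) h1 h2
  rw [mul_one] at h5
  exact h5

lemma rl_step {a b : ℤ → ℝ} (hT : ∀ u : rlH, ∀ n : ℤ,
    T u n = (a n : ℂ) * u (n + 1) + (a (n - 1) : ℂ) * u (n - 1) + (b n : ℂ) * u n)
    (ha : ∀ n, 0 < a n) {n : ℤ} (hG : rlGood a b T n) :
    (a n = 1 ∧ a (n-1) = 1 ∧ b n = 0) ∨ (1 < a n ∧ 1 < a (n-1) ∧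
      r^2 < (a (n-1)^2 - 1) / (a n^2 - 1) ∧ (a (n-1)^2 - 1) / (a n^2 - 1) < 1/r^2) := by
  obtain ⟨M, h1, h2, h3, h4⟩ := hG
  apply rl_core (F := fun l => M (-l - 1/l)) (φ := fun l => rlp T n (l / (1 + l^2)))
    (ψ := fun l => rlm T n (l / (1 + l^2))) hr0 hr1 (ha n) (ha (n-1))
  · intro l hl
    have hl0 : l ≠ 0 := by rintro rfl; simp at hl
    have d1 : DifferentiableAt ℂ M (-l - 1/l) :=
      h1.differentiableAt (rl_Omega_open.mem_nhds (rl_z_mem hl))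
    have d2 : DifferentiableAt ℂ (fun l : ℂ => -l - 1/l) l :=
      differentiableAt_id.neg.sub ((differentiableAt_const _).div differentiableAt_id hl0)
    exact (DifferentiableAt.comp l d1 d2).differentiableWithinAt
  · intro l hl; exact h2 _ (rl_z_mem hl)
  · exact rl_app_an hr0 hr1 hrR hs hR _ _
  · intro x _; exact rl_app_real hs _ _ x
  · simp [rlp, rlg, rlG_zero]
  · exact rl_app_deriv _ _
  · exact rl_app_an hr0 hr1 hrR hs hR _ _
  · intro x _; exact rl_app_real hs _ _ x
  · simp [rlm, rlg, rlG_zero]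
  · exact rl_app_deriv _ _
  · intro l hl hn
    have hl0 : l ≠ 0 := by rintro rfl; simp at hl
    have hp := Complex.normSq_pos.2 hl0
    have hn1 : Complex.normSq l < 1 := by
      rw [Complex.normSq_eq_norm_sq]; nlinarith [norm_nonneg l]
    change M (-l - 1/l) = rlp T n (l / (1 + l^2))
    rw [h3, rl_z_neg_inv hl0]
    rw [rl_z_im, sub_pos, lt_div_iff₀ hp]
    nlinarith
  · intro l hl hn
    have hl0 : l ≠ 0 := by rintro rfl; simp at hl
    have hp := Complex.normSq_pos.2 hl0
    have hn1 : 1 < Complex.normSq l := by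
      rw [Complex.normSq_eq_norm_sq]; nlinarith [norm_nonneg l]
    change (a n : ℂ)^2 * M (-l - 1/l) =
      l + 1/l + b n - (a (n-1):ℂ)^2 * rlm T n ((1/l) / (1 + (1/l)^2))
    rw [h4, rl_z_neg_inv hl0]
    · have e : (1/l) / (1 + (1/l)^2) = l / (1 + l^2) := by
        have e1 : 1 + (1/l)^2 = (1 + l^2) / l^2 := by field_simp; ring
        rw [e1, div_div_eq_mul_div]; congr 1; field_simp
      rw [e]; ring
    · rw [rl_z_im, sub_neg, div_lt_iff₀ hp]
      nlinarith
  · intro x hx0 hx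
    have hxC : (x:ℂ) ≠ 0 := by exact_mod_cast hx0
    have eE : ((-x - 1/x : ℝ) : ℂ) = -(x:ℂ) - 1/(x:ℂ) := by push_cast; ring
    have eu : -1 / ((-x - 1/x : ℝ) : ℂ) = (x:ℂ) / (1 + (x:ℂ)^2) := by
      rw [eE, rl_z_neg_inv hxC]
    have exE : x * (-x - 1/x) = -(1 + x^2) := by field_simp; ring
    have hE0 : -x - 1/x ≠ 0 := by
      intro h; rw [h] at exE; nlinarith [sq_nonneg x]
    have hu := rl_u_small hr0 hr1 hrR hx
    have hER : R < |(-x - 1/x)| := by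
      have e1 : ‖(x:ℂ) / (1 + (x:ℂ)^2)‖ = 1 / |(-x - 1/x)| := by
        rw [← eu, norm_div, norm_neg, norm_one, Complex.norm_real, Real.norm_eq_abs]
      rw [e1, div_mul_eq_mul_div, one_mul, div_lt_one (abs_pos.2 hE0)] at hu
      exact hu
    have hS := rl_sign hT hR n hE0 (by rw [eu]; exact hu) hER
    rw [eu] at hS
    change x * ((a n)^2 * (rlp T n ((x:ℂ) / (1 + (x:ℂ)^2))).re - x - 1/x - b n +
      (a (n-1))^2 * (rlm T n ((x:ℂ) / (1 + (x:ℂ)^2))).re) ≤ 0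
    set Q := (a n)^2 * (rlp T n ((x:ℂ) / (1 + (x:ℂ)^2))).re - x - 1/x - b n +
      (a (n-1))^2 * (rlm T n ((x:ℂ) / (1 + (x:ℂ)^2))).re with hQ
    have hS2 : 0 ≤ (-x - 1/x) * Q := by
      convert hS using 2; rw [hQ]; ring
    have h5 : x^2 * ((-x - 1/x) * Q) = -(1 + x^2) * (x * Q) := by
      rw [← exE]; ring
    have h6 : 0 ≤ x^2 * ((-x - 1/x) * Q) := mul_nonneg (sq_nonneg _) hS2
    by_contra hc
    have := mul_pos (by positivity : 0 < 1 + x^2) (not_le.1 hc)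
    linarith
end app

/-- Proposition 3.3: if `J ∈ M_R` (with `R ≥ 2`, `r ∈ (0,1]`, `r + 1/r = R`) is not the
free Jacobi matrix, then `a_n > 1` for all `n ∈ ℤ` and
`r² < (a_{n+1}² - 1)/(a_n² - 1) < 1/r²` for all `n ∈ ℤ`. -/
theorem statement8 (R r : ℝ) (hR : 2 ≤ R) (hr0 : 0 < r) (hr1 : r ≤ 1)
    (hrR : r + 1/r = R) (a b : ℤ → ℝ) (hJ : MemMR R a b)
    (hnotfree : ¬ (∀ n : ℤ, a n = 1 ∧ b n = 0)) :
    ∀ n : ℤ, 1 < a n ∧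
      r^2 < (a (n+1)^2 - 1) / (a n^2 - 1) ∧
      (a (n+1)^2 - 1) / (a n^2 - 1) < 1/r^2 := by
  obtain ⟨ha, ⟨T, hT, hTR⟩, mp, mm, hp, hm, hrefl⟩ := hJ
  have hT : ∀ u : rlH, ∀ n : ℤ,
    T u n = (a n : ℂ) * u (n + 1) + (a (n - 1) : ℂ) * u (n - 1) + (b n : ℂ) * u n := hT
  have hG0 : rlGood a b T 0 := by
    apply rlGood_zero hT ha (mp := mp) (mm := mm) _ _ hrefl
    · intro z hz
      obtain ⟨f, hf1, hf2, hf3, hf4⟩ := hp z hz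
      rw [hf4]; exact rl_mp hT ha hz.ne' hf1 hf2 hf3
    · intro z hz
      obtain ⟨f, hf1, hf2, hf3, hf4⟩ := hm z hz
      rw [hf4]; exact rl_mm hT ha hz.ne' hf1 hf2 hf3
  have hP := fun n => rl_step hr0 hr1 hrR (rlT_sa hT) hTR hT ha (rlGood_all hT ha hG0 n)
  have hne : ∀ n, a n ≠ 1 := by
    intro n hn
    apply hnotfree
    have hup : ∀ m, a m = 1 → a (m+1) = 1 := by
      intro m h
      have := hP (m+1)
      have e : m + 1 - 1 = m := by ring
      rw [e] at this
      rcases this with h1 | h1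
      · exact h1.1
      · linarith [h1.2.1]
    have hdown : ∀ m, a m = 1 → a (m-1) = 1 := by
      intro m h
      rcases hP m with h1 | h1
      · exact h1.2.1
      · linarith [h1.1]
    have hall : ∀ m, a (n + m) = 1 := by
      intro m
      induction m using Int.induction_on with
      | zero => simpa using hn
      | succ i hi => have := hup _ hi; rwa [add_assoc] at this
      | pred i hi => have := hdown _ hi; rwa [add_sub_assoc] at this
    intro m
    have h1 : a m = 1 := by have := hall (m - n); simpa using this
    refine ⟨h1, ?_⟩
    rcases hP m with h2 | h2
    · exact h2.2.2
    · linarith [h2.1]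
  intro n
  have hn := hP (n+1)
  have e : n + 1 - 1 = n := by ring
  rw [e] at hn
  rcases hn with h | ⟨h1, h2, h3, h4⟩
  · exact absurd h.1 (hne _)
  · refine ⟨h2, ?_, ?_⟩
    · have p1 : 0 < a (n+1)^2 - 1 := by nlinarith
      have p2 : 0 < a n^2 - 1 := by nlinarith
      rw [div_lt_div_iff₀ p1 (by positivity)] at h4
      rw [lt_div_iff₀ p2]; linarith
    · have p1 : 0 < a (n+1)^2 - 1 := by nlinarith
      have p2 : 0 < a n^2 - 1 := by nlinarith
      rw [lt_div_iff₀ p1] at h3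
      rw [div_lt_div_iff₀ p2 (by positivity)]; linarith
end
end

section
/- Let g be a Herglotz function and let a > 0. Then there exists a finite Borel measure ρ on ℝ with ρ(ℝ) = a such that g(z) = ∫ dρ(t)/(t − z) for all z ∈ ℂ⁺, if and only if lim_{y→∞} y·g(iy) = ia. -/
open MeasureTheory Complex Filter Set

noncomputable section

noncomputable instance circMS : MeasurableSpace Circle := borel Circle

instance circBS : BorelSpace Circle := ⟨rfl⟩

lemma pk_cont (w : ℂ) (hw : w ∈ Metric.ball (0:ℂ) 1) :
    Continuous (fun ζ : Circle => poissonKernel 0 w (ζ:ℂ)) := by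
  unfold poissonKernel
  have : ∀ ζ : Circle, ‖(ζ:ℂ) - 0 - (w - 0)‖ ^ 2 ≠ 0 := by
    intro ζ h
    simp only [sub_zero, ne_eq, OfNat.ofNat_ne_zero, not_false_eq_true, pow_eq_zero_iff,
      norm_eq_zero] at h
    rw [sub_eq_zero] at h
    rw [← h] at hw
    rw [mem_ball_zero_iff, Circle.norm_coe] at hw
    exact lt_irrefl _ hw
  apply Continuous.div (by fun_prop) (by fun_prop) this

lemma circle_one (f : ℂ → ℂ) (hf : DiffContOnCl ℂ f (Metric.ball 0 1))
    (hpos : ∀ w ∈ Metric.closedBall (0:ℂ) 1, 0 ≤ (f w).im) :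
    ∃ μ : FiniteMeasure Circle, ∀ w ∈ Metric.ball (0:ℂ) 1,
      (f w).im = ∫ ζ : Circle, poissonKernel 0 w (ζ:ℂ) ∂(μ : Measure Circle) := by
  have hcont : ContinuousOn f (Metric.closedBall 0 1) := by
    have := hf.continuousOn
    rwa [closure_ball _ (by norm_num)] at this
  have hcm : ∀ θ : ℝ, circleMap 0 1 θ ∈ Metric.closedBall (0:ℂ) 1 := by
    intro θ; simp [circleMap]
  have hce : ∀ θ : ℝ, circleMap 0 1 θ = (Circle.exp θ : ℂ) := by
    intro θ; simp [circleMap]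
  have hfc : Continuous (fun θ : ℝ => f (circleMap 0 1 θ)) :=
    hcont.comp_continuous (continuous_circleMap 0 1) hcm
  set φ : ℝ → ℝ := fun θ => (2 * Real.pi)⁻¹ * (f (circleMap 0 1 θ)).im with hφ
  have hφc : Continuous φ := by
    have := Complex.continuous_im.comp hfc
    exact continuous_const.mul this
  have hφ0 : ∀ θ, 0 ≤ φ θ := fun θ => mul_nonneg (by positivity) (hpos _ (hcm θ))
  set ν : Measure ℝ := (volume.restrict (Ioc 0 (2 * Real.pi))).withDensity
    (fun θ => ENNReal.ofReal (φ θ)) with hν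
  have hint : Integrable φ (volume.restrict (Ioc 0 (2 * Real.pi))) :=
    (hφc.integrableOn_Icc (a := 0) (b := 2 * Real.pi)).mono_set Ioc_subset_Icc_self
  have : IsFiniteMeasure ν := isFiniteMeasure_withDensity_ofReal hint.2
  refine ⟨⟨ν.map Circle.exp, inferInstance⟩, ?_⟩
  intro w hw
  have hP := hf.circleAverage_poissonKernel_smul hw
  have hPc := pk_cont w hw
  simp only [FiniteMeasure.toMeasure_mk]
  rw [integral_map (by fun_prop) hPc.aestronglyMeasurable, hν,
    integral_withDensity_eq_integral_toReal_smul (by fun_prop) (by simp)]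
  rw [← hP, Real.circleAverage_def, intervalIntegral.integral_of_le (by positivity)]
  rw [Complex.smul_im, ← Complex.imCLM_apply, ← ContinuousLinearMap.integral_comp_comm]
  · rw [smul_eq_mul, ← integral_const_mul]
    congr 1
    ext θ
    rw [ENNReal.toReal_ofReal (hφ0 θ)]
    simp [hφ, hce]
    ring
  · have : Continuous (fun θ : ℝ => (poissonKernel 0 w • f) (circleMap 0 1 θ)) := by
      have h2 := hPc.comp (Circle.exp.continuous)
      simp only [Function.comp_def] at h2
      simp only [Pi.smul_apply']
      simp only [hce] at hfc ⊢
      exact h2.smul hfc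
    exact (this.integrableOn_Icc (a := 0) (b := 2 * Real.pi)).mono_set Ioc_subset_Icc_self

lemma circle_rep (u : ℂ → ℂ) (hd : DifferentiableOn ℂ u (Metric.ball 0 1))
    (hpos : ∀ w ∈ Metric.ball (0:ℂ) 1, 0 < (u w).im) :
    ∃ μ : FiniteMeasure Circle, ∀ w ∈ Metric.ball (0:ℂ) 1,
      (u w).im = ∫ ζ : Circle, poissonKernel 0 w (ζ:ℂ) ∂(μ : Measure Circle) := by
  have hr : ∀ n : ℕ, 0 < (1 - 1 / ((n:ℝ) + 2)) ∧ (1 - 1 / ((n:ℝ) + 2)) < 1 := by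
    intro n
    have : (0:ℝ) < 1 / ((n:ℝ) + 2) := by positivity
    have h2 : 1 / ((n:ℝ) + 2) < 1 := by
      rw [div_lt_one (by positivity)]
      have : (0:ℝ) ≤ n := by positivity
      linarith
    constructor <;> linarith
  set r : ℕ → ℝ := fun n => 1 - 1 / ((n:ℝ) + 2) with hrdef
  have hrlim : Tendsto r atTop (nhds 1) := by
    have h0 : Tendsto (fun n : ℕ => 1 / ((n:ℝ) + 2)) atTop (nhds 0) := by
      have := tendsto_const_div_atTop_nhds_zero_nat (1:ℝ)
      have h := (this.comp (tendsto_add_atTop_nat 2))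
      refine h.congr ?_
      intro n; simp
    have h := h0.const_sub 1
    rw [sub_zero] at h
    exact h
  have hmaps : ∀ n, ∀ w ∈ Metric.closedBall (0:ℂ) 1, (r n : ℂ) * w ∈ Metric.ball (0:ℂ) 1 := by
    intro n w hw
    simp only [mem_closedBall_zero_iff, mem_ball_zero_iff, norm_mul, norm_real, Real.norm_eq_abs] at *
    rw [abs_of_pos (hr n).1]
    nlinarith [(hr n).1, (hr n).2, norm_nonneg w]
  have hex : ∀ n, ∃ μ : FiniteMeasure Circle, ∀ w ∈ Metric.ball (0:ℂ) 1,
      (u (r n * w)).im = ∫ ζ : Circle, poissonKernel 0 w (ζ:ℂ) ∂(μ : Measure Circle) := by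
    intro n
    apply circle_one (fun w => u (r n * w))
    · apply DifferentiableOn.diffContOnCl
      rw [closure_ball _ (by norm_num)]
      exact hd.comp (by fun_prop) (hmaps n)
    · intro w hw
      exact (hpos _ (hmaps n w hw)).le
  choose μ hμ using hex
  have hmass : ∀ n, (μ n).mass = (NNReal.mk (u 0).im (hpos 0 (by simp)).le) := by
    intro n
    have := hμ n 0 (by simp)
    apply NNReal.coe_injective
    simp only [mul_zero, poissonKernel, sub_zero, Circle.norm_coe, norm_zero] at this
    simp at this
    exact this.symm
  have hcomp := isCompact_setOfPred_finiteMeasure_eq_of_compactSpace Circle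
    (NNReal.mk (u 0).im (hpos 0 (by simp)).le)
  obtain ⟨m, -, hm⟩ := hcomp.ultrafilter_le_nhds (Ultrafilter.map μ (Filter.hyperfilter ℕ)) (by
    rw [le_principal_iff]
    exact Filter.mem_map.2 (Filter.univ_mem' hmass))
  refine ⟨m, fun w hw => ?_⟩
  have hm' : Tendsto μ (Filter.hyperfilter ℕ : Filter ℕ) (nhds m) := hm
  rw [FiniteMeasure.tendsto_iff_forall_integral_tendsto] at hm'
  have h1 := hm' (BoundedContinuousFunction.mkOfCompact ⟨_, pk_cont w hw⟩)
  simp only [BoundedContinuousFunction.mkOfCompact_apply, ContinuousMap.coe_mk] at h1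
  have h2 : Tendsto (fun n => (u (r n * w)).im) (Filter.hyperfilter ℕ : Filter ℕ) (nhds (u w).im) := by
    have : Tendsto (fun n => (u (r n * w)).im) atTop (nhds (u w).im) := by
      have hc : ContinuousAt u w := (hd.differentiableAt (Metric.isOpen_ball.mem_nhds hw)).continuousAt
      have h3 : Tendsto (fun n => (r n : ℂ) * w) atTop (nhds w) := by
        have := ((Complex.continuous_ofReal.tendsto 1).comp hrlim).mul_const w
        simpa using this
      exact (Complex.continuous_im.tendsto _).comp (hc.tendsto.comp h3)
    exact this.mono_left Nat.hyperfilter_le_atTop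
  refine tendsto_nhds_unique h2 (h1.congr fun n => (hμ n w hw).symm)

lemma hp_add_I_ne {z : ℂ} (hz : 0 ≤ z.im) : z + I ≠ 0 := by
  intro h
  have := congrArg Complex.im h
  simp at this
  linarith

lemma cayley_mem {z : ℂ} (hz : 0 < z.im) : (z - I) / (z + I) ∈ Metric.ball (0:ℂ) 1 := by
  have h := hp_add_I_ne hz.le
  rw [mem_ball_zero_iff, norm_div, div_lt_one (norm_pos_iff.2 h)]
  rw [← sq_lt_sq₀ (norm_nonneg _) (norm_nonneg _), ← normSq_eq_norm_sq, ← normSq_eq_norm_sq]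
  simp [normSq_apply]
  nlinarith

lemma one_sub_ne {w : ℂ} (hw : w ∈ Metric.ball (0:ℂ) 1) : 1 - w ≠ 0 := by
  intro h
  rw [sub_eq_zero] at h
  rw [← h] at hw
  simp at hw

lemma cayley_inv_im {w : ℂ} (hw : w ∈ Metric.ball (0:ℂ) 1) : 0 < (I * (1 + w) / (1 - w)).im := by
  have h := one_sub_ne hw
  have h1 : 0 < normSq (1 - w) := normSq_pos.2 h
  have h2 : normSq w < 1 := by
    rw [mem_ball_zero_iff] at hw
    rw [normSq_eq_norm_sq]
    nlinarith [norm_nonneg w]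
  rw [div_im, ← sub_div]
  apply div_pos _ h1
  simp [normSq_apply] at *
  nlinarith

lemma cayley_inv {z : ℂ} (hz : 0 < z.im) :
    I * (1 + (z - I) / (z + I)) / (1 - (z - I) / (z + I)) = z := by
  have h := hp_add_I_ne hz.le
  have h1 := one_sub_ne (cayley_mem hz)
  rw [div_eq_iff h1]
  field_simp
  ring_nf

noncomputable def cT (ζ : Circle) : ℝ := (I * (1 + (ζ:ℂ)) / (1 - ζ)).re

lemma cT_spec {ζ : Circle} (h : (ζ:ℂ) ≠ 1) : (ζ:ℂ) = ((cT ζ : ℂ) - I) / ((cT ζ : ℂ) + I) := by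
  have h1 : (1:ℂ) - ζ ≠ 0 := fun h' => h (sub_eq_zero.1 h').symm
  have h0 : (ζ:ℂ) ≠ 0 := Circle.coe_ne_zero ζ
  have h3 : (ζ:ℂ) - 1 ≠ 0 := sub_ne_zero.2 h
  have hre : (cT ζ : ℂ) = I * (1 + (ζ:ℂ)) / (1 - ζ) := by
    unfold cT
    rw [← Complex.conj_eq_iff_re]
    have hc : (starRingEnd ℂ) (ζ:ℂ) = (ζ:ℂ)⁻¹ := by
      rw [← Circle.coe_inv, Circle.coe_inv_eq_conj]
    simp only [map_div₀, map_mul, map_add, map_sub, map_one, conj_I, hc]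
    have h2 : (1:ℂ) - (ζ:ℂ)⁻¹ ≠ 0 := by
      rw [sub_ne_zero]; intro h'; exact h (by rw [eq_comm, inv_eq_one] at h'; exact h')
    field_simp
    ring
  rw [eq_div_iff (hp_add_I_ne (by simp)), hre]
  field_simp
  ring

lemma pk_eq {ζ : Circle} (h : (ζ:ℂ) ≠ 1) {z : ℂ} (hz : 0 < z.im) :
    poissonKernel 0 ((z - I) / (z + I)) (ζ:ℂ) =
      (1 + cT ζ ^ 2) * (((cT ζ : ℂ) - z)⁻¹).im := by
  have e1 : ‖(ζ:ℂ)‖ = 1 := Circle.norm_coe ζ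
  have hzi := hp_add_I_ne hz.le
  have hti : (cT ζ : ℂ) + I ≠ 0 := hp_add_I_ne (by simp)
  have htz : (cT ζ : ℂ) - z ≠ 0 := by
    intro h'
    have := congrArg Complex.im h'
    simp at this
    linarith
  have e2 : (ζ:ℂ) - (z - I) / (z + I) = 2 * I * (cT ζ - z) / ((cT ζ + I) * (z + I)) := by
    conv_lhs => rw [cT_spec h]
    field_simp
    ring
  unfold poissonKernel
  simp only [sub_zero]
  rw [e2, e1]
  have n1 : normSq (z + I) ≠ 0 := (normSq_pos.2 hzi).ne'
  have n3 : normSq ((cT ζ : ℂ) - z) ≠ 0 := (normSq_pos.2 htz).ne'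
  have n2 : normSq ((cT ζ : ℂ) + I) = 1 + cT ζ ^ 2 := by simp [normSq_apply]; ring
  have n2' : (1 + cT ζ ^ 2) ≠ 0 := by positivity
  have n4 : normSq (z + I) - normSq (z - I) = 4 * z.im := by simp [normSq_apply]; ring
  rw [inv_im, ← normSq_eq_norm_sq, ← normSq_eq_norm_sq]
  simp only [map_div₀, map_mul, n2, normSq_I]
  have n5 : normSq (2:ℂ) = 4 := by simp; norm_num
  rw [n5]
  have n6 : (-((cT ζ : ℂ) - z).im) = z.im := by simp
  rw [n6]
  field_simp
  linarith

lemma pk_one {z : ℂ} (hz : 0 < z.im) :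
    poissonKernel 0 ((z - I) / (z + I)) 1 = z.im := by
  have hzi := hp_add_I_ne hz.le
  have e2 : (1:ℂ) - (z - I) / (z + I) = 2 * I / (z + I) := by
    field_simp
    ring
  unfold poissonKernel
  simp only [sub_zero]
  rw [e2]
  have n1 : normSq (z + I) ≠ 0 := (normSq_pos.2 hzi).ne'
  have n4 : normSq (z + I) - normSq (z - I) = 4 * z.im := by simp [normSq_apply]; ring
  rw [norm_one, ← normSq_eq_norm_sq, ← normSq_eq_norm_sq]
  have n5 : normSq (2:ℂ) = 4 := by simp; norm_num
  simp only [map_div₀, map_mul, normSq_I, n5]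
  field_simp
  linarith

lemma pk_nonneg {w : ℂ} (hw : w ∈ Metric.ball (0:ℂ) 1) (ζ : Circle) :
    0 ≤ poissonKernel 0 w (ζ:ℂ) := by
  unfold poissonKernel
  rw [mem_ball_zero_iff] at hw
  apply div_nonneg _ (by positivity)
  rw [sub_zero, sub_zero, Circle.norm_coe]
  nlinarith [norm_nonneg w]

lemma inv_im_nonneg (t : ℝ) {z : ℂ} (hz : 0 < z.im) : 0 ≤ (((t:ℂ) - z)⁻¹).im := by
  rw [inv_im]
  apply div_nonneg _ (normSq_nonneg _)
  simp [hz.le]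

lemma norm_inv_le (t : ℝ) {z : ℂ} (hz : 0 < z.im) : ‖((t:ℂ) - z)⁻¹‖ ≤ z.im⁻¹ := by
  rw [norm_inv]
  apply inv_anti₀ hz
  have := Complex.abs_im_le_norm ((t:ℂ) - z)
  simp at this
  exact (le_abs_self _).trans this

lemma resolv_integrable (ρ : Measure ℝ) [IsFiniteMeasure ρ] {z : ℂ} (hz : 0 < z.im) :
    Integrable (fun t : ℝ => ((t:ℂ) - z)⁻¹) ρ := by
  apply Integrable.of_bound (C := z.im⁻¹)
  · apply Measurable.aestronglyMeasurable
    fun_prop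
  · exact Eventually.of_forall fun t => norm_inv_le t hz

lemma forward (ρ : Measure ℝ) [IsFiniteMeasure ρ] (a : ℝ) (ha : 0 < a)
    (hρ : ρ Set.univ = ENNReal.ofReal a) :
    Tendsto (fun y : ℝ => (y : ℂ) * ∫ t : ℝ, ((t:ℂ) - (y:ℂ) * I)⁻¹ ∂ρ) atTop
      (nhds ((a : ℂ) * I)) := by
  have e : (a:ℂ) * I = ∫ t : ℝ, I ∂ρ := by
    simp [measureReal_def, hρ, ENNReal.toReal_ofReal ha.le]
  rw [e]
  simp_rw [← integral_const_mul]
  apply tendsto_integral_filter_of_dominated_convergence (fun _ => 1)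
  · apply Eventually.of_forall
    intro y
    apply Measurable.aestronglyMeasurable
    fun_prop
  · filter_upwards [eventually_gt_atTop 0] with y hy
    apply Eventually.of_forall
    intro t
    have := norm_inv_le t (z := (y:ℂ) * I) (by simpa using hy)
    rw [norm_mul]
    simp only [norm_real, Real.norm_eq_abs, abs_of_pos hy]
    simp only [mul_im, ofReal_re, I_im, mul_one, ofReal_im, I_re, mul_zero, add_zero] at this
    calc y * _ ≤ y * y⁻¹ := by gcongr
      _ = 1 := mul_inv_cancel₀ hy.ne'
  · exact integrable_const _
  · apply Eventually.of_forall
    intro t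
    have h0 : Tendsto (fun y : ℝ => ((t / y : ℝ) : ℂ)) atTop (nhds ((0:ℝ):ℂ)) :=
      (Complex.continuous_ofReal.tendsto 0).comp (tendsto_const_nhds.div_atTop tendsto_id)
    have h1 : Tendsto (fun y : ℝ => (((t / y : ℝ) : ℂ) - I)⁻¹) atTop (nhds ((((0:ℝ):ℂ) - I)⁻¹)) := by
      apply Tendsto.inv₀ (h0.sub_const I)
      simp
    have e2 : (((0:ℝ):ℂ) - I)⁻¹ = I := by simp
    rw [e2] at h1
    apply h1.congr'
    filter_upwards [eventually_gt_atTop 0] with y hy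
    have hy' : (y:ℂ) ≠ 0 := by exact_mod_cast hy.ne'
    have : (t:ℂ) - y * I = y * (((t / y : ℝ) : ℂ) - I) := by
      push_cast
      field_simp
    rw [this, mul_inv, ← mul_assoc, mul_inv_cancel₀ hy', one_mul]

lemma cT_measurable : Measurable cT := by
  unfold cT
  have : Measurable (fun ζ : Circle => (ζ:ℂ)) := Continuous.measurable (by fun_prop)
  fun_prop

/-- Representation of the imaginary part, under a bound that excludes the linear term. -/
lemma im_rep (g : ℂ → ℂ) (hg : IsHerglotz g) (a : ℝ)
    (h : Tendsto (fun y : ℝ => y * (g ((y : ℂ) * I)).im) atTop (nhds a)) :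
    ∃ ρ : Measure ℝ, ∀ z : ℂ, 0 < z.im →
      ENNReal.ofReal (g z).im = ∫⁻ t : ℝ, ENNReal.ofReal (((t:ℂ) - z)⁻¹).im ∂ρ := by
  obtain ⟨μ, hμ⟩ := circle_rep (fun w => g (I * (1 + w) / (1 - w)))
    (hg.1.comp (by
      intro w hw
      have := one_sub_ne hw
      apply DifferentiableAt.differentiableWithinAt
      fun_prop (disch := assumption)) (fun w hw => cayley_inv_im hw))
    (fun w hw => hg.2 _ (cayley_inv_im hw))
  have key : ∀ z : ℂ, 0 < z.im → ENNReal.ofReal (g z).im =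
      ∫⁻ ζ : Circle, ENNReal.ofReal (poissonKernel 0 ((z - I) / (z + I)) (ζ:ℂ)) ∂(μ : Measure Circle) := by
    intro z hz
    have h1 := hμ _ (cayley_mem hz)
    rw [cayley_inv hz] at h1
    rw [h1]
    apply ofReal_integral_eq_lintegral_ofReal
    · exact (BoundedContinuousFunction.mkOfCompact ⟨_, pk_cont _ (cayley_mem hz)⟩).integrable _
    · exact Eventually.of_forall fun ζ => pk_nonneg (cayley_mem hz) ζ
  have hatom : (μ : Measure Circle) {1} = 0 := by
    by_contra hne
    have hfin : (μ : Measure Circle) {1} ≠ ⊤ := measure_ne_top _ _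
    set m := ((μ : Measure Circle) {1}).toReal with hm
    have hmpos : 0 < m := ENNReal.toReal_pos hne hfin
    have hle : ∀ y : ℝ, 0 < y → y * m ≤ (g ((y:ℂ) * I)).im := by
      intro y hy
      have hz : 0 < ((y:ℂ) * I).im := by simpa using hy
      have hk := key _ hz
      have h2 : ENNReal.ofReal y * (μ : Measure Circle) {1} ≤ ENNReal.ofReal (g ((y:ℂ) * I)).im := by
        rw [hk]
        refine le_trans ?_ (setLIntegral_le_lintegral {1} _)
        rw [lintegral_singleton, Circle.coe_one, pk_one hz]
        simp
      rw [← ENNReal.ofReal_toReal hfin, ← ENNReal.ofReal_mul hy.le] at h2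
      exact (ENNReal.ofReal_le_ofReal_iff (hg.2 _ hz).le).1 h2
    have h3 : Tendsto (fun y : ℝ => y * (y * m)) atTop atTop :=
      tendsto_id.atTop_mul_atTop₀ (tendsto_id.atTop_mul_const hmpos)
    have h4 : Tendsto (fun y : ℝ => y * (g ((y : ℂ) * I)).im) atTop atTop := by
      apply tendsto_atTop_mono' _ _ h3
      filter_upwards [eventually_gt_atTop 0] with y hy
      exact mul_le_mul_of_nonneg_left (hle y hy) hy.le
    exact not_tendsto_nhds_of_tendsto_atTop h4 _ h
  have hae : ∀ᵐ ζ : Circle ∂(μ : Measure Circle), (ζ:ℂ) ≠ 1 := by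
    have e1 : {ζ : Circle | ¬ ((ζ:ℂ) ≠ 1)} = {(1 : Circle)} := by
      ext ζ
      simp only [ne_eq, not_not, mem_setOf_eq, mem_singleton_iff]
      exact ⟨fun h => Circle.ext h, fun h => by rw [h]; rfl⟩
    rw [ae_iff, e1]
    exact hatom
  have hTm := cT_measurable
  refine ⟨((μ : Measure Circle).withDensity (fun ζ => ENNReal.ofReal (1 + cT ζ ^ 2))).map cT, ?_⟩
  intro z hz
  rw [lintegral_map (by fun_prop) hTm, lintegral_withDensity_eq_lintegral_mul _ (by fun_prop)
    (by fun_prop), key z hz]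
  apply lintegral_congr_ae
  filter_upwards [hae] with ζ hζ
  rw [pk_eq hζ hz, ENNReal.ofReal_mul (by positivity)]
  rfl

lemma mass_eq (g : ℂ → ℂ) (a : ℝ)
    (h : Tendsto (fun y : ℝ => y * (g ((y : ℂ) * I)).im) atTop (nhds a)) (ρ : Measure ℝ)
    (hρ : ∀ z : ℂ, 0 < z.im →
      ENNReal.ofReal (g z).im = ∫⁻ t : ℝ, ENNReal.ofReal (((t:ℂ) - z)⁻¹).im ∂ρ) :
    ρ Set.univ = ENNReal.ofReal a := by
  have h1 : Tendsto (fun n : ℕ => ENNReal.ofReal (((n:ℝ) + 1) * (g ((((n:ℝ) + 1 : ℝ) : ℂ) * I)).im))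
      atTop (nhds (ENNReal.ofReal a)) := by
    apply ENNReal.tendsto_ofReal
    exact h.comp (tendsto_atTop_add_const_right _ 1 tendsto_natCast_atTop_atTop)
  have e : ∀ (t y : ℝ), 0 < y → y * (((t:ℂ) - (y:ℂ) * I)⁻¹).im = 1 - t ^ 2 / (t ^ 2 + y ^ 2) := by
    intro t y hy
    have : t ^ 2 + y ^ 2 ≠ 0 := by positivity
    have h2 : normSq ((t:ℂ) - (y:ℂ) * I) = t ^ 2 + y ^ 2 := by simp [normSq_apply]; ring
    rw [inv_im, h2]
    simp
    field_simp
    ring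
  have h2 : Tendsto (fun n : ℕ => ∫⁻ t : ℝ, ENNReal.ofReal (1 - t ^ 2 / (t ^ 2 + ((n:ℝ) + 1) ^ 2)) ∂ρ)
      atTop (nhds (∫⁻ t : ℝ, 1 ∂ρ)) := by
    apply lintegral_tendsto_of_tendsto_of_monotone
    · intro n
      fun_prop
    · apply Eventually.of_forall
      intro t n m hnm
      apply ENNReal.ofReal_le_ofReal
      have : (n:ℝ) ≤ m := by exact_mod_cast hnm
      gcongr
    · apply Eventually.of_forall
      intro t
      have h0 : Tendsto (fun n : ℕ => t ^ 2 / (t ^ 2 + ((n:ℝ) + 1) ^ 2)) atTop (nhds 0) := by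
        apply tendsto_const_nhds.div_atTop
        apply tendsto_atTop_add_const_left
        exact (tendsto_pow_atTop (by norm_num)).comp
          (tendsto_atTop_add_const_right _ 1 tendsto_natCast_atTop_atTop)
      have := ENNReal.tendsto_ofReal (h0.const_sub 1)
      simpa using this
  have h3 := tendsto_nhds_unique (h2.congr fun n => ?_) h1
  · simpa using h3
  · have hn : (0:ℝ) < (n:ℝ) + 1 := by positivity
    rw [ENNReal.ofReal_mul hn.le, hρ _ (by simpa using hn), ← lintegral_const_mul _ (by fun_prop)]
    congr 1
    ext t
    rw [← ENNReal.ofReal_mul hn.le, e t _ hn]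

lemma upper_preconnected : IsPreconnected {z : ℂ | 0 < z.im} :=
  (convex_halfSpace_im_gt 0).isPreconnected

lemma backward (g : ℂ → ℂ) (hg : IsHerglotz g) (a : ℝ) (ha : 0 < a)
    (h : Tendsto (fun y : ℝ => (y : ℂ) * g ((y : ℂ) * I)) atTop (nhds ((a : ℂ) * I))) :
    ∃ ρ : Measure ℝ, IsFiniteMeasure ρ ∧ ρ Set.univ = ENNReal.ofReal a ∧
      ∀ z : ℂ, 0 < z.im → g z = ∫ t : ℝ, ((t:ℂ) - z)⁻¹ ∂ρ := by
  have him : Tendsto (fun y : ℝ => y * (g ((y : ℂ) * I)).im) atTop (nhds a) := by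
    have := (Complex.continuous_im.tendsto _).comp h
    simpa [Function.comp_def] using this
  obtain ⟨ρ, hρ⟩ := im_rep g hg a him
  have hmass := mass_eq g a him ρ hρ
  have hfin : IsFiniteMeasure ρ := ⟨by rw [hmass]; exact ENNReal.ofReal_lt_top⟩
  refine ⟨ρ, hfin, hmass, ?_⟩
  set H : ℂ → ℂ := fun z => ∫ t : ℝ, ((t:ℂ) - z)⁻¹ ∂ρ with hH
  have hHim : ∀ z : ℂ, 0 < z.im → (H z).im = (g z).im := by
    intro z hz
    have e1 : (H z).im = ∫ t : ℝ, (((t:ℂ) - z)⁻¹).im ∂ρ :=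
      (Complex.imCLM.integral_comp_comm (resolv_integrable ρ hz)).symm
    rw [e1, integral_eq_lintegral_of_nonneg_ae
      (Eventually.of_forall fun t => inv_im_nonneg t hz)
      (Measurable.aestronglyMeasurable (by fun_prop)), ← hρ z hz,
      ENNReal.toReal_ofReal (hg.2 z hz).le]
  have hopen : IsOpen {z : ℂ | 0 < z.im} := isOpen_lt continuous_const Complex.continuous_im
  have hHd : DifferentiableOn ℂ H {z : ℂ | 0 < z.im} := by
    have h1 := (analyticOn_resolventTransform (𝕜 := ℝ) (μ := ρ)).differentiableOn
    have e1 : resolventTransform ρ = H := by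
      ext z
      simp [resolventTransform, resolvent, hH, Ring.inverse_eq_inv]
    rw [e1] at h1
    apply h1.mono
    rintro z hz ⟨t, -, rfl⟩
    simp at hz
  have han : AnalyticOnNhd ℂ (fun z => g z - H z) {z : ℂ | 0 < z.im} :=
    (hg.1.sub hHd).analyticOnNhd hopen
  obtain ⟨c, hc⟩ := han.eq_const_of_im_eq_const (c₀ := 0)
    (by intro z hz; simp [hHim z hz]) hopen
    ⟨⟨I, by simp⟩, upper_preconnected⟩
  have hc' : ∀ z : ℂ, 0 < z.im → g z - H z = c := fun z hz => hc z hz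
  have hfw := forward ρ a ha hmass
  have hdiff := h.sub hfw
  rw [sub_self] at hdiff
  have hinv : Tendsto (fun y : ℝ => ((y⁻¹ : ℝ) : ℂ)) atTop (nhds ((0:ℝ):ℂ)) :=
    (Complex.continuous_ofReal.tendsto 0).comp tendsto_inv_atTop_zero
  have hprod := hinv.mul hdiff
  have hcz : c = 0 := by
    have hconst : Tendsto (fun _ : ℝ => c) atTop (nhds 0) := by
      rw [mul_zero] at hprod
      apply hprod.congr'
      filter_upwards [eventually_gt_atTop 0] with y hy
      have hy' : (y:ℂ) ≠ 0 := by exact_mod_cast hy.ne'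
      rw [← hc' ((y:ℂ) * I) (by simpa using hy)]
      simp only [hH]
      push_cast
      field_simp
    exact tendsto_nhds_unique tendsto_const_nhds hconst
  intro z hz
  have := hc' z hz
  rw [hcz, sub_eq_zero] at this
  exact this

/-- Lemma 3.2: a Herglotz function `g` has the representation `g(z) = ∫ dρ(t)/(t-z)` with a
finite measure `ρ` of total mass `a > 0` if and only if `lim_{y→∞} y g(iy) = i a`. -/
theorem statement10 (g : ℂ → ℂ) (hg : IsHerglotz g) (a : ℝ) (ha : 0 < a) :
    (∃ ρ : Measure ℝ, IsFiniteMeasure ρ ∧ ρ Set.univ = ENNReal.ofReal a ∧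
      ∀ z : ℂ, 0 < z.im → g z = ∫ t : ℝ, ((t:ℂ) - z)⁻¹ ∂ρ) ↔
    Tendsto (fun y : ℝ => (y : ℂ) * g ((y : ℂ) * I)) atTop (nhds ((a : ℂ) * I)) := by
  constructor
  · rintro ⟨ρ, hfin, hmass, hrep⟩
    refine (forward ρ a ha hmass).congr' ?_
    filter_upwards [eventually_gt_atTop 0] with y hy
    rw [hrep _ (by simpa using hy)]
  · exact backward g hg a ha
end
end
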